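/- arXiv:1812.09098 — 3 statements merged into one kernel-verified Lean document; each statement's English description precedes it below -/
import Mathlib

section
/- For n ≥ 1, the q-binomial-Eulerian polynomial admits the gamma-expansion Ã_n(t,q) = ∑_{k=0}^{⌊n/2⌋} γ̃_{n,k}(q) t^k (1+t)^{n-2k}, where γ̃_{n,k}(q) = ∑ q^{inv(σ)} over permutations σ ∈ S_n with no non-initial double descents and exactly k descents. -/
open Finset

/-- A permutation of `Fin n` viewed as a function `ℕ → ℕ` (0-based), identity outside. -/
def pf {n : ℕ} (π : Equiv.Perm (Fin n)) (i : ℕ) : ℕ :=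
  if h : i < n then (π ⟨i, h⟩ : ℕ) else i

/-- Number of descents. -/
def desN {n : ℕ} (π : Equiv.Perm (Fin n)) : ℕ :=
  ((range (n - 1)).filter (fun i => pf π (i + 1) < pf π i)).card

/-- Number of inversions. -/
def invN {n : ℕ} (π : Equiv.Perm (Fin n)) : ℕ :=
  (((range n) ×ˢ (range n)).filter (fun p => p.1 < p.2 ∧ pf π p.2 < pf π p.1)).card

/-- Number of excedances. -/
def excN {n : ℕ} (π : Equiv.Perm (Fin n)) : ℕ :=
  ((range n).filter (fun i => i < pf π i)).card

/-- Major index. -/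
def majN {n : ℕ} (π : Equiv.Perm (Fin n)) : ℕ :=
  ∑ i ∈ (range (n - 1)).filter (fun i => pf π (i + 1) < pf π i), (i + 1)

/-- Number of admissible inversions. -/
def aiN {n : ℕ} (π : Equiv.Perm (Fin n)) : ℕ :=
  (((range n) ×ˢ (range n)).filter (fun p => p.1 < p.2 ∧ pf π p.2 < pf π p.1 ∧
    ((0 < p.1 ∧ pf π (p.1 - 1) < pf π p.1) ∨ ∃ k < p.2, p.1 < k ∧ pf π p.1 < pf π k))).card

/-- The classical Eulerian polynomial `A_n(t) = ∑_{π ∈ S_n} t^{des π}`. -/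
def eulerPoly (R : Type*) [CommRing R] (n : ℕ) (t : R) : R :=
  ∑ π : Equiv.Perm (Fin n), t ^ desN π

/-- The (maj, exc) q-Eulerian polynomial `A_n(t,q)`. -/
def Aq (R : Type*) [CommRing R] (n : ℕ) (t q : R) : R :=
  ∑ π : Equiv.Perm (Fin n), t ^ excN π * q ^ (majN π - excN π)

/-- The Gaussian binomial coefficient (as a value at `q`), via the q-Pascal recurrence. -/
def gaussR {R : Type*} [CommRing R] (q : R) : ℕ → ℕ → R
  | _, 0 => 1
  | 0, _ + 1 => 0
  | n + 1, k + 1 => gaussR q n k + q ^ (k + 1) * gaussR q n (k + 1)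

/-- The q-binomial-Eulerian polynomial `Ã_n(t,q)`. -/
def Atilde (R : Type*) [CommRing R] (n : ℕ) (t q : R) : R :=
  1 + t * ∑ m ∈ Icc 1 n, gaussR q n m * Aq R m t q

/-- Membership in PRW: if the permutation has an ascent, then the first ascent
carries the smallest letter. -/
def isPRW {n : ℕ} (π : Equiv.Perm (Fin n)) : Prop :=
  ∀ i < n, i + 1 < n → pf π i < pf π (i + 1) →
    (∀ j < i, ¬ pf π j < pf π (j + 1)) → pf π i = 0

instance {n : ℕ} : DecidablePred (isPRW (n := n)) := fun _ => by
  unfold isPRW; infer_instance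

/-- 1-based entries with boundary convention `σ₀ = σ_{n+1} = +∞` (encoded as `n`). -/
def extv {n : ℕ} (π : Equiv.Perm (Fin n)) (i : ℕ) : ℕ :=
  if 1 ≤ i ∧ i ≤ n then pf π (i - 1) else n

/-- Number of non-initial double descents. -/
def ddN {n : ℕ} (π : Equiv.Perm (Fin n)) : ℕ :=
  ((Icc 2 n).filter (fun i => extv π (i + 1) < extv π i ∧ extv π i < extv π (i - 1))).card


namespace QBE

section Alg
variable {K : Type*} [Field K]

/-- q-Pochhammer `(q)_n`. -/
def qp (q : K) (n : ℕ) : K := ∏ i ∈ range n, (1 - q ^ (i + 1))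

lemma qp_ne {q : K} (hq : ∀ n, 1 ≤ n → 1 - q ^ n ≠ 0) (n : ℕ) : qp q n ≠ 0 := by
  unfold qp
  exact Finset.prod_ne_zero_iff.mpr fun i _ => hq _ (by omega)

lemma qp_succ (q : K) (n : ℕ) : qp q (n + 1) = qp q n * (1 - q ^ (n + 1)) := by
  unfold qp; rw [prod_range_succ]

lemma qp_zero (q : K) : qp q 0 = 1 := by simp [qp]

open PowerSeries

/-- The q-exponential. -/
noncomputable def HH (q : K) : K⟦X⟧ := PowerSeries.mk fun n => (qp q n)⁻¹

lemma HH_q {q : K} (hq : ∀ n, 1 ≤ n → 1 - q ^ n ≠ 0) :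
    rescale q (HH q) = (1 - X) * HH q := by
  ext n
  rw [sub_mul, one_mul, map_sub, coeff_rescale]
  cases n with
  | zero => simp [HH, qp]
  | succ n =>
    rw [coeff_succ_X_mul]
    simp only [HH, coeff_mk, qp_succ]
    have := qp_ne hq n
    have := hq (n+1) (by omega)
    field_simp
    ring

lemma HH_tq {q : K} (hq : ∀ n, 1 ≤ n → 1 - q ^ n ≠ 0) (t : K) :
    rescale q (rescale t (HH q)) = (1 - C t * X) * rescale t (HH q) := by
  have : rescale q (rescale t (HH q)) = rescale t (rescale q (HH q)) := by
    rw [rescale_rescale, rescale_rescale, mul_comm]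
  rw [this, HH_q hq, map_mul, map_sub, map_one, rescale_X]

/-- `∑ z^u Q_u`. -/
noncomputable def Ss (Q : ℕ → K⟦X⟧) : K⟦X⟧ :=
  PowerSeries.mk fun N => ∑ u ∈ range (N + 1), coeff (N - u) (Q u)

lemma coeff_Ss (Q : ℕ → K⟦X⟧) (N M : ℕ) (h : N < M) :
    coeff N (Ss Q) = coeff N (∑ u ∈ range M, X ^ u * Q u) := by
  rw [map_sum, Ss, coeff_mk]
  rw [← sum_subset (s₁ := range (N + 1)) (s₂ := range M)]
  · refine sum_congr rfl fun u hu => ?_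
    rw [coeff_X_pow_mul', if_pos (by simp at hu; omega)]
  · intro x hx; simp at *; omega
  · intro u _ hu
    rw [coeff_X_pow_mul', if_neg (by simp at hu; omega)]

lemma mul_Ss (a : K⟦X⟧) (Q : ℕ → K⟦X⟧) : a * Ss Q = Ss (fun u => a * Q u) := by
  ext N
  rw [coeff_Ss _ N (N + 1) (by omega), coeff_mul]
  have : ∀ x ∈ antidiagonal N, coeff x.1 a * coeff x.2 (Ss Q) =
      coeff x.1 a * coeff x.2 (∑ u ∈ range (N + 1), X ^ u * Q u) := by
    intro x hx
    rw [coeff_Ss _ x.2 (N + 1)]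
    have := mem_antidiagonal.mp hx
    omega
  rw [sum_congr rfl this, ← coeff_mul, mul_sum]
  congr 1
  refine sum_congr rfl fun u _ => by ring

lemma Ss_succ (Q : ℕ → K⟦X⟧) : Ss Q = Q 0 + X * Ss (fun u => Q (u + 1)) := by
  ext N
  rw [coeff_Ss _ N (N + 2) (by omega), sum_range_succ', mul_Ss, map_add, map_add,
    coeff_Ss _ N (N + 1) (by omega), pow_zero, one_mul, add_comm]
  congr 2
  refine sum_congr rfl fun u _ => by ring

lemma Ss_add (P Q : ℕ → K⟦X⟧) : Ss (fun u => P u + Q u) = Ss P + Ss Q := by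
  ext N
  simp [Ss, sum_add_distrib]

lemma Ss_geom (c : K⟦X⟧) (j : ℕ) :
    (1 - X * c) ^ j * Ss (fun u => (Nat.multichoose j u : K⟦X⟧) * c ^ u) = 1 := by
  induction j with
  | zero =>
    rw [Ss_succ]
    have : (Ss fun u => ((Nat.multichoose 0 (u + 1) : ℕ) : K⟦X⟧) * c ^ (u + 1)) = 0 := by
      ext N; simp [Ss]
    rw [this]; simp
  | succ j ih =>
    refine Eq.trans ?_ ih
    rw [pow_succ, mul_assoc]
    congr 1
    rw [sub_mul, one_mul, mul_assoc X, mul_Ss c]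
    rw [Ss_succ (fun u => (Nat.multichoose (j+1) u : K⟦X⟧) * c ^ u),
      Ss_succ (fun u => (Nat.multichoose j u : K⟦X⟧) * c ^ u)]
    have : (fun u => (Nat.multichoose (j+1) (u + 1) : K⟦X⟧) * c ^ (u + 1)) =
      fun u => (Nat.multichoose j (u + 1) : K⟦X⟧) * c ^ (u + 1) +
        c * ((Nat.multichoose (j+1) u : K⟦X⟧) * c ^ u) := by
      ext1 u
      rw [Nat.multichoose_succ_succ]; push_cast; ring
    rw [this, Ss_add]
    simp
    ring

/-- Binomial inversion. -/
lemma binom_inv (c h : ℕ → K) (hc : ∀ M, ∑ m ∈ range (M + 1), (Nat.choose M m : K) * c m = h M)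
    (m : ℕ) : c m = ∑ j ∈ range (m + 1), (-1) ^ (m - j) * (Nat.choose m j : K) * h j := by
  have key : ∀ c' : ℕ → K, (∀ M, ∑ m ∈ range (M + 1), (Nat.choose M m : K) * c' m = h M) →
      ∀ c'' : ℕ → K, (∀ M, ∑ m ∈ range (M + 1), (Nat.choose M m : K) * c'' m = h M) → c' = c'' := by
    intro c' h' c'' h''
    ext m
    induction m using Nat.strong_induction_on with
    | _ m ih =>
      have e1 := h' m
      have e2 := h'' m
      rw [sum_range_succ] at e1 e2
      rw [sum_congr rfl (g := fun x => (Nat.choose m x : K) * c'' x)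
        (fun x hx => by rw [ih x (by simpa using hx)])] at e1
      have := e1.trans e2.symm
      simpa using this
  refine congrFun (key c hc (fun m => ∑ j ∈ range (m + 1), (-1) ^ (m - j) * (Nat.choose m j : K) * h j) ?_) m
  intro M
  simp_rw [mul_sum]
  rw [sum_sigma']
  have e : ∑ x ∈ (range (M+1)).sigma (fun a => range (a + 1)),
      (Nat.choose M x.1 : K) * ((-1) ^ (x.1 - x.2) * (Nat.choose x.1 x.2 : K) * h x.2) =
      ∑ x ∈ (range (M+1)).sigma (fun j => range (M - j + 1)),
        (Nat.choose M x.1 : K) * ((Nat.choose (M - x.1) x.2 : K) * (-1) ^ x.2) * h x.1 := by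
    refine sum_nbij' (fun x => ⟨x.2, x.1 - x.2⟩) (fun x => ⟨x.1 + x.2, x.1⟩) ?_ ?_ ?_ ?_ ?_
    · rintro ⟨a, b⟩ h; simp at *; omega
    · rintro ⟨a, b⟩ h; simp at *; omega
    · rintro ⟨a, b⟩ h; simp at *; omega
    · rintro ⟨a, b⟩ h; simp at *
    · rintro ⟨a, b⟩ hab
      simp only [mem_sigma, mem_range] at hab
      have := Nat.choose_mul (n := M) (k := a) (s := b) (by omega)
      have : (Nat.choose M a : K) * Nat.choose a b = Nat.choose M b * Nat.choose (M - b) (a - b) := by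
        rw [← Nat.cast_mul, ← Nat.cast_mul, this]
      dsimp only
      linear_combination (-1)^(a-b) * h b * this
  rw [e, sum_sigma]
  have e2 : ∀ j ∈ range (M+1), ∑ s ∈ range (M - j + 1),
        (Nat.choose M j : K) * ((Nat.choose (M - j) s : K) * (-1) ^ s) * h j =
        if j = M then h M else 0 := by
    intro j hj
    rw [← sum_mul, ← mul_sum]
    have h1 : ∑ s ∈ range (M - j + 1), ((Nat.choose (M - j) s : K) * (-1) ^ s) = if M - j = 0 then 1 else 0 := by
      have := add_pow (-1 : K) 1 (M - j)
      simp only [neg_add_cancel, one_pow, mul_one] at this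
      rw [zero_pow_eq] at this
      rw [this]
      exact sum_congr rfl fun _ _ => by ring
    rw [h1]
    simp at hj
    by_cases hjM : j = M
    · subst hjM; simp
    · rw [if_neg (by omega), if_neg hjM]; simp
  rw [sum_congr rfl e2]
  simp

/-- Denominator. -/
noncomputable def DD (t q : K) : K⟦X⟧ := rescale t (HH q) - C t * HH q

/-- The generating function of `A_n / (q)_n`. -/
noncomputable def FF (t q : K) : K⟦X⟧ := C (1 - t) * HH q * (DD t q)⁻¹

noncomputable def YY (t q : K) : K⟦X⟧ := C (1 - t) * rescale t (HH q) * (DD t q)⁻¹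

lemma DD_const (t q : K) : constantCoeff (DD t q) = 1 - t := by
  rw [← coeff_zero_eq_constantCoeff_apply, DD, map_sub, coeff_rescale, coeff_C_mul]
  simp [HH, qp]

lemma HH_const (q : K) : constantCoeff (HH q) = 1 := by
  rw [← coeff_zero_eq_constantCoeff_apply]; simp [HH, qp]

lemma DD_ne {t : K} (ht : t ≠ 1) (q : K) : DD t q ≠ 0 := by
  intro h
  have := DD_const t q
  rw [h, map_zero] at this
  exact ht (sub_eq_zero.mp this.symm).symm

lemma DD_inv {t : K} (ht : t ≠ 1) (q : K) : DD t q * (DD t q)⁻¹ = 1 := by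
  apply PowerSeries.mul_inv_cancel
  rw [DD_const]
  exact sub_ne_zero.mpr ht.symm

lemma FF_DD {t : K} (ht : t ≠ 1) (q : K) : FF t q * DD t q = C (1 - t) * HH q := by
  rw [FF, mul_assoc, mul_comm _ (DD t q), DD_inv ht, mul_one]

lemma YY_DD {t : K} (ht : t ≠ 1) (q : K) : YY t q * DD t q = C (1 - t) * rescale t (HH q) := by
  rw [YY, mul_assoc, mul_comm _ (DD t q), DD_inv ht, mul_one]

/-- candidate -/
noncomputable def Ast (t q : K) (n m : ℕ) : K := qp q n * coeff n (FF t q * (YY t q - 1) ^ m)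

lemma sum_Ast (t q : K) (n M : ℕ) : ∑ m ∈ range (M + 1), (Nat.choose M m : K) * Ast t q n m =
    qp q n * coeff n (FF t q * (YY t q) ^ M) := by
  have : YY t q = (YY t q - 1) + 1 := by ring
  conv_rhs => rw [this, add_pow, mul_sum, map_sum, mul_sum]
  refine sum_congr rfl fun m _ => ?_
  have : FF t q * ((YY t q - 1) ^ m * 1 ^ (M - m) * (M.choose m : K⟦X⟧)) =
    C (M.choose m : K) * (FF t q * (YY t q - 1) ^ m) := by simp; ring
  rw [this, coeff_C_mul, Ast]
  ring

/-- prefix transform -/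
noncomputable def Apr (A : ℕ → ℕ → K) (n b m : ℕ) : K :=
  ∑ j ∈ range (m + 1), (-1) ^ (m - j) * (Nat.choose m j : K) *
    ((Nat.multichoose j b : K) * ∑ d ∈ range (j + 1), (Nat.choose j d : K) * A n d)

/-- `Σ_b mc(j,b) t^b z^b` -/
noncomputable def St (t : K) (j : ℕ) : K⟦X⟧ := PowerSeries.mk fun b => (Nat.multichoose j b : K) * t ^ b

lemma St_mul (t : K) (j : ℕ) : (1 - X * C t) ^ j * St t j = 1 := by
  have := Ss_geom (C t) j
  convert this using 2
  ext b
  rw [St, coeff_mk, Ss, coeff_mk, sum_range_succ, Nat.sub_self]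
  rw [sum_eq_zero]
  · simp only [zero_add, ← map_pow]
    rw [mul_comm ((Nat.multichoose j b : ℕ) : K⟦X⟧), coeff_C_mul]
    simp [mul_comm]
  · intro x hx
    simp at hx
    rw [← map_pow, mul_comm ((Nat.multichoose j x : ℕ) : K⟦X⟧), coeff_C_mul]
    have : ((Nat.multichoose j x : ℕ) : K⟦X⟧) = C (Nat.multichoose j x : K) := by simp
    rw [this, coeff_C, if_neg (by omega), mul_zero]

lemma coeff_Apr {t q : K} (hq : ∀ n, 1 ≤ n → 1 - q ^ n ≠ 0) (Z : K⟦X⟧) (hZ : (1 - X * C t) * Z = 1)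
    (m N : ℕ) :
    ∑ x ∈ antidiagonal N, q ^ x.1 * t ^ x.2 / qp q x.1 * Apr (Ast t q) x.1 x.2 m =
      coeff N (rescale q (FF t q) * (rescale q (YY t q) * Z - 1) ^ m) := by
  have hSt : ∀ j, St t j = Z ^ j := by
    intro j
    have h1 := St_mul t j
    have h2 : (1 - X * C t) ^ j * Z ^ j = 1 := by rw [← mul_pow, hZ, one_pow]
    have h3 : (1 - X * C t) ^ j ≠ 0 := by
      intro h; rw [h, zero_mul] at h1; exact zero_ne_one h1
    exact mul_left_cancel₀ h3 (h1.trans h2.symm)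
  rw [sub_eq_add_neg, add_pow, mul_sum, map_sum]
  simp_rw [Apr, mul_sum (s := range (m + 1))]
  rw [sum_comm]
  refine sum_congr rfl fun j hj => ?_
  have : rescale q (FF t q) * ((rescale q (YY t q) * Z) ^ j * (-1) ^ (m - j) * (m.choose j : K⟦X⟧)) =
    C ((-1) ^ (m - j) * (m.choose j : K)) * (rescale q (FF t q * YY t q ^ j) * St t j) := by
    rw [hSt]; simp; ring
  rw [this, coeff_C_mul, coeff_mul, mul_sum]
  refine sum_congr rfl fun x _ => ?_
  rw [coeff_rescale, St, coeff_mk, sum_Ast]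
  have := qp_ne hq x.1
  field_simp

theorem alg_main {t q : K} (hq : ∀ n, 1 ≤ n → 1 - q ^ n ≠ 0) (ht : t ≠ 1)
    (A : ℕ → ℕ → K) (A' : ℕ → ℕ → ℕ → K)
    (h0 : ∀ m, A 0 m = if m = 0 then 1 else 0)
    (h1 : ∀ n b M, ∑ m ∈ range (M + 1), (Nat.choose M m : K) * A' n b m =
      (Nat.multichoose M b : K) * ∑ m ∈ range (M + 1), (Nat.choose M m : K) * A n m)
    (h2 : ∀ N m, A N m / qp q N = ∑ u ∈ range (N + 1), ∑ x ∈ antidiagonal (N - u),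
      q ^ x.1 * t ^ x.2 / qp q x.1 * ∑ s ∈ range (u + 1),
        (Nat.choose u s : K) * (Nat.multichoose (m + 1) u : K) * A' x.1 x.2 (m + s))
    (N m : ℕ) : A N m = Ast t q N m := by
  -- the candidate satisfies the recursion
  obtain ⟨Z, hZ⟩ : ∃ Z : K⟦X⟧, (1 - X * C t) * Z = 1 :=
    ⟨(1 - X * C t)⁻¹, PowerSeries.mul_inv_cancel _ (by simp)⟩
  have hA' : ∀ n b m, A' n b m = Apr A n b m := fun n b m => binom_inv _ _ (h1 n b) m
  have hst : ∀ N m, Ast t q N m / qp q N = ∑ u ∈ range (N + 1), ∑ x ∈ antidiagonal (N - u),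
      q ^ x.1 * t ^ x.2 / qp q x.1 * ∑ s ∈ range (u + 1),
        (Nat.choose u s : K) * (Nat.multichoose (m + 1) u : K) *
          Apr (Ast t q) x.1 x.2 (m + s) := by
    intro N m
    set V := rescale q (YY t q) * Z - 1 with hV
    set Fh := rescale q (FF t q) with hFh
    have e1 : ∀ u ∈ range (N + 1), ∑ x ∈ antidiagonal (N - u),
      q ^ x.1 * t ^ x.2 / qp q x.1 * ∑ s ∈ range (u + 1),
        (Nat.choose u s : K) * (Nat.multichoose (m + 1) u : K) *
          Apr (Ast t q) x.1 x.2 (m + s) = coeff (N - u)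
            (Fh * V ^ m * ((Nat.multichoose (m + 1) u : K⟦X⟧) * (1 + V) ^ u)) := by
      intro u _
      simp_rw [mul_sum]
      rw [sum_comm, add_comm 1 V, add_pow, mul_sum, mul_sum, map_sum]
      refine sum_congr rfl fun s _ => ?_
      have : Fh * V ^ m * ((Nat.multichoose (m + 1) u : K⟦X⟧) * (V ^ s * 1 ^ (u - s) * (u.choose s : K⟦X⟧)))
        = C ((u.choose s : K) * (Nat.multichoose (m + 1) u : K)) * (Fh * V ^ (m + s)) := by
        simp; ring
      rw [this, coeff_C_mul, ← coeff_Apr hq Z hZ, mul_sum]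
      exact sum_congr rfl fun x _ => by ring
    rw [sum_congr rfl e1]
    have e2 : ∑ u ∈ range (N + 1), coeff (N - u)
            (Fh * V ^ m * ((Nat.multichoose (m + 1) u : K⟦X⟧) * (1 + V) ^ u)) =
        coeff N (Fh * V ^ m * Ss (fun u => (Nat.multichoose (m + 1) u : K⟦X⟧) * (1 + V) ^ u)) := by
      rw [mul_Ss, Ss, coeff_mk]
    rw [e2, Ast, mul_div_cancel_left₀ _ (qp_ne hq N)]
    congr 1
    have hg := Ss_geom (1 + V) (m + 1)
    set S := Ss (fun u => (Nat.multichoose (m + 1) u : K⟦X⟧) * (1 + V) ^ u)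
    set Q := 1 - X * (1 + V) with hQ
    -- claims
    have hD := DD_ne ht q
    have eF := FF_DD ht q
    have eY := YY_DD ht q
    have eFh := congrArg (rescale q) eF
    have eYh := congrArg (rescale q) eY
    have hC : ∀ a : K, rescale q (C a) = C a := by
      intro a; ext n; rw [coeff_rescale, coeff_C]; split_ifs with h
      · simp [h]
      · simp
    have eDh : rescale q (DD t q) = (1 - C t * X) * rescale t (HH q) - C t * ((1 - X) * HH q) := by
      rw [DD, map_sub, map_mul, HH_tq hq, HH_q hq, hC]
    rw [map_mul, map_mul, HH_q hq, hC, ← hFh] at eFh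
    rw [map_mul, map_mul, HH_tq hq, hC] at eYh
    set Dh := rescale q (DD t q) with hDh
    have hDh0 : Dh ≠ 0 := by
      intro h
      have : constantCoeff Dh = 1 - t := by
        rw [← coeff_zero_eq_constantCoeff_apply, hDh, coeff_rescale,
          coeff_zero_eq_constantCoeff_apply, DD_const]; simp
      rw [h, map_zero] at this
      exact ht (sub_eq_zero.mp this.symm).symm
    have hX1 : (1 - X : K⟦X⟧) ≠ 0 := by
      intro h
      have := congrArg constantCoeff h
      simp at this
    have hDdef : DD t q = rescale t (HH q) - C t * HH q := rfl
    set Ht := rescale t (HH q)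
    set H := HH q
    have hC1 : (C (1 - t) : K⟦X⟧) = 1 - C t := by simp
    have eV : (1 + V) * Dh = C (1 - t) * Ht := by
      rw [hV]; linear_combination Z * eYh + C (1 - t) * Ht * hZ
    have eQ : Q * Dh = (1 - X) * DD t q := by
      rw [hQ, hDdef]; rw [hC1] at eV; linear_combination eDh - X * eV
    have hQ0 : Q ≠ 0 := by
      intro h; rw [h, zero_mul] at eQ
      exact mul_ne_zero hX1 hD eQ.symm
    have eFQ : FF t q * Q = Fh := by
      apply mul_right_cancel₀ hDh0
      rw [eFh]
      linear_combination FF t q * eQ + (1 - X) * eF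
    have eWQ : (YY t q - 1) * Q = V := by
      apply mul_right_cancel₀ hDh0
      rw [hC1] at eV eY
      linear_combination (YY t q - 1) * eQ + (1 - X) * eY - eV + eDh - (1 - X) * hDdef
    rw [← eFQ, ← eWQ, mul_pow]
    linear_combination - FF t q * (YY t q - 1) ^ m * hg
  induction N using Nat.strong_induction_on generalizing m with
  | _ N ih =>
  by_cases hN : N = 0
  · subst hN
    rw [h0, Ast, qp_zero, one_mul, coeff_zero_eq_constantCoeff_apply, map_mul, map_pow, map_sub]
    have hD := DD_const t q
    have h1t : (1 - t) ≠ 0 := sub_ne_zero.mpr ht.symm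
    have c1 : constantCoeff (FF t q) = 1 := by
      have := congrArg constantCoeff (FF_DD ht q)
      rw [map_mul, map_mul, hD, HH_const] at this
      simp at this
      exact mul_right_cancel₀ h1t (by rw [this, one_mul])
    have c2 : constantCoeff (YY t q) = 1 := by
      have := congrArg constantCoeff (YY_DD ht q)
      rw [map_mul, map_mul, hD, ← coeff_zero_eq_constantCoeff_apply (rescale t (HH q)), coeff_rescale,
        coeff_zero_eq_constantCoeff_apply, HH_const] at this
      simp at this
      exact mul_right_cancel₀ h1t (by rw [this, one_mul])
    rw [c1, c2]
    simp [zero_pow_eq]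
  · have ea := h2 N m
    have eb := hst N m
    simp_rw [hA'] at ea
    rw [sum_range_succ'] at ea eb
    -- isolate n = N : occurs only for u = 0, x = (N,0)
    have hAp : ∀ n, n < N → ∀ b m, Apr A n b m = Apr (Ast t q) n b m := by
      intro n hn b m
      unfold Apr
      refine sum_congr rfl fun j _ => ?_
      congr 2
      exact sum_congr rfl fun d _ => by rw [ih n hn]
    have hB : ∀ (B : ℕ → ℕ → K), Apr B N 0 m = B N m := by
      intro B
      symm
      refine binom_inv (fun m => B N m) (fun j => (Nat.multichoose j 0 : K) * ∑ d ∈ range (j + 1), (Nat.choose j d : K) * B N d) ?_ m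
      intro M; simp
    have hs1 : ∀ B : ℕ → ℕ → K, ∑ x ∈ antidiagonal (N - 0),
      q ^ x.1 * t ^ x.2 / qp q x.1 * ∑ s ∈ range (0 + 1),
        (Nat.choose 0 s : K) * (Nat.multichoose (m + 1) 0 : K) * Apr B x.1 x.2 (m + s) =
        q ^ N / qp q N * B N m + ∑ x ∈ (antidiagonal N).erase (N, 0),
          q ^ x.1 * t ^ x.2 / qp q x.1 * Apr B x.1 x.2 m := by
      intro B
      rw [Nat.sub_zero, ← add_sum_erase _ _ (show (N, 0) ∈ antidiagonal N by simp)]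
      simp [hB]
    rw [hs1] at ea eb
    have hs2 : ∑ x ∈ (antidiagonal N).erase (N, 0), q ^ x.1 * t ^ x.2 / qp q x.1 * Apr A x.1 x.2 m
      = ∑ x ∈ (antidiagonal N).erase (N, 0), q ^ x.1 * t ^ x.2 / qp q x.1 * Apr (Ast t q) x.1 x.2 m := by
      refine sum_congr rfl fun x hx => ?_
      rw [hAp]
      rcases x with ⟨x, y⟩
      simp at hx
      by_contra hxn
      have : x = N := by omega
      exact hx.1 this (by omega)
    have hs3 : ∑ u ∈ range N, ∑ x ∈ antidiagonal (N - (u + 1)),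
      q ^ x.1 * t ^ x.2 / qp q x.1 * ∑ s ∈ range (u + 1 + 1),
        (Nat.choose (u+1) s : K) * (Nat.multichoose (m + 1) (u+1) : K) * Apr A x.1 x.2 (m + s) =
        ∑ u ∈ range N, ∑ x ∈ antidiagonal (N - (u + 1)),
      q ^ x.1 * t ^ x.2 / qp q x.1 * ∑ s ∈ range (u + 1 + 1),
        (Nat.choose (u+1) s : K) * (Nat.multichoose (m + 1) (u+1) : K) *
          Apr (Ast t q) x.1 x.2 (m + s) := by
      refine sum_congr rfl fun u hu => sum_congr rfl fun x hx => ?_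
      congr 1
      refine sum_congr rfl fun s _ => ?_
      rw [hAp]
      have := mem_antidiagonal.mp hx
      simp at hu
      omega
    rw [hs2, hs3] at ea
    have hne := qp_ne hq N
    have hne2 := hq N (by omega)
    have : (A N m - Ast t q N m) * ((1 - q ^ N) / qp q N) = 0 := by
      linear_combination ea - eb
    rcases mul_eq_zero.mp this with h | h
    · exact sub_eq_zero.mp h
    · exact absurd h (div_ne_zero hne2 hne)

end Alg
end QBE


namespace QBE

/-- Injective words of length `n` with letters in `V`. -/
def LI (n : ℕ) (V : Finset ℕ) : Finset (List ℕ) :=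
  ((Fintype.piFinset fun _ : Fin n => V).image List.ofFn).filter List.Nodup

lemma mem_LI {n : ℕ} {V : Finset ℕ} {l : List ℕ} :
    l ∈ LI n V ↔ l.length = n ∧ l.Nodup ∧ ∀ x ∈ l, x ∈ V := by
  simp only [LI, mem_filter, mem_image, Fintype.mem_piFinset]
  constructor
  · rintro ⟨⟨f, hf, rfl⟩, h⟩
    refine ⟨by simp, h, ?_⟩
    intro x hx
    rw [List.mem_ofFn] at hx
    obtain ⟨i, rfl⟩ := hx
    exact hf i
  · rintro ⟨rfl, h, hV⟩
    refine ⟨⟨fun i => l[i], fun i => hV _ (List.getElem_mem _), ?_⟩, h⟩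
    apply List.ext_getElem <;> simp

variable {M : Type*} [AddCommMonoid M]

theorem split_sum (r : ℕ → ℕ → Prop) [DecidableRel r] [IsTrans ℕ r] [Std.Antisymm r] [Std.Total r]
    (n b : ℕ) (V : Finset ℕ) (F : List ℕ → M) :
    ∑ L ∈ (LI (n + b) V).filter (fun L => (L.drop n).Pairwise r), F L =
      ∑ B ∈ powersetCard b V, ∑ l ∈ LI n (V \ B), F (l ++ B.sort r) := by
  rw [sum_sigma']
  refine sum_nbij' (fun L => ⟨(L.drop n).toFinset, L.take n⟩) (fun x => x.2 ++ x.1.sort r)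
    ?_ ?_ ?_ ?_ ?_
  · intro L hL
    rw [mem_filter, mem_LI] at hL
    obtain ⟨⟨h1, h2, h3⟩, h4⟩ := hL
    rw [mem_sigma, mem_powersetCard, mem_LI]
    refine ⟨⟨?_, ?_⟩, ?_, ?_, ?_⟩
    · intro x hx
      exact h3 x (List.mem_of_mem_drop (List.mem_toFinset.mp hx))
    · rw [List.toFinset_card_of_nodup (h2.sublist (List.drop_sublist _ _))]
      simp [h1]
    · simp [h1]
    · exact h2.sublist (List.take_sublist _ _)
    · intro x hx
      rw [mem_sdiff, List.mem_toFinset]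
      refine ⟨h3 x (List.mem_of_mem_take hx), fun hx' => ?_⟩
      rw [← List.take_append_drop n L, List.nodup_append] at h2
      exact h2.2.2 _ hx _ hx' rfl
  · rintro ⟨B, l⟩ h
    rw [mem_sigma, mem_powersetCard, mem_LI] at h
    obtain ⟨⟨h1, h2⟩, h3, h4, h5⟩ := h
    dsimp only at *
    rw [mem_filter, mem_LI]
    refine ⟨⟨by simp [h2, h3], ?_, ?_⟩, ?_⟩
    · rw [List.nodup_append]
      refine ⟨h4, B.sort_nodup r, ?_⟩
      rintro a ha c hc rfl
      exact (mem_sdiff.mp (h5 a ha)).2 (by simpa using hc)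
    · intro x hx
      rw [List.mem_append] at hx
      rcases hx with hx | hx
      · exact (mem_sdiff.mp (h5 x hx)).1
      · exact h1 (by simpa using hx)
    · rw [List.drop_append_of_le_length (by omega), List.drop_eq_nil_of_le (by omega)]
      simp
  · intro L hL
    rw [mem_filter, mem_LI] at hL
    obtain ⟨⟨h1, h2, h3⟩, h4⟩ := hL
    dsimp only
    rw [(List.toFinset_sort r (h2.sublist (List.drop_sublist _ _))).mpr h4]
    exact List.take_append_drop n L
  · rintro ⟨B, l⟩ h
    rw [mem_sigma, mem_powersetCard, mem_LI] at h
    obtain ⟨⟨h1, h2⟩, h3, h4, h5⟩ := h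
    dsimp only at *
    subst h3
    simp
  · intro L hL
    rw [mem_filter, mem_LI] at hL
    obtain ⟨⟨h1, h2, h3⟩, h4⟩ := hL
    dsimp only
    rw [(List.toFinset_sort r (h2.sublist (List.drop_sublist _ _))).mpr h4]
    rw [List.take_append_drop n L]

/-- rank -/
def rk (V : Finset ℕ) (x : ℕ) : ℕ := (V.filter (· < x)).card

lemma rk_lt {V : Finset ℕ} {x y : ℕ} (hx : x ∈ V) (h : x < y) : rk V x < rk V y := by
  apply card_lt_card
  refine ⟨fun a ha => ?_, fun hs => ?_⟩
  · simp at *; exact ⟨ha.1, by omega⟩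
  · have := hs (mem_filter.mpr ⟨hx, h⟩)
    simp at this

lemma rk_lt_iff {V : Finset ℕ} {x y : ℕ} (hx : x ∈ V) (hy : y ∈ V) : rk V x < rk V y ↔ x < y := by
  constructor
  · intro h
    by_contra h'
    rcases (not_lt.mp h').lt_or_eq with h1 | h1
    · have := rk_lt hy h1; omega
    · subst h1; omega
  · exact rk_lt hx

lemma rk_inj {V : Finset ℕ} {x y : ℕ} (hx : x ∈ V) (hy : y ∈ V) (h : rk V x = rk V y) : x = y := by
  rcases lt_trichotomy x y with h1 | h1 | h1
  · have := rk_lt hx h1; omega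
  · exact h1
  · have := rk_lt hy h1; omega

lemma rk_card {V : Finset ℕ} {x : ℕ} (hx : x ∈ V) : rk V x < V.card := by
  apply card_lt_card
  refine ⟨filter_subset _ _, fun hs => ?_⟩
  have := hs hx
  simp at this

lemma rk_image (V : Finset ℕ) : V.image (rk V) = range V.card := by
  apply eq_of_subset_of_card_le
  · intro y hy
    rw [mem_image] at hy
    obtain ⟨x, hx, rfl⟩ := hy
    exact mem_range.mpr (rk_card hx)
  · rw [card_image_of_injOn, card_range]
    intro x hx y hy h
    exact rk_inj hx hy h

theorem relabel (n : ℕ) (V : Finset ℕ) (G : List ℕ → M)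
    (hG : ∀ l ∈ LI n V, G (l.map (rk V)) = G l) :
    ∑ l ∈ LI n V, G l = ∑ l ∈ LI n (range V.card), G l := by
  refine sum_bij (fun l _ => l.map (rk V)) ?_ ?_ ?_ (fun l hl => (hG l hl).symm)
  · intro l hl
    rw [mem_LI] at *
    refine ⟨by simp [hl.1], ?_, ?_⟩
    · refine (List.nodup_map_iff_inj_on hl.2.1).mpr ?_
      intro x hx y hy h
      exact rk_inj (hl.2.2 x hx) (hl.2.2 y hy) h
    · intro y hy
      rw [List.mem_map] at hy
      obtain ⟨x, hx, rfl⟩ := hy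
      exact mem_range.mpr (rk_card (hl.2.2 x hx))
  · intro l hl l' hl' h
    rw [mem_LI] at hl hl'
    apply List.ext_getElem (by omega)
    intro i h1 h2
    have : (l.map (rk V))[i]'(by simpa using h1) = (l'.map (rk V))[i]'(by simpa using h2) := by
      simp only [h]
    simp only [List.getElem_map] at this
    exact rk_inj (hl.2.2 _ (List.getElem_mem _)) (hl'.2.2 _ (List.getElem_mem _)) this
  · intro l' hl'
    rw [mem_LI] at hl'
    have hinv : ∀ y ∈ range V.card, ∃ x ∈ V, rk V x = y := by
      intro y hy
      rw [← rk_image, mem_image] at hy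
      exact hy
    choose! g hg hg' using hinv
    have hmap : (l'.map g).map (rk V) = l' := by
      rw [List.map_map]
      conv_rhs => rw [← List.map_id l']
      apply List.map_congr_left
      intro y hy
      exact hg' y (hl'.2.2 y hy)
    refine ⟨l'.map g, ?_, hmap⟩
    rw [mem_LI]
    refine ⟨by simp [hl'.1], ?_, ?_⟩
    · apply List.Nodup.of_map (rk V)
      rw [hmap]; exact hl'.2.1
    · intro x hx
      rw [List.mem_map] at hx
      obtain ⟨y, hy, rfl⟩ := hx
      exact hg y (hl'.2.2 y hy)

/-- decomposition according to the set of large letters used -/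
theorem fiber_sum (k : ℕ) (W S : Finset ℕ) (hWS : Disjoint W S) (G : List ℕ → M) :
    ∑ T ∈ S.powerset, ∑ l ∈ (LI k (W ∪ T)).filter (fun l => ∀ x ∈ T, x ∈ l), G l =
      ∑ l ∈ LI k (W ∪ S), G l := by
  rw [sum_sigma']
  refine sum_nbij' (fun x => x.2) (fun l => ⟨S.filter (· ∈ l), l⟩) ?_ ?_ ?_ ?_ ?_
  · rintro ⟨T, l⟩ h
    simp only [mem_sigma, mem_powerset, mem_filter, mem_LI, mem_union] at *
    refine ⟨h.2.1.1, h.2.1.2.1, fun x hx => ?_⟩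
    rcases h.2.1.2.2 x hx with h1 | h1
    · exact Or.inl h1
    · exact Or.inr (h.1 h1)
  · intro l h
    simp only [mem_sigma, mem_powerset, mem_filter, mem_LI, mem_union] at *
    refine ⟨filter_subset _ _, ⟨h.1, h.2.1, fun x hx => ?_⟩, fun x hx => hx.2⟩
    rcases h.2.2 x hx with h1 | h1
    · exact Or.inl h1
    · exact Or.inr ⟨h1, hx⟩
  · rintro ⟨T, l⟩ h
    simp only [mem_sigma, mem_powerset, mem_filter, mem_LI, mem_union] at *
    have : S.filter (· ∈ l) = T := by
      ext x
      rw [mem_filter]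
      constructor
      · rintro ⟨h1, h2⟩
        rcases h.2.1.2.2 x h2 with h3 | h3
        · exact absurd h1 (Finset.disjoint_left.mp hWS h3)
        · exact h3
      · intro hx; exact ⟨h.1 hx, h.2.2 x hx⟩
    rw [this]
  · intro l _; rfl
  · intro x _; rfl

/-- a set function whose subset sums depend only on cardinality depends only on cardinality -/
theorem card_only {A : Type*} [AddCommGroup A] (k : ℕ) (F : Finset ℕ → A) (h : ℕ → A)
    (hF : ∀ S : Finset ℕ, (∀ x ∈ S, k ≤ x) → ∑ T ∈ S.powerset, F T = h S.card) :
    ∀ T : Finset ℕ, (∀ x ∈ T, k ≤ x) → F T = F (Ico k (k + T.card)) := by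
  intro T
  induction hc : T.card using Nat.strong_induction_on generalizing T with
  | _ c ih =>
  intro hT
  have e1 := hF T hT
  have e2 := hF (Ico k (k + c)) (by intro x hx; simp at hx; omega)
  rw [← insert_erase (mem_powerset_self T), sum_insert (by simp)] at e1
  rw [← insert_erase (mem_powerset_self (Ico k (k + c))), sum_insert (by simp)] at e2
  have e3 : ∀ S : Finset ℕ, (∀ x ∈ S, k ≤ x) → S.card = c →
      ∑ x ∈ S.powerset.erase S, F x + F (Ico k (k + c)) =
        ∑ m ∈ range (c + 1), c.choose m • F (Ico k (k + m)) := by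
    intro S hS hSc
    have := sum_powerset_apply_card (fun m => F (Ico k (k + m))) (x := S)
    rw [hSc, ← insert_erase (mem_powerset_self S), sum_insert (by simp), hSc, add_comm] at this
    rw [← this]
    congr 1
    refine sum_congr rfl fun x hx => ?_
    rw [mem_erase, mem_powerset] at hx
    have hlt : x.card < c := by
      rw [← hSc]; exact card_lt_card (hx.2.ssubset_of_ne hx.1)
    exact ih _ hlt x rfl fun y hy => hS y (hx.2 hy)
  have e4 := e3 T hT hc
  have e5 := e3 (Ico k (k + c)) (by intro x hx; simp at hx; omega) (by simp)
  have e6 := add_right_cancel (e4.trans e5.symm)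
  rw [hc, e6] at e1
  rw [Nat.card_Ico, Nat.add_sub_cancel_left] at e2
  exact add_right_cancel (e1.trans e2.symm)

end QBE


namespace QBE

section W
variable {K : Type*} [Field K]

/-- DEX-type descent at position `i` (columns `i-1`, `i`); false for `i = 0`. -/
def DX (f : ℕ → ℕ) (i : ℕ) : Prop :=
  (¬ (i - 1 < f (i - 1)) ∧ i < f i) ∨ (((i - 1 < f (i - 1)) ↔ i < f i) ∧ f i < f (i - 1))

instance (f : ℕ → ℕ) (i : ℕ) : Decidable (DX f i) := by unfold DX; infer_instance

def ee (t : K) (f : ℕ → ℕ) (i : ℕ) : K := if i < f i then t else 1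

def wt (t q : K) (f : ℕ → ℕ) (n : ℕ) : K :=
  ∏ i ∈ range n, (ee t f i * if DX f i then q ^ i else 1)

lemma wt_congr (t q : K) (f g : ℕ → ℕ) (n : ℕ) (h1 : ∀ i < n, (i < f i ↔ i < g i))
    (h2 : ∀ i < n, (f i < f (i - 1) ↔ g i < g (i - 1))) : wt t q f n = wt t q g n := by
  unfold wt
  refine prod_congr rfl fun i hi => ?_
  rw [mem_range] at hi
  have : DX f i ↔ DX g i := by
    unfold DX
    rw [h1 i hi, h1 (i - 1) (by omega), h2 i hi]
  simp only [ee, h1 i hi, this]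

/-- weight of DEX-free tails -/
def RR (t : K) (f : ℕ → ℕ) (n : ℕ) : ℕ → K
  | 0 => 1
  | k + 1 => RR t f n k * ee t f (n + k) * (if k ≠ 0 ∧ DX f (n + k) then 0 else 1)

lemma run_lemma {t q : K} (hq : ∀ n, 1 ≤ n → 1 - q ^ n ≠ 0) (f : ℕ → ℕ) (N : ℕ) :
    wt t q f N / qp q N = ∑ n ∈ range (N + 1), q ^ n * RR t f n (N - n) * wt t q f n / qp q n := by
  induction N with
  | zero => simp [wt, qp, RR]
  | succ N ih =>
    rw [sum_range_succ, sum_range_succ]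
    rw [sum_range_succ] at ih
    have e1 : ∑ n ∈ range N, q ^ n * RR t f n (N + 1 - n) * wt t q f n / qp q n =
      (∑ n ∈ range N, q ^ n * RR t f n (N - n) * wt t q f n / qp q n) * (ee t f N *
        (if DX f N then 0 else 1)) := by
      rw [sum_mul]
      refine sum_congr rfl fun n hn => ?_
      rw [mem_range] at hn
      have : N + 1 - n = (N - n) + 1 := by omega
      rw [this, RR]
      have h2 : n + (N - n) = N := by omega
      have h3 : N - n ≠ 0 := by omega
      rw [h2]
      simp only [h3, ne_eq, not_false_eq_true, true_and]
      ring
    rw [e1]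
    have h3 : N + 1 - N = 0 + 1 := by omega
    rw [h3, RR, Nat.sub_self]
    rw [Nat.sub_self] at ih
    simp only [RR, add_zero, ne_eq, not_true_eq_false, false_and, if_false, mul_one, one_mul] at *
    have hw : wt t q f (N + 1) = wt t q f N * (ee t f N * if DX f N then q ^ N else 1) := by
      rw [wt, prod_range_succ]; rfl
    rw [hw, qp_succ]
    set Sm := ∑ n ∈ range N, q ^ n * RR t f n (N - n) * wt t q f n / qp q n
    have hS : Sm = wt t q f N / qp q N - q ^ N * wt t q f N / qp q N := by
      linear_combination -ih
    rw [hS]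
    have a1 := qp_ne hq N
    have a2 := hq (N + 1) (by omega)
    split_ifs with hd
    · field_simp
      ring
    · field_simp
      ring

/-- columns `[k, k+j)` weakly increasing -/
def Incr (f : ℕ → ℕ) (k j : ℕ) : Prop := ∀ i < j, i ≠ 0 → f (k + i - 1) ≤ f (k + i)

instance (f : ℕ → ℕ) (k j : ℕ) : Decidable (Incr f k j) := by unfold Incr; infer_instance

def Tl (f : ℕ → ℕ) (n b u : ℕ) : Prop :=
  ((∀ i < b, n + i < f (n + i)) ∧ Incr f n b) ∧
    ((∀ i < u, f (n + b + i) ≤ n + b + i) ∧ Incr f (n + b) u)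

instance (f : ℕ → ℕ) (n b u : ℕ) : Decidable (Tl f n b u) := by unfold Tl; infer_instance

lemma RR_eq (t : K) (f : ℕ → ℕ) (n k : ℕ) :
    RR t f n k = ∑ b ∈ range (k + 1), if Tl f n b (k - b) then t ^ b else 0 := by
  have incS : ∀ a j, Incr f a (j + 1) ↔ Incr f a j ∧ (j ≠ 0 → f (a + j - 1) ≤ f (a + j)) := by
    intro a j
    constructor
    · intro h
      exact ⟨fun i hi => h i (by omega), fun hj => h j (by omega) hj⟩
    · rintro ⟨h1, h2⟩ i hi hi0
      rcases Nat.lt_succ_iff_lt_or_eq.mp hi with h | rfl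
      · exact h1 i h hi0
      · exact h2 hi0
  induction k with
  | zero => simp [RR, Tl, Incr]
  | succ k ih =>
    rw [RR, ih, sum_range_succ _ (k + 1)]
    by_cases hx : n + k < f (n + k)
    · -- only last survives
      have z1 : ∀ b ∈ range (k + 1), (if Tl f n b (k + 1 - b) then t ^ b else (0:K)) = 0 := by
        intro b hb
        rw [mem_range] at hb
        rw [if_neg]
        intro h
        have := h.2.1 (k - b) (by omega)
        rw [show n + b + (k - b) = n + k by omega] at this
        omega
      rw [sum_eq_zero z1, zero_add, sum_range_succ, ee, if_pos hx]
      have hT : Tl f n (k + 1) (k + 1 - (k + 1)) ↔ Tl f n k (k - k) ∧ ¬ (k ≠ 0 ∧ DX f (n + k)) := by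
        simp only [Tl, Nat.sub_self, incS]
        have t1 : Incr f (n + (k + 1)) 0 := fun i hi => absurd hi (by omega)
        have t2 : Incr f (n + k) 0 := fun i hi => absurd hi (by omega)
        constructor
        · rintro ⟨⟨h1, h2, h3⟩, h4⟩
          refine ⟨⟨⟨fun i hi => h1 i (by omega), h2⟩, fun i hi => absurd hi (by omega), t2⟩, ?_⟩
          rintro ⟨hk, hd⟩
          have := h3 hk
          have h5 := h1 (k - 1) (by omega)
          rw [show n + (k - 1) = n + k - 1 by omega] at h5
          rcases hd with hd | hd
          · exact hd.1 h5
          · omega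
        · rintro ⟨⟨⟨h1, h2⟩, h4⟩, h3⟩
          refine ⟨⟨?_, h2, ?_⟩, fun i hi => absurd hi (by omega), t1⟩
          · intro i hi
            rcases Nat.lt_succ_iff_lt_or_eq.mp hi with h | rfl
            · exact h1 i h
            · exact hx
          · intro hk
            by_contra hlt
            refine h3 ⟨hk, Or.inr ⟨?_, by omega⟩⟩
            have h5 := h1 (k - 1) (by omega)
            rw [show n + (k - 1) = n + k - 1 by omega] at h5
            exact ⟨fun _ => hx, fun _ => h5⟩
      have z2 : (∑ b ∈ range k, if Tl f n b (k - b) then t ^ b else (0:K)) *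
          (if k ≠ 0 ∧ DX f (n + k) then 0 else 1) = 0 := by
        rw [sum_mul]
        refine sum_eq_zero fun b hb => ?_
        rw [mem_range] at hb
        by_cases h : Tl f n b (k - b)
        · rw [if_pos (c := k ≠ 0 ∧ DX f (n + k)), mul_zero]
          refine ⟨by omega, Or.inl ⟨?_, hx⟩⟩
          have := h.2.1 (k - 1 - b) (by omega)
          rw [show n + b + (k - 1 - b) = n + k - 1 by omega] at this
          omega
        · rw [if_neg h, zero_mul]
      rw [add_mul, add_mul, mul_right_comm, z2, zero_mul, zero_add]
      simp only [hT]
      split_ifs <;> first | (exfalso; tauto) | ring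
    · rw [if_neg (c := Tl f n (k + 1) (k + 1 - (k + 1))), add_zero, sum_mul, sum_mul]
      · refine sum_congr rfl fun b hb => ?_
        rw [mem_range] at hb
        rw [ee, if_neg hx, mul_one]
        have hT : Tl f n b (k + 1 - b) ↔ Tl f n b (k - b) ∧ ¬ (k ≠ 0 ∧ DX f (n + k)) := by
          rw [show k + 1 - b = (k - b) + 1 by omega]
          simp only [Tl, incS]
          constructor
          · rintro ⟨h0, h1, h2, h3⟩
            refine ⟨⟨h0, fun i hi => h1 i (by omega), h2⟩, ?_⟩
            rintro ⟨hk, hd⟩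
            rcases hd with hd | hd
            · exact hx hd.2
            · have hkb : k - b ≠ 0 := by
                intro hkb
                have hbk : b = k := by omega
                subst hbk
                have := h0.1 (b - 1) (by omega)
                rw [show n + (b - 1) = n + b - 1 by omega] at this
                exact hx (hd.1.mp this)
              have := h3 hkb
              rw [show n + b + (k - b) = n + k by omega] at this
              omega
          · rintro ⟨⟨h0, h1, h2⟩, h3⟩
            refine ⟨h0, ?_, h2, ?_⟩
            · intro i hi
              rcases Nat.lt_succ_iff_lt_or_eq.mp hi with h | rfl
              · exact h1 i h
              · rw [show n + b + (k - b) = n + k by omega]; omega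
            · intro hkb
              rw [show n + b + (k - b) = n + k by omega]
              by_contra hlt
              refine h3 ⟨by omega, Or.inr ⟨?_, by omega⟩⟩
              have := h1 (k - b - 1) (by omega)
              rw [show n + b + (k - b - 1) = n + k - 1 by omega] at this
              exact ⟨fun h => absurd h (by omega), fun h => absurd h hx⟩
        simp only [hT]
        split_ifs <;> first | (exfalso; tauto) | ring
      · intro h
        exact hx (h.1.1 k (by omega))

lemma run_lemma2 {t q : K} (hq : ∀ n, 1 ≤ n → 1 - q ^ n ≠ 0) (f : ℕ → ℕ) (N : ℕ) :
    wt t q f N / qp q N = ∑ n ∈ range (N + 1), ∑ b ∈ range (N - n + 1),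
      q ^ n * t ^ b / qp q n * (if Tl f n b (N - n - b) then wt t q f n else 0) := by
  rw [run_lemma hq]
  refine sum_congr rfl fun n _ => ?_
  rw [RR_eq, mul_sum, sum_mul, sum_div]
  refine sum_congr rfl fun b _ => ?_
  split_ifs
  · ring
  · simp

end W
end QBE


namespace QBE

section S
variable {K : Type*} [Field K]

/-- word as a function -/
def gf (l : List ℕ) (i : ℕ) : ℕ := l.getD i 0

lemma gf_app_left (l s : List ℕ) {i : ℕ} (h : i < l.length) : gf (l ++ s) i = gf l i :=
  List.getD_append _ _ _ _ h

lemma gf_app_right (l s : List ℕ) (i : ℕ) : gf (l ++ s) (l.length + i) = gf s i := by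
  unfold gf
  rw [List.getD_append_right _ _ _ _ (by omega), Nat.add_sub_cancel_left]

lemma gf_eq (l : List ℕ) {i : ℕ} (h : i < l.length) : gf l i = l[i] := by
  simp [gf, h]

lemma gf_mem (l : List ℕ) {i : ℕ} (h : i < l.length) : gf l i ∈ l := by
  rw [gf_eq l h]; exact List.getElem_mem _

lemma wt_app (t q : K) (l s : List ℕ) : wt t q (gf (l ++ s)) l.length = wt t q (gf l) l.length := by
  apply wt_congr
  · intro i hi; rw [gf_app_left l s hi]
  · intro i hi
    rw [gf_app_left l s hi, gf_app_left l s (show i - 1 < l.length by omega)]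

lemma Incr_iff (s : List ℕ) : Incr (gf s) 0 s.length ↔ s.Pairwise (· ≤ ·) := by
  rw [← List.isChain_iff_pairwise, List.isChain_iff_getElem]
  constructor
  · intro h i hi
    have := h (i + 1) hi (by omega)
    simp only [zero_add, Nat.add_sub_cancel] at this
    rwa [gf_eq s hi, gf_eq s (show i < s.length by omega)] at this
  · intro h i hi hi0
    obtain ⟨j, rfl⟩ := Nat.exists_eq_succ_of_ne_zero hi0
    have := h j hi
    simp only [zero_add, Nat.succ_eq_add_one, Nat.add_sub_cancel]
    rw [gf_eq s (show j < s.length by omega), gf_eq s hi]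
    exact this

lemma Incr_app (l s : List ℕ) : Incr (gf (l ++ s)) l.length s.length ↔ s.Pairwise (· ≤ ·) := by
  rw [← Incr_iff]
  refine forall_congr' fun i => forall_congr' fun hi => forall_congr' fun h0 => ?_
  rw [gf_app_right, show l.length + i - 1 = l.length + (i - 1) by omega, gf_app_right, zero_add]

lemma Incr_app_left (l s : List ℕ) (n b : ℕ) (h : n + b ≤ l.length) :
    Incr (gf (l ++ s)) n b ↔ Incr (gf l) n b := by
  refine forall_congr' fun i => forall_congr' fun hi => forall_congr' fun h0 => ?_
  rw [gf_app_left l s (by omega), gf_app_left l s (by omega)]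

lemma strict_of {s : List ℕ} (hs : s.Pairwise (· ≤ ·)) (hn : s.Nodup) (i : ℕ) (h : i + 1 < s.length) :
    gf s i < gf s (i + 1) := by
  rw [gf_eq s h, gf_eq s (show i < s.length by omega)]
  have h1 := List.pairwise_iff_getElem.mp hs i (i + 1) (by omega) h (by omega)
  have h2 := List.pairwise_iff_getElem.mp hn i (i + 1) (by omega) h (by omega)
  exact lt_of_le_of_ne h1 h2

lemma exc_iff {s : List ℕ} (hs : s.Pairwise (· ≤ ·)) (hn : s.Nodup) (n : ℕ) :
    (∀ i < s.length, n + i < gf s i) ↔ ∀ x ∈ s, n < x := by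
  constructor
  · intro h x hx
    obtain ⟨i, hi, rfl⟩ := List.mem_iff_getElem.mp hx
    have := h i hi
    rw [gf_eq s hi] at this
    omega
  · intro h i hi
    induction i with
    | zero => exact h _ (gf_mem s hi)
    | succ i ih =>
      have := ih (by omega)
      have := strict_of hs hn i hi
      omega

lemma nexc_iff {s : List ℕ} (hs : s.Pairwise (· ≤ ·)) (hn : s.Nodup) (k : ℕ) :
    (∀ i < s.length, gf s i ≤ k + i) ↔ ∀ x ∈ s, x < k + s.length := by
  constructor
  · intro h x hx
    obtain ⟨i, hi, rfl⟩ := List.mem_iff_getElem.mp hx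
    have := h i hi
    rw [gf_eq s hi] at this
    omega
  · intro h i hi
    have key : ∀ j i, i + j + 1 = s.length → gf s i ≤ k + i := by
      intro j
      induction j with
      | zero =>
        intro i hi
        have := h _ (gf_mem s (show i < s.length by omega))
        omega
      | succ j ih =>
        intro i hi
        have := ih (i + 1) (by omega)
        have := strict_of hs hn i (by omega)
        omega
    exact key (s.length - 1 - i) i (by omega)

/-- increasing excedance block on columns `[n, n+b)` -/
def BT (f : ℕ → ℕ) (n b : ℕ) : Prop := (∀ i < b, n + i < f (n + i)) ∧ Incr f n b

instance (f : ℕ → ℕ) (n b : ℕ) : Decidable (BT f n b) := by unfold BT; infer_instance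

lemma BT_app (l s : List ℕ) (hs : s.Nodup) :
    BT (gf (l ++ s)) l.length s.length ↔ s.Pairwise (· ≤ ·) ∧ ∀ x ∈ s, l.length < x := by
  unfold BT
  rw [Incr_app]
  simp only [gf_app_right]
  constructor
  · rintro ⟨h1, h2⟩
    exact ⟨h2, (exc_iff h2 hs _).mp h1⟩
  · rintro ⟨h2, h1⟩
    exact ⟨(exc_iff h2 hs _).mpr h1, h2⟩

lemma BT_app_left (l s : List ℕ) (n b : ℕ) (h : n + b ≤ l.length) :
    BT (gf (l ++ s)) n b ↔ BT (gf l) n b := by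
  unfold BT
  rw [Incr_app_left l s n b h]
  have : ∀ i < b, gf (l ++ s) (n + i) = gf l (n + i) := fun i hi => gf_app_left l s (by omega)
  constructor
  · rintro ⟨h1, h2⟩
    exact ⟨fun i hi => by rw [← this i hi]; exact h1 i hi, h2⟩
  · rintro ⟨h1, h2⟩
    exact ⟨fun i hi => by rw [this i hi]; exact h1 i hi, h2⟩

lemma UT_app (l s : List ℕ) (hs : s.Nodup) :
    ((∀ i < s.length, gf (l ++ s) (l.length + i) ≤ l.length + i) ∧ Incr (gf (l ++ s)) l.length s.length) ↔
      s.Pairwise (· ≤ ·) ∧ ∀ x ∈ s, x < l.length + s.length := by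
  rw [Incr_app]
  simp only [gf_app_right]
  constructor
  · rintro ⟨h1, h2⟩
    exact ⟨h2, (nexc_iff h2 hs _).mp h1⟩
  · rintro ⟨h2, h1⟩
    exact ⟨(nexc_iff h2 hs _).mpr h1, h2⟩

/-- all injective words -/
def pp (t q : K) (n M : ℕ) : K := ∑ l ∈ LI n (range (n + M)), wt t q (gf l) n

lemma gf_map (g : ℕ → ℕ) (l : List ℕ) {i : ℕ} (h : i < l.length) : gf (l.map g) i = g (gf l i) := by
  rw [gf_eq _ (by simpa using h), gf_eq _ h]; simp

lemma pp_eq (t q : K) (n M : ℕ) (V : Finset ℕ) (hV : range n ⊆ V) (hc : V.card = n + M) :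
    ∑ l ∈ LI n V, wt t q (gf l) n = pp t q n M := by
  rw [relabel n V, hc, pp]
  intro l hl
  rw [mem_LI] at hl
  obtain ⟨rfl, hn, hm⟩ := hl
  apply wt_congr
  · intro i hi
    rw [gf_map _ _ hi]
    have hx := hm _ (gf_mem l hi)
    set x := gf l i
    constructor
    · intro h
      by_contra hle
      have h1 : rk V i < rk V x ↔ i < x := rk_lt_iff (hV (mem_range.mpr hi)) hx
      have h2 : i < x := by
        have : rk V x ≤ x := by
          unfold rk
          calc _ ≤ (range x).card := card_le_card (by intro y hy; simp at *; exact hy.2)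
            _ = x := card_range x
        omega
      exact hle h2
    · intro h
      have : rk V i < rk V x := rk_lt (hV (mem_range.mpr hi)) h
      have h3 : i ≤ rk V i := by
        unfold rk
        calc i = (range i).card := (card_range i).symm
          _ ≤ _ := card_le_card (by
            intro y hy
            rw [mem_range] at hy
            rw [mem_filter]
            exact ⟨hV (mem_range.mpr (by omega)), hy⟩)
      omega
  · intro i hi
    rw [gf_map _ _ hi, gf_map _ _ (show i - 1 < l.length by omega)]
    exact rk_lt_iff (hm _ (gf_mem l hi)) (hm _ (gf_mem l (by omega)))

/-- prefix sums -/
def Asum (t q : K) (n b : ℕ) (T : Finset ℕ) : K :=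
  ∑ μ ∈ (LI (n + b) (range (n + b) ∪ T)).filter (fun l => ∀ x ∈ T, x ∈ l),
    if BT (gf μ) n b then wt t q (gf μ) n else 0

lemma bstep (t q : K) (n b : ℕ) (S : Finset ℕ) (hS : ∀ x ∈ S, n + b ≤ x) :
    ∑ T ∈ S.powerset, Asum t q n b T = (Nat.multichoose S.card b : K) * pp t q n S.card := by
  unfold Asum
  have hdis : Disjoint (range (n + b)) S := by
    rw [Finset.disjoint_left]; intro x hx hx'
    have := hS x hx'; rw [mem_range] at hx; omega
  rw [fiber_sum _ _ _ hdis]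
  set V := range (n + b) ∪ S with hV
  have hVc : V.card = n + b + S.card := by
    rw [hV, card_union_of_disjoint hdis, card_range]
  have e1 : ∑ L ∈ LI (n + b) V, (if BT (gf L) n b then wt t q (gf L) n else 0) =
      ∑ L ∈ (LI (n + b) V).filter (fun L => (L.drop n).Pairwise (· ≤ ·)),
        if ∀ x ∈ L.drop n, n < x then wt t q (gf L) n else 0 := by
    rw [sum_filter]
    refine sum_congr rfl fun L hL => ?_
    rw [mem_LI] at hL
    have h1 : (L.take n).length = n := by simp [hL.1]
    have h2 : (L.drop n).length = b := by simp [hL.1]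
    have := BT_app (L.take n) (L.drop n) (hL.2.1.sublist (List.drop_sublist _ _))
    rw [h1, h2, List.take_append_drop] at this
    rw [← ite_and]
    simp only [this]
  rw [e1, split_sum (· ≤ ·)]
  have e2 : ∀ B ∈ powersetCard b V, ∑ l ∈ LI n (V \ B),
      (if ∀ x ∈ (l ++ B.sort (· ≤ ·)).drop n, n < x then wt t q (gf (l ++ B.sort (· ≤ ·))) n else 0) =
      if ∀ x ∈ B, n < x then pp t q n S.card else 0 := by
    intro B hB
    rw [mem_powersetCard] at hB
    have e3 : ∀ l ∈ LI n (V \ B), (if ∀ x ∈ (l ++ B.sort (· ≤ ·)).drop n, n < x then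
        wt t q (gf (l ++ B.sort (· ≤ ·))) n else 0) = if ∀ x ∈ B, n < x then wt t q (gf l) n else 0 := by
      intro l hl
      rw [mem_LI] at hl
      obtain ⟨rfl, _⟩ := hl
      rw [wt_app]
      simp
    rw [sum_congr rfl e3]
    split_ifs with h
    · apply pp_eq
      · intro x hx
        rw [mem_sdiff, hV, mem_union]
        rw [mem_range] at hx
        refine ⟨Or.inl (mem_range.mpr (by omega)), fun hx' => ?_⟩
        have := h x hx'; omega
      · rw [card_sdiff_of_subset hB.1, hVc, hB.2]; omega
    · simp
  rw [sum_congr rfl e2, ← sum_filter, sum_const, nsmul_eq_mul]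
  congr 2
  have e4 : (powersetCard b V).filter (fun B => ∀ x ∈ B, n < x) = powersetCard b (V.filter (n < ·)) := by
    ext B
    rw [mem_filter, mem_powersetCard, mem_powersetCard]
    constructor
    · rintro ⟨⟨h1, h2⟩, h3⟩
      exact ⟨fun x hx => mem_filter.mpr ⟨h1 hx, h3 x hx⟩, h2⟩
    · rintro ⟨h1, h2⟩
      exact ⟨⟨fun x hx => (mem_filter.mp (h1 hx)).1, h2⟩, fun x hx => (mem_filter.mp (h1 hx)).2⟩
  rw [e4, card_powersetCard]
  rcases Nat.eq_zero_or_pos b with rfl | hb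
  · simp
  · have : V.filter (n < ·) = V \ range (n + 1) := by
      ext x; simp
    rw [this, card_sdiff_of_subset, hVc, card_range, Nat.multichoose_eq]
    · congr 1; omega
    · intro x hx; rw [hV, mem_union]; left; simp at *; omega

/-- the numbers `a'_{n,b,m}` -/
def Ap (t q : K) (n b m : ℕ) : K := Asum t q n b (Ico (n + b) (n + b + m))

lemma Asum_card (t q : K) (n b : ℕ) (T : Finset ℕ) (hT : ∀ x ∈ T, n + b ≤ x) :
    Asum t q n b T = Ap t q n b T.card :=
  card_only (n + b) (Asum t q n b) (fun M => (Nat.multichoose M b : K) * pp t q n M)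
    (bstep t q n b) T hT

lemma Ap_sum (t q : K) (n b M : ℕ) : ∑ m ∈ range (M + 1), (Nat.choose M m : K) * Ap t q n b m =
    (Nat.multichoose M b : K) * pp t q n M := by
  have h := bstep t q n b (Ico (n + b) (n + b + M)) (by intro x hx; simp at hx; omega)
  rw [Nat.card_Ico, Nat.add_sub_cancel_left] at h
  rw [← h]
  have := sum_powerset_apply_card (fun m => Ap t q n b m) (x := Ico (n + b) (n + b + M))
  rw [Nat.card_Ico, Nat.add_sub_cancel_left] at this
  simp only [nsmul_eq_mul] at this
  rw [← this]
  refine sum_congr rfl fun T hT => ?_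
  rw [Asum_card]
  intro x hx
  have := mem_powerset.mp hT hx
  simp at this; omega

lemma ustep (t q : K) (n b u : ℕ) (T : Finset ℕ) (hT : ∀ x ∈ T, n + b + u ≤ x) :
    ∑ L ∈ (LI (n + b + u) (range (n + b + u) ∪ T)).filter (fun l => ∀ x ∈ T, x ∈ l),
      (if Tl (gf L) n b u then wt t q (gf L) n else 0) =
    ∑ s ∈ range (u + 1), (Nat.choose u s : K) * (Nat.multichoose (T.card + 1) u : K) *
      Ap t q n b (T.card + s) := by
  set N := n + b + u with hN
  set V := range N ∪ T with hV
  have hdis : Disjoint (range N) T := by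
    rw [Finset.disjoint_left]; intro x hx hx'
    have := hT x hx'; rw [mem_range] at hx; omega
  have e1 : ∑ L ∈ (LI N V).filter (fun l => ∀ x ∈ T, x ∈ l),
      (if Tl (gf L) n b u then wt t q (gf L) n else 0) =
      ∑ L ∈ (LI N V).filter (fun L => (L.drop (n + b)).Pairwise (· ≤ ·)),
        if (∀ x ∈ T, x ∈ L) ∧ BT (gf (L.take (n + b))) n b ∧ (∀ x ∈ L.drop (n + b), x < N)
          then wt t q (gf L) n else 0 := by
    rw [sum_filter, sum_filter]
    refine sum_congr rfl fun L hL => ?_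
    rw [mem_LI] at hL
    have h1 : (L.take (n + b)).length = n + b := by simp [hL.1]; omega
    have h2 : (L.drop (n + b)).length = u := by simp [hL.1]; omega
    have e1 := UT_app (L.take (n + b)) (L.drop (n + b)) (hL.2.1.sublist (List.drop_sublist _ _))
    have e2 := BT_app_left (L.take (n + b)) (L.drop (n + b)) n b (by omega)
    rw [h1, h2, List.take_append_drop] at e1
    rw [List.take_append_drop] at e2
    rw [← ite_and, ← ite_and]
    have : ((∀ x ∈ T, x ∈ L) ∧ Tl (gf L) n b u) ↔ (List.Pairwise (· ≤ ·) (L.drop (n + b)) ∧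
        (∀ x ∈ T, x ∈ L) ∧ BT (gf (L.take (n + b))) n b ∧ (∀ x ∈ L.drop (n + b), x < N)) := by
      have : Tl (gf L) n b u ↔ BT (gf L) n b ∧ ((∀ i < u, gf L (n + b + i) ≤ n + b + i) ∧
        Incr (gf L) (n + b) u) := Iff.rfl
      rw [this, e1, e2]
      tauto
    simp only [this]
  rw [e1, hN, split_sum (· ≤ ·)]
  have e2 : ∀ U ∈ powersetCard u V, ∑ μ ∈ LI (n + b) (V \ U),
      (if (∀ x ∈ T, x ∈ μ ++ U.sort (· ≤ ·)) ∧
        BT (gf ((μ ++ U.sort (· ≤ ·)).take (n + b))) n b ∧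
          (∀ x ∈ (μ ++ U.sort (· ≤ ·)).drop (n + b), x < n + b + u)
          then wt t q (gf (μ ++ U.sort (· ≤ ·))) n else 0) =
      ∑ μ ∈ (LI (n + b) (V \ U)).filter (fun μ => (∀ x ∈ T, x ∈ μ) ∧ BT (gf μ) n b ∧ (∀ x ∈ U, x < N)),
        wt t q (gf μ) n := by
    intro U hU
    rw [sum_filter]
    refine sum_congr rfl fun μ hμ => ?_
    rw [mem_LI] at hμ
    have h1 : (μ ++ U.sort (· ≤ ·)).take (n + b) = μ := by rw [← hμ.1]; simp
    have h2 : (μ ++ U.sort (· ≤ ·)).drop (n + b) = U.sort (· ≤ ·) := by rw [← hμ.1]; simp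
    have h3 : wt t q (gf (μ ++ U.sort (· ≤ ·))) n = wt t q (gf μ) n := by
      apply wt_congr
      · intro i hi; rw [gf_app_left _ _ (by omega)]
      · intro i hi; rw [gf_app_left _ _ (by omega), gf_app_left _ _ (by omega)]
    rw [h1, h2, h3]
    have : ((∀ x ∈ T, x ∈ μ ++ U.sort (· ≤ ·)) ∧ BT (gf μ) n b ∧ (∀ x ∈ U.sort (· ≤ ·), x < n + b + u)) ↔
      ((∀ x ∈ T, x ∈ μ) ∧ BT (gf μ) n b ∧ (∀ x ∈ U, x < N)) := by
      simp only [List.mem_append, mem_sort]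
      constructor
      · rintro ⟨h1, h2, h3⟩
        refine ⟨fun x hx => ?_, h2, h3⟩
        rcases h1 x hx with h | h
        · exact h
        · have := h3 x h; have := hT x hx; omega
      · rintro ⟨h1, h2, h3⟩
        exact ⟨fun x hx => Or.inl (h1 x hx), h2, h3⟩
    simp only [this]
  rw [sum_congr rfl e2]
  rw [sum_comm' (t' := (LI (n + b) V).filter (fun μ => (∀ x ∈ T, x ∈ μ) ∧ BT (gf μ) n b))
    (s' := fun μ => powersetCard u (range N \ μ.toFinset))]
  swap
  · intro U μ
    simp only [mem_powersetCard, mem_filter, mem_LI, mem_sdiff]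
    constructor
    · rintro ⟨⟨h1, h2⟩, ⟨h3, h4, h5⟩, h6, h7, h8⟩
      refine ⟨⟨fun x hx => ?_, h2⟩, ⟨h3, h4, fun x hx => (h5 x hx).1⟩, h6, h7⟩
      rw [mem_sdiff, mem_range, List.mem_toFinset]
      exact ⟨h8 x hx, fun hm => (h5 x hm).2 hx⟩
    · rintro ⟨⟨h1, h2⟩, ⟨h3, h4, h5⟩, h6, h7⟩
      refine ⟨⟨fun x hx => ?_, h2⟩, ⟨h3, h4, fun x hx => ⟨h5 x hx, fun hU => ?_⟩⟩, h6, h7, fun x hx => ?_⟩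
      · exact mem_union_left _ (mem_sdiff.mp (h1 hx)).1
      · exact (mem_sdiff.mp (h1 hU)).2 (List.mem_toFinset.mpr hx)
      · exact mem_range.mp (mem_sdiff.mp (h1 hx)).1
  have e3 : ∀ μ ∈ (LI (n + b) V).filter (fun μ => (∀ x ∈ T, x ∈ μ) ∧ BT (gf μ) n b),
      ∑ U ∈ powersetCard u (range N \ μ.toFinset), wt t q (gf μ) n =
        (Nat.multichoose (T.card + 1) u : K) * wt t q (gf μ) n := by
    intro μ hμ
    rw [mem_filter, mem_LI] at hμ
    obtain ⟨⟨h1, h2, h3⟩, h4, h5⟩ := hμ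
    rw [sum_const, card_powersetCard, nsmul_eq_mul]
    have hu : range N ∪ μ.toFinset = V := by
      ext x
      rw [hV, mem_union, mem_union, List.mem_toFinset]
      constructor
      · rintro (h | h)
        · exact Or.inl h
        · have := h3 x h; rwa [hV, mem_union] at this
      · rintro (h | h)
        · exact Or.inl h
        · exact Or.inr (h4 x h)
    have hc : (range N \ μ.toFinset).card = T.card + u := by
      have hh := card_sdiff_add_card (range N) μ.toFinset
      rw [hu, List.toFinset_card_of_nodup h2, h1, hV, card_union_of_disjoint hdis, card_range] at hh
      omega
    rw [hc, Nat.multichoose_eq]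
    congr 3
    omega
  rw [sum_congr rfl e3, ← mul_sum]
  -- fibre over the intermediate letters
  have hVV : V = (range (n + b) ∪ T) ∪ Ico (n + b) N := by
    ext x
    simp only [hV, mem_union, mem_range, mem_Ico]
    constructor
    · rintro (h | h)
      · by_cases hx : x < n + b
        · exact Or.inl (Or.inl hx)
        · exact Or.inr ⟨by omega, h⟩
      · exact Or.inl (Or.inr h)
    · rintro ((h | h) | h)
      · left; omega
      · exact Or.inr h
      · exact Or.inl h.2
  have hdis2 : Disjoint (range (n + b) ∪ T) (Ico (n + b) N) := by
    rw [Finset.disjoint_left]; intro x hx hx'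
    simp only [mem_union, mem_range, mem_Ico] at hx hx'
    rcases hx with h | h
    · omega
    · have := hT x h; omega
  rw [sum_filter, hVV, ← fiber_sum _ _ _ hdis2]
  have e4 : ∀ S ∈ (Ico (n + b) N).powerset,
      ∑ l ∈ (LI (n + b) (range (n + b) ∪ T ∪ S)).filter (fun l => ∀ x ∈ S, x ∈ l),
        (if (∀ x ∈ T, x ∈ l) ∧ BT (gf l) n b then wt t q (gf l) n else 0) =
      Ap t q n b (T.card + S.card) := by
    intro S hS
    rw [mem_powerset] at hS
    have hd : Disjoint T S := by
      rw [Finset.disjoint_left]; intro x hx hx'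
      have h1 := hT x hx
      have h2 := mem_Ico.mp (hS hx'); omega
    rw [← card_union_of_disjoint hd, ← Asum_card, Asum, union_assoc, sum_filter, sum_filter]
    · refine sum_congr rfl fun l _ => ?_
      rw [← ite_and, ← ite_and]
      have : ((∀ x ∈ S, x ∈ l) ∧ (∀ x ∈ T, x ∈ l) ∧ BT (gf l) n b) ↔
        ((∀ x ∈ T ∪ S, x ∈ l) ∧ BT (gf l) n b) := by
        simp only [mem_union]
        constructor
        · rintro ⟨h1, h2, h3⟩
          exact ⟨fun x hx => hx.elim (h2 x) (h1 x), h3⟩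
        · rintro ⟨h1, h2⟩
          exact ⟨fun x hx => h1 x (Or.inr hx), fun x hx => h1 x (Or.inl hx), h2⟩
      simp only [this]
    · intro x hx
      rw [mem_union] at hx
      rcases hx with h | h
      · have := hT x h; omega
      · exact (mem_Ico.mp (hS h)).1
  rw [sum_congr rfl e4, sum_powerset_apply_card (fun m => Ap t q n b (T.card + m)), Nat.card_Ico,
    show N - (n + b) = u by omega, mul_sum]
  refine sum_congr rfl fun s _ => ?_
  rw [nsmul_eq_mul]
  ring

end S
end QBE


namespace QBE

section S
variable {K : Type*} [Field K]

theorem pp_main {t q : K} (hq : ∀ n, 1 ≤ n → 1 - q ^ n ≠ 0) (ht : t ≠ 1) (N : ℕ) :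
    pp t q N 0 = qp q N * PowerSeries.coeff N (FF t q) := by
  have hpp : ∀ n M, pp t q n M = ∑ m ∈ range (M + 1), (Nat.choose M m : K) * Ap t q n 0 m := by
    intro n M
    rw [Ap_sum]; simp
  have hA : ∀ N m, Ap t q N 0 m = Ast t q N m := by
    apply alg_main hq ht (fun n m => Ap t q n 0 m) (Ap t q)
    · intro m
      simp only [Ap, Asum]
      have hbt : ∀ μ : List ℕ, BT (gf μ) 0 0 := by
        intro μ; exact ⟨fun i hi => absurd hi (by omega), fun i hi => absurd hi (by omega)⟩
      simp only [hbt, if_true, wt, range_zero, prod_empty, sum_const, nsmul_eq_mul, mul_one]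
      rcases Nat.eq_zero_or_pos m with rfl | hm
      · have hlem : ∀ W T : Finset ℕ, T = ∅ →
            ((LI (0 + 0) W).filter (fun l => ∀ x ∈ T, x ∈ l)).card = 1 := by
          rintro W T rfl
          rw [card_eq_one]
          refine ⟨[], ?_⟩
          ext l
          rw [mem_filter, mem_LI, mem_singleton]
          constructor
          · intro h; exact List.length_eq_zero_iff.mp h.1.1
          · rintro rfl; simp
        rw [hlem _ _ (by simp)]; simp
      · rw [if_neg (by omega), filter_eq_empty_iff.mpr]
        · simp
        · intro l hl h
          rw [mem_LI] at hl
          have h1 := h 0 (by simp; omega)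
          have := List.length_pos_of_mem h1
          omega
    · intro n b M
      rw [Ap_sum, hpp]
    · intro N m
      have e0 : Ap t q N 0 m = ∑ L ∈ (LI N (range N ∪ Ico N (N + m))).filter
          (fun l => ∀ x ∈ Ico N (N + m), x ∈ l), wt t q (gf L) N := by
        simp only [Ap, Asum, add_zero]
        refine sum_congr rfl fun L _ => ?_
        rw [if_pos]
        exact ⟨fun i hi => absurd hi (by omega), fun i hi => absurd hi (by omega)⟩
      rw [e0, sum_div]
      simp_rw [run_lemma2 hq]
      rw [sum_comm]
      have e1 : ∀ n ∈ range (N + 1), ∑ L ∈ (LI N (range N ∪ Ico N (N + m))).filter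
          (fun l => ∀ x ∈ Ico N (N + m), x ∈ l), ∑ b ∈ range (N - n + 1),
          q ^ n * t ^ b / qp q n * (if Tl (gf L) n b (N - n - b) then wt t q (gf L) n else 0) =
          ∑ b ∈ range (N - n + 1), q ^ n * t ^ b / qp q n *
            ∑ s ∈ range (N - n - b + 1), (Nat.choose (N - n - b) s : K) *
              (Nat.multichoose (m + 1) (N - n - b) : K) * Ap t q n b (m + s) := by
        intro n hn
        rw [sum_comm]
        refine sum_congr rfl fun b hb => ?_
        rw [← mul_sum]
        congr 1
        rw [mem_range] at hn hb
        have := ustep t q n b (N - n - b) (Ico N (N + m)) (by intro x hx; simp at hx; omega)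
        rw [show n + b + (N - n - b) = N by omega, Nat.card_Ico, Nat.add_sub_cancel_left] at this
        exact this
      rw [sum_congr rfl e1, sum_sigma', sum_sigma']
      refine sum_nbij' (fun x => ⟨N - x.1 - x.2, (x.1, x.2)⟩) (fun x => ⟨x.2.1, x.2.2⟩) ?_ ?_ ?_ ?_ ?_
      · rintro ⟨n, b⟩ h; simp at *; omega
      · rintro ⟨u, n, b⟩ h; simp at *; omega
      · rintro ⟨n, b⟩ h; rfl
      · rintro ⟨u, n, b⟩ h
        simp at h
        have : N - n - b = u := by omega
        simp [this]
      · rintro ⟨n, b⟩ h; rfl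
  rw [hpp]
  simp [hA, Ast]

/-- permutations as words -/
lemma perm_sum {M : Type*} [AddCommMonoid M] (n : ℕ) (G : List ℕ → M) :
    ∑ π : Equiv.Perm (Fin n), G (List.ofFn fun i => (π i : ℕ)) = ∑ l ∈ LI n (range n), G l := by
  refine sum_bij (fun π _ => List.ofFn fun i => (π i : ℕ)) ?_ ?_ ?_ (fun _ _ => rfl)
  · intro π _
    rw [mem_LI]
    refine ⟨by simp, ?_, ?_⟩
    · rw [List.nodup_ofFn]
      intro i j h
      exact π.injective (Fin.ext h)
    · intro x hx
      rw [List.mem_ofFn] at hx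
      obtain ⟨i, rfl⟩ := hx
      simp
  · intro π _ π' _ h
    have := List.ofFn_injective h
    ext i
    exact congrFun this i
  · intro l hl
    rw [mem_LI] at hl
    obtain ⟨h1, h2, h3⟩ := hl
    subst h1
    have hinj : Function.Injective (fun i : Fin l.length =>
        (⟨l[i], mem_range.mp (h3 _ (List.getElem_mem _))⟩ : Fin l.length)) := by
      intro i j h
      simp only [Fin.mk.injEq] at h
      exact List.nodup_iff_injective_get.mp h2 h
    refine ⟨Equiv.ofBijective _ (Finite.injective_iff_bijective.mp hinj), mem_univ _, ?_⟩
    apply List.ext_getElem <;> simp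

lemma gf_ofFn {n : ℕ} (π : Equiv.Perm (Fin n)) {i : ℕ} (h : i < n) :
    gf (List.ofFn fun i => (π i : ℕ)) i = pf π i := by
  rw [gf_eq _ (by simpa using h)]
  simp [pf, h]

/-- `maj = exc + (sum of DEX positions)` -/
lemma maj_eq (f : ℕ → ℕ) (n : ℕ) (hf : ∀ i < n, f (i + 1) ≠ f i) :
    ∑ i ∈ (range n).filter (fun i => f (i + 1) < f i), (i + 1) + (if n < f n then n + 1 else 0) =
    ((range (n + 1)).filter (fun i => i < f i)).card +
      ∑ i ∈ (range (n + 1)).filter (fun i => DX f i), i := by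
  simp only [sum_filter, card_filter]
  induction n with
  | zero => rcases Nat.eq_zero_or_pos (f 0) with h | h <;> simp [h, filter_singleton]
  | succ n ih =>
    have ih := ih (fun i hi => hf i (by omega))
    have hfn := hf n (by omega)
    rw [sum_range_succ, sum_range_succ _ (n + 1), sum_range_succ _ (n + 1)]
    have : (if f (n + 1) < f n then n + 1 else 0) + (if n + 1 < f (n + 1) then n + 1 + 1 else 0) =
      (if n < f n then n + 1 else 0) + (if n + 1 < f (n + 1) then 1 else 0) +
        (if DX f (n + 1) then n + 1 else 0) := by
      have hd : DX f (n + 1) ↔ ((¬ (n < f n) ∧ n + 1 < f (n + 1)) ∨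
          (((n < f n) ↔ n + 1 < f (n + 1)) ∧ f (n + 1) < f n)) := by
        unfold DX
        rw [Nat.add_sub_cancel]
      simp only [hd]
      by_cases h1 : n < f n <;> by_cases h2 : n + 1 < f (n + 1) <;> by_cases h3 : f (n + 1) < f n <;>
        simp [h1, h2, h3] <;> omega
    omega

lemma wt_eq (t q : K) (f : ℕ → ℕ) (n : ℕ) : wt t q f n =
    t ^ ((range n).filter (fun i => i < f i)).card * q ^ (∑ i ∈ (range n).filter (fun i => DX f i), i) := by
  unfold wt ee
  rw [prod_mul_distrib]
  congr 1
  · rw [prod_ite]; simp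
  · rw [prod_ite, prod_const_one, mul_one, prod_pow_eq_pow_sum]

lemma Aq_eq_pp (t q : K) (n : ℕ) : Aq K n t q = pp t q n 0 := by
  rw [Aq, pp, add_zero, ← perm_sum]
  refine sum_congr rfl fun π _ => ?_
  have hw : wt t q (gf (List.ofFn fun i => (π i : ℕ))) n = wt t q (pf π) n := by
    apply wt_congr
    · intro i hi; rw [gf_ofFn π hi]
    · intro i hi; rw [gf_ofFn π hi, gf_ofFn π (by omega)]
  rw [hw, wt_eq]
  rcases n with _ | n
  · simp [excN, majN]
  · have := maj_eq (pf π) n (by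
      intro i hi h
      unfold pf at h
      rw [dif_pos (by omega), dif_pos (by omega)] at h
      have := π.injective (Fin.ext h)
      simp at this)
    have hlast : ¬ n < pf π n := by
      have : pf π n < n + 1 := by
        unfold pf; rw [dif_pos (by omega)]; exact (π _).2
      omega
    rw [if_neg hlast, add_zero] at this
    have e : majN π - excN π = ∑ i ∈ (range (n + 1)).filter (fun i => DX (pf π) i), i := by
      unfold majN excN
      rw [Nat.add_sub_cancel, this]; omega
    rw [e]; rfl

end S
end QBE


namespace QBE

section G
variable {K : Type*} [Field K]

/-- descent ending at position `n` -/
def Ds (f : ℕ → ℕ) (n : ℕ) : Prop := n ≠ 0 ∧ f n < f (n - 1)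

instance (f : ℕ → ℕ) (n : ℕ) : Decidable (Ds f n) := by unfold Ds; infer_instance

/-- weight of a prefix -/
def Wf (t : K) (f : ℕ → ℕ) : ℕ → K
  | 0 => 1
  | 1 => 1 + t
  | n + 2 => if Ds f (n + 1) then (if Ds f n then 0 else t * Wf t f n) else (1 + t) * Wf t f (n + 1)

lemma Wf_congr (t : K) (f g : ℕ → ℕ) (n : ℕ) (h : ∀ i < n, (Ds f i ↔ Ds g i)) : Wf t f n = Wf t g n := by
  induction n using Nat.strong_induction_on with
  | _ n ih =>
    match n, ih, h with
    | 0, _, _ => rfl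
    | 1, _, _ => rfl
    | n + 2, ih, h =>
      simp only [Wf, h (n + 1) (by omega), h n (by omega)]
      rw [ih n (by omega) (fun i hi => h i (by omega)), ih (n + 1) (by omega) (fun i hi => h i (by omega))]

/-- decreasing block -/
def Dr (f : ℕ → ℕ) (k j : ℕ) : Prop := ∀ i < j, i ≠ 0 → Ds f (k + i)

instance (f : ℕ → ℕ) (k j : ℕ) : Decidable (Dr f k j) := by unfold Dr; infer_instance

lemma Dr_zero (f : ℕ → ℕ) (k : ℕ) : Dr f k 0 := by intro i hi; omega

lemma Dr_one (f : ℕ → ℕ) (k : ℕ) : Dr f k 1 := by intro i hi; omega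

lemma Dr_succ (f : ℕ → ℕ) (k j : ℕ) : Dr f k (j + 1) ↔ (j = 0 ∨ Ds f (k + j)) ∧ Dr f k j := by
  constructor
  · intro h
    refine ⟨?_, fun i hi => h i (by omega)⟩
    by_cases hj : j = 0
    · exact Or.inl hj
    · exact Or.inr (h j (by omega) hj)
  · rintro ⟨h1, h2⟩ i hi hi0
    rcases Nat.lt_succ_iff_lt_or_eq.mp hi with h | h
    · exact h2 i h hi0
    · subst h; exact h1.resolve_left hi0

/-- generic run sum -/
def Us (c : ℕ → K) (t : K) (f : ℕ → ℕ) (n : ℕ) : K :=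
  ∑ x ∈ antidiagonal n, if Dr f x.1 x.2 then c x.2 * Wf t f x.1 else 0

lemma Us_succ (c : ℕ → K) (t : K) (f : ℕ → ℕ) (n : ℕ) :
    Us c t f (n + 1) = c 0 * Wf t f (n + 1) +
      if Ds f n then Us (fun j => c (j + 1)) t f n else c 1 * Wf t f n := by
  rw [Us, Finset.Nat.sum_antidiagonal_succ', if_pos (Dr_zero _ _)]
  congr 1
  by_cases h : Ds f n
  · rw [if_pos h, Us]
    refine sum_congr rfl fun x hx => ?_
    have hx := mem_antidiagonal.mp hx
    simp only [Dr_succ, hx, h, or_true, true_and]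
  · rw [if_neg h]
    rw [sum_eq_single (n, 0)]
    · rw [if_pos (Dr_one _ _)]
    · rintro ⟨k, j⟩ hx hne
      have hx := mem_antidiagonal.mp hx
      rw [if_neg]
      rw [Dr_succ]
      dsimp only at *
      rw [hx]
      rintro ⟨h1 | h1, -⟩
      · subst h1; simp at hx; subst hx; exact hne rfl
      · exact h h1
    · intro h; exact absurd (by simp) h

lemma Us_lin (a b : K) (c d : ℕ → K) (t : K) (f : ℕ → ℕ) (n : ℕ) :
    Us (fun j => a * c j + b * d j) t f n = a * Us c t f n + b * Us d t f n := by
  unfold Us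
  rw [mul_sum, mul_sum, ← sum_add_distrib]
  refine sum_congr rfl fun x _ => ?_
  split_ifs <;> ring

lemma U1 (t : K) (f : ℕ → ℕ) (n : ℕ) : Us (fun j => (-1) ^ j) t f (n + 1) =
    if Ds f n then 0 else t * Wf t f n := by
  induction n with
  | zero =>
    rw [Us_succ]
    have : ¬ Ds f 0 := fun h => h.1 rfl
    simp [this, Wf]
  | succ n ih =>
    rw [Us_succ]
    have e : Us (fun j => (-1 : K) ^ (j + 1)) t f (n + 1) = - Us (fun j => (-1) ^ j) t f (n + 1) := by
      have := Us_lin (-1) 0 (fun j => (-1) ^ j) (fun _ => 0) t f (n + 1)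
      simp only [zero_mul, add_zero, neg_one_mul, mul_zero] at this
      rw [← this]
      congr 1
      ext j; ring
    rw [e, ih]
    by_cases h : Ds f (n + 1) <;> by_cases h' : Ds f n <;> simp [h, h', Wf] <;> ring

/-- the coefficients of `1/((1+x)(1+tx))` -/
def aj (t : K) (j : ℕ) : K := (-1) ^ j * ∑ i ∈ range (j + 1), t ^ i

lemma aj_succ (t : K) (j : ℕ) : aj t (j + 1) = (-t) * aj t j + (-1) * (-1) ^ j := by
  unfold aj
  rw [sum_range_succ', pow_succ, pow_zero]
  have : ∑ i ∈ range (j + 1), t ^ (i + 1) = t * ∑ i ∈ range (j + 1), t ^ i := by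
    rw [mul_sum]; exact sum_congr rfl fun _ _ => by ring
  rw [this]; ring

lemma S1 (t : K) (f : ℕ → ℕ) (n : ℕ) : Us (aj t) t f (n + 1) = 0 := by
  induction n with
  | zero =>
    rw [Us_succ]
    have : ¬ Ds f 0 := fun h => h.1 rfl
    simp [this, Wf, aj, sum_range_succ]
  | succ n ih =>
    rw [Us_succ]
    by_cases h : Ds f (n + 1)
    · rw [if_pos h]
      simp only [aj_succ]
      rw [Us_lin, ih, U1]
      by_cases h' : Ds f n <;> simp [h, h', Wf, aj]
    · simp [h, Wf, aj, sum_range_succ]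
      ring

/-- inversions of a word -/
def invL : List ℕ → ℕ
  | [] => 0
  | x :: l => l.countP (· < x) + invL l

lemma invL_append (l s : List ℕ) : invL (l ++ s) =
    invL l + invL s + (l.map fun x => s.countP (· < x)).sum := by
  induction l with
  | nil => simp [invL]
  | cons x l ih => simp [invL, ih]; omega

lemma invL_sort (s : List ℕ) (h : s.Pairwise (· ≥ ·)) (hn : s.Nodup) : invL s = s.length.choose 2 := by
  induction s with
  | nil => simp [invL]
  | cons x s ih =>
    rw [List.pairwise_cons] at h
    rw [List.nodup_cons] at hn
    rw [invL, ih h.2 hn.2, List.length_cons, Nat.choose_succ_succ' _ 1, Nat.choose_one_right]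
    congr 1
    rw [List.countP_eq_length]
    intro a ha
    have := h.1 a ha
    have : a ≠ x := by rintro rfl; exact hn.1 ha
    simp; omega

lemma invL_map (V : Finset ℕ) (l : List ℕ) (h : ∀ x ∈ l, x ∈ V) : invL (l.map (rk V)) = invL l := by
  induction l with
  | nil => rfl
  | cons x l ih =>
    simp only [List.mem_cons, forall_eq_or_imp] at h
    rw [List.map_cons, invL, invL, ih h.2, List.countP_map]
    congr 1
    apply List.countP_congr
    intro y hy
    simp [rk_lt_iff (h.2 y hy) h.1]

/-- crossing count -/
def cr (B : Finset ℕ) (n : ℕ) : ℕ := ∑ x ∈ range n \ B, (B.filter (· < x)).card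

lemma cr_sum (q : K) (n j : ℕ) : ∑ B ∈ powersetCard j (range n), q ^ cr B n = gaussR q n j := by
  induction n generalizing j with
  | zero =>
    cases j with
    | zero => simp [cr, gaussR]
    | succ j =>
      rw [powersetCard_eq_empty.mpr (by simp), sum_empty, gaussR]
  | succ n ih =>
    cases j with
    | zero => simp [cr, gaussR]
    | succ k =>
      rw [gaussR, ← ih, ← ih, range_add_one, powersetCard_succ_insert (by simp), sum_union, add_comm, sum_image]
      · congr 1
        · refine sum_congr rfl fun B hB => ?_
          rw [mem_powersetCard] at hB
          congr 1
          unfold cr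
          have e : range (n + 1) \ insert n B = range n \ B := by
            ext x
            simp only [mem_sdiff, mem_range, mem_insert, not_or]
            constructor <;> rintro ⟨h1, h2⟩ <;> refine ⟨?_, ?_⟩ <;> first | omega | tauto | skip
            exact ⟨by omega, h2⟩
          rw [e]
          refine sum_congr rfl fun x hx => ?_
          congr 1
          rw [mem_sdiff, mem_range] at hx
          rw [filter_insert, if_neg (by omega)]
        · rw [mul_sum]
          refine sum_congr rfl fun B hB => ?_
          rw [mem_powersetCard] at hB
          rw [← pow_add]
          congr 1
          unfold cr
          have hn : n ∉ B := fun h => by simpa using hB.1 h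
          rw [range_add_one, insert_sdiff_of_notMem _ hn, sum_insert (by simp)]
          congr 1
          rw [filter_true_of_mem, hB.2]
          intro x hx
          simpa using hB.1 hx
      · intro B hB C hC h
        rw [mem_coe, mem_powersetCard] at hB hC
        have hn : n ∉ B := fun h => by simpa using hB.1 h
        have hn' : n ∉ C := fun h => by simpa using hC.1 h
        rw [← erase_insert hn, ← erase_insert hn', h]
      · rw [disjoint_left]
        intro B hB hB'
        rw [mem_powersetCard] at hB
        rw [mem_image] at hB'
        obtain ⟨C, -, rfl⟩ := hB'
        have := hB.1 (mem_insert_self _ _)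
        simp at this

/-- The gamma sum. -/
def Gm (t q : K) (k : ℕ) : K := ∑ l ∈ LI k (range k), q ^ invL l * Wf t (gf l) k

lemma Ds_map (V : Finset ℕ) (l : List ℕ) (h : ∀ x ∈ l, x ∈ V) (i : ℕ) (hi : i < l.length) :
    Ds (gf (l.map (rk V))) i ↔ Ds (gf l) i := by
  unfold Ds
  rw [gf_map _ _ hi, gf_map _ _ (by omega), rk_lt_iff (h _ (gf_mem _ hi)) (h _ (gf_mem _ (by omega)))]

lemma Ds_app_left (l s : List ℕ) {i : ℕ} (h : i < l.length) : Ds (gf (l ++ s)) i ↔ Ds (gf l) i := by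
  unfold Ds
  rw [gf_app_left _ _ h, gf_app_left _ _ (by omega)]

lemma Gm_V (t q : K) (k : ℕ) (V : Finset ℕ) (hV : V.card = k) :
    ∑ l ∈ LI k V, q ^ invL l * Wf t (gf l) k = Gm t q k := by
  rw [relabel k V, hV, Gm]
  intro l hl
  rw [mem_LI] at hl
  rw [invL_map V l hl.2.2]
  congr 1
  apply Wf_congr
  intro i hi
  exact Ds_map V l hl.2.2 i (by omega)

lemma Dr_drop (L : List ℕ) (k j : ℕ) (hL : L.length = k + j) (hn : L.Nodup) :
    Dr (gf L) k j ↔ (L.drop k).Pairwise (· ≥ ·) := by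
  rw [← List.isChain_iff_pairwise, List.isChain_iff_getElem]
  simp only [List.length_drop, List.getElem_drop]
  constructor
  · intro h i hi
    have := (h (i + 1) (by omega) (by omega)).2
    rw [gf_eq _ (by omega), gf_eq _ (by omega)] at this
    exact this.le
  · intro h i hi hi0
    obtain ⟨i, rfl⟩ := Nat.exists_eq_succ_of_ne_zero hi0
    have := h i (by omega)
    refine ⟨by omega, ?_⟩
    rw [gf_eq _ (by omega), gf_eq _ (by omega)]
    refine lt_of_le_of_ne this ?_
    intro h
    have := (List.Nodup.getElem_inj_iff hn).mp h
    omega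

lemma dstep (t q : K) (k j : ℕ) :
    ∑ L ∈ LI (k + j) (range (k + j)), (if Dr (gf L) k j then q ^ invL L * Wf t (gf L) k else 0) =
      gaussR q (k + j) j * q ^ (j.choose 2) * Gm t q k := by
  rw [← sum_filter]
  have e : (LI (k + j) (range (k + j))).filter (fun L => Dr (gf L) k j) =
    (LI (k + j) (range (k + j))).filter (fun L => (L.drop k).Pairwise (· ≥ ·)) := by
    apply filter_congr
    intro L hL
    rw [mem_LI] at hL
    exact Dr_drop L k j hL.1 hL.2.1
  rw [e, split_sum, ← cr_sum, sum_mul, sum_mul]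
  refine sum_congr rfl fun B hB => ?_
  rw [mem_powersetCard] at hB
  have hc : (range (k + j) \ B).card = k := by
    rw [card_sdiff_of_subset hB.1, hB.2, card_range]; omega
  rw [← Gm_V t q k _ hc, mul_sum]
  refine sum_congr rfl fun l hl => ?_
  rw [mem_LI] at hl
  have h1 : Wf t (gf (l ++ B.sort (· ≥ ·))) k = Wf t (gf l) k := by
    apply Wf_congr
    intro i hi
    exact Ds_app_left _ _ (by omega)
  have h2 : l.toFinset = range (k + j) \ B := by
    apply eq_of_subset_of_card_le
    · intro x hx; exact hl.2.2 x (List.mem_toFinset.mp hx)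
    · rw [hc, List.toFinset_card_of_nodup hl.2.1, hl.1]
  have h3 : (l.map fun x => (B.sort (· ≥ ·)).countP (· < x)).sum = cr B (k + j) := by
    rw [cr, ← h2, List.sum_toFinset _ hl.2.1]
    congr 1
    apply List.map_congr_left
    intro x _
    rw [List.countP_eq_length_filter, ← List.toFinset_card_of_nodup ((B.sort_nodup _).filter _)]
    congr 1
    ext y
    simp
  rw [h1, invL_append, h3, invL_sort _ (B.pairwise_sort _) (B.sort_nodup _), length_sort, hB.2]
  ring

theorem Gm_rec (t q : K) (n : ℕ) : ∑ x ∈ antidiagonal (n + 1),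
    aj t x.2 * gaussR q (n + 1) x.2 * q ^ (x.2.choose 2) * Gm t q x.1 = 0 := by
  have : ∑ L ∈ LI (n + 1) (range (n + 1)), q ^ invL L * Us (aj t) t (gf L) (n + 1) = 0 := by
    apply sum_eq_zero
    intro L _
    rw [S1, mul_zero]
  rw [← this]
  simp only [Us, mul_sum]
  rw [sum_comm]
  refine sum_congr rfl fun x hx => ?_
  have hx := mem_antidiagonal.mp hx
  rw [← hx]
  have := dstep t q x.1 x.2
  rw [mul_assoc (aj t x.2), mul_assoc (aj t x.2), ← this, mul_sum]
  refine sum_congr rfl fun L _ => ?_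
  split_ifs <;> ring

end G
end QBE


namespace QBE

section G2
variable {K : Type*} [Field K]

lemma gauss_zero (q : K) (n k : ℕ) (h : n < k) : gaussR q n k = 0 := by
  induction n generalizing k with
  | zero =>
    obtain ⟨k, rfl⟩ := Nat.exists_eq_succ_of_ne_zero (by omega : k ≠ 0)
    rfl
  | succ n ih =>
    obtain ⟨k, rfl⟩ := Nat.exists_eq_succ_of_ne_zero (by omega : k ≠ 0)
    show gaussR q n k + q ^ (k + 1) * gaussR q n (k + 1) = 0
    rw [ih k (by omega), ih (k + 1) (by omega)]; simp

lemma gauss_qp (q : K) (n k m : ℕ) (h : k + m = n) : gaussR q n k * (qp q k * qp q m) = qp q n := by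
  induction n generalizing k m with
  | zero =>
    obtain rfl : k = 0 := by omega
    obtain rfl : m = 0 := by omega
    simp [gaussR, qp_zero]
  | succ n ih =>
    rcases k with _ | k
    · obtain rfl : m = n + 1 := by omega
      simp [gaussR, qp_zero]
    · rcases m with _ | m
      · obtain rfl : k = n := by omega
        have := ih k 0 (by omega)
        rw [gaussR, gauss_zero q k (k + 1) (by omega), qp_succ]
        linear_combination (1 - q ^ (k + 1)) * this
      · have h1 := ih k (m + 1) (by omega)
        have h2 := ih (k + 1) m (by omega)
        rw [gaussR]
        rw [qp_succ] at h1 h2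
        rw [qp_succ, qp_succ, qp_succ]
        obtain rfl : n = k + m + 1 := by omega
        linear_combination (1 - q ^ (k + 1)) * h1 + q ^ (k + 1) * (1 - q ^ (m + 1)) * h2

lemma gauss_div {q : K} (hq : ∀ n, 1 ≤ n → 1 - q ^ n ≠ 0) (n k m : ℕ) (h : k + m = n) :
    gaussR q n k = qp q n * ((qp q k)⁻¹ * (qp q m)⁻¹) := by
  rw [← gauss_qp q n k m h]
  have := qp_ne hq k
  have := qp_ne hq m
  field_simp

open PowerSeries

/-- the other q-exponential -/
noncomputable def EE (q : K) : K⟦X⟧ := PowerSeries.mk fun j => (-1) ^ j * q ^ (j.choose 2) * (qp q j)⁻¹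

lemma EE_q {q : K} (hq : ∀ n, 1 ≤ n → 1 - q ^ n ≠ 0) : EE q = (1 - X) * rescale q (EE q) := by
  ext n
  rw [sub_mul, one_mul, map_sub, coeff_rescale]
  cases n with
  | zero => simp [EE, qp]
  | succ n =>
    rw [coeff_succ_X_mul, coeff_rescale]
    simp only [EE, coeff_mk, qp_succ]
    have := qp_ne hq n
    have := hq (n+1) (by omega)
    rw [Nat.choose_succ_succ' _ 1, Nat.choose_one_right, pow_add]
    field_simp
    ring

lemma EE_HH {q : K} (hq : ∀ n, 1 ≤ n → 1 - q ^ n ≠ 0) : EE q * HH q = 1 := by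
  have h : rescale q (EE q * HH q) = EE q * HH q := by
    rw [map_mul, HH_q hq]
    conv_rhs => rw [EE_q hq]
    ring
  ext n
  rcases n with _ | n
  · rw [coeff_zero_eq_constantCoeff_apply, map_mul, HH_const]
    rw [← coeff_zero_eq_constantCoeff_apply]
    simp [EE, qp]
  · have := congrArg (coeff (n + 1)) h
    rw [coeff_rescale] at this
    have h1 := hq (n + 1) (by omega)
    have : (1 - q ^ (n + 1)) * coeff (n + 1) (EE q * HH q) = 0 := by linear_combination -this
    rw [(mul_eq_zero.mp this).resolve_left h1]
    rw [coeff_one, if_neg (by omega)]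

noncomputable def GG (t q : K) : K⟦X⟧ := PowerSeries.mk fun k => Gm t q k * (qp q k)⁻¹

lemma aj_mul (t : K) (j : ℕ) : (1 - t) * aj t j = (-1) ^ j * (1 - t ^ (j + 1)) := by
  unfold aj
  have := geom_sum_mul_neg t (j + 1)
  rw [← this]; ring

lemma GG_rec {q : K} (hq : ∀ n, 1 ≤ n → 1 - q ^ n ≠ 0) (t : K) :
    GG t q * (EE q - C t * rescale t (EE q)) = C (1 - t) := by
  ext n
  rw [coeff_mul, coeff_C]
  rcases n with _ | n
  · simp [GG, EE, qp, Gm, Wf, LI, filter_singleton, invL]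
  · rw [if_neg (by omega)]
    have h := Gm_rec t q n
    have hn := qp_ne hq (n + 1)
    have : (qp q (n + 1))⁻¹ * (1 - t) * ∑ x ∈ antidiagonal (n + 1),
      aj t x.2 * gaussR q (n + 1) x.2 * q ^ (x.2.choose 2) * Gm t q x.1 = 0 := by rw [h, mul_zero]
    rw [← this, mul_sum]
    refine sum_congr rfl fun x hx => ?_
    have hx := mem_antidiagonal.mp hx
    rw [gauss_div hq (n + 1) x.2 x.1 (by omega), map_sub, coeff_C_mul, coeff_rescale]
    simp only [GG, EE, coeff_mk]
    have := aj_mul t x.2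
    have e : (qp q (n + 1))⁻¹ * (1 - t) * (aj t x.2 * (qp q (n + 1) * ((qp q x.2)⁻¹ * (qp q x.1)⁻¹)) *
      q ^ (x.2.choose 2) * Gm t q x.1) = ((1 - t) * aj t x.2) * ((qp q x.2)⁻¹ * (qp q x.1)⁻¹) *
      q ^ (x.2.choose 2) * Gm t q x.1 := by
      field_simp
    rw [e, this]
    ring

lemma GG_eq {t q : K} (hq : ∀ n, 1 ≤ n → 1 - q ^ n ≠ 0) (ht : t ≠ 1) :
    GG t q = FF t q * rescale t (HH q) := by
  have h1 := GG_rec hq t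
  have h2 := EE_HH hq
  have h3 : rescale t (EE q) * rescale t (HH q) = 1 := by rw [← map_mul, h2, map_one]
  have h4 := FF_DD ht q
  apply mul_right_cancel₀ (DD_ne ht q)
  have e : GG t q * DD t q = C (1 - t) * (HH q * rescale t (HH q)) := by
    rw [← h1, DD]
    linear_combination (-1 : K⟦X⟧) * GG t q * rescale t (HH q) * h2 + GG t q * C t * HH q * h3
  rw [e]
  linear_combination (-1 : K⟦X⟧) * rescale t (HH q) * h4

theorem Atilde_eq {t q : K} (hq : ∀ n, 1 ≤ n → 1 - q ^ n ≠ 0) (ht : t ≠ 1) (n : ℕ) :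
    Atilde K n t q = Gm t q n := by
  have h0 : coeff 0 (FF t q) = 1 := by
    have := pp_main hq ht 0
    rw [← Aq_eq_pp, qp_zero, one_mul] at this
    rw [← this]
    simp [Aq, excN, majN]
  have hG : GG t q = C (1 - t) * HH q + C t * (FF t q * HH q) := by
    rw [GG_eq hq ht, ← FF_DD ht q, DD]; ring
  have hc := congrArg (coeff n) hG
  rw [map_add, coeff_C_mul, coeff_C_mul, coeff_mul] at hc
  simp only [GG, HH, coeff_mk] at hc
  have hn := qp_ne hq n
  have e1 : Gm t q n = qp q n * (Gm t q n * (qp q n)⁻¹) := by field_simp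
  rw [e1, hc, Atilde]
  have e2 : ∑ m ∈ Icc 1 n, gaussR q n m * Aq K m t q =
      qp q n * ∑ x ∈ antidiagonal n, coeff x.1 (FF t q) * (qp q x.2)⁻¹ - 1 := by
    rw [Finset.Nat.sum_antidiagonal_eq_sum_range_succ_mk, sum_range_succ', mul_add]
    have : qp q n * (coeff 0 (FF t q) * (qp q (n - 0))⁻¹) = 1 := by
      rw [h0, Nat.sub_zero]; field_simp
    rw [this, add_sub_cancel_right, mul_sum]
    have e3 : Icc 1 n = (range n).image (· + 1) := by
      ext x; simp only [mem_Icc, mem_image, mem_range]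
      constructor
      · intro h; exact ⟨x - 1, by omega, by omega⟩
      · rintro ⟨a, h, rfl⟩; omega
    rw [e3, sum_image (by intro a _ b _ h; simpa using h)]
    refine sum_congr rfl fun m hm => ?_
    rw [mem_range] at hm
    rw [Aq_eq_pp, pp_main hq ht, gauss_div hq n (m + 1) (n - (m + 1)) (by omega)]
    have := qp_ne hq (m + 1)
    field_simp
  rw [e2]
  field_simp
  ring

end G2
end QBE


namespace QBE

/-- descents of a prefix -/
def dc (f : ℕ → ℕ) (n : ℕ) : ℕ := ∑ i ∈ range n, if Ds f i then 1 else 0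

def ND (f : ℕ → ℕ) (n : ℕ) : Prop := ∀ i, i + 1 < n → ¬ (Ds f i ∧ Ds f (i + 1))

lemma ND_succ (f : ℕ → ℕ) (n : ℕ) : ND f (n + 2) ↔ ND f (n + 1) ∧ ¬ (Ds f n ∧ Ds f (n + 1)) := by
  constructor
  · intro h
    exact ⟨fun i hi => h i (by omega), h n (by omega)⟩
  · rintro ⟨h1, h2⟩ i hi
    by_cases h : i = n
    · subst h; exact h2
    · exact h1 i (by omega)

lemma ND_one (f : ℕ → ℕ) : ND f 1 := by intro i hi; omega
lemma ND_zero (f : ℕ → ℕ) : ND f 0 := by intro i hi; omega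

lemma ND_ascent (f : ℕ → ℕ) (n : ℕ) (h : ¬ Ds f n) : ND f (n + 1) ↔ ND f n := by
  rcases n with _ | n
  · simp [ND_one, ND_zero]
  · rw [ND_succ]; tauto

lemma dc_succ (f : ℕ → ℕ) (n : ℕ) : dc f (n + 1) = dc f n + if Ds f n then 1 else 0 := by
  rw [dc, sum_range_succ]; rfl

lemma Wf_closed {K : Type*} [Field K] (t : K) (f : ℕ → ℕ) (n : ℕ) :
    (ND f n → 2 * dc f n ≤ n ∧ Wf t f n = t ^ dc f n * (1 + t) ^ (n - 2 * dc f n)) ∧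
      (¬ ND f n → Wf t f n = 0) := by
  induction n using Nat.strong_induction_on with
  | _ n ih =>
    match n, ih with
    | 0, _ => simp [dc, Wf, ND_zero]
    | 1, _ => simp [dc, Wf, ND_one, Ds, filter_singleton]
    | n + 2, ih =>
      have i0 := ih n (by omega)
      have i1 := ih (n + 1) (by omega)
      rw [ND_succ, dc_succ]
      by_cases h1 : Ds f (n + 1)
      · by_cases h0 : Ds f n
        · simp [h0, h1, Wf]
        · simp only [h0, h1, Wf, false_and, not_false_eq_true, and_true, if_true, if_false]
          rw [ND_ascent f n h0, dc_succ, if_neg h0]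
          constructor
          · intro h
            obtain ⟨a, b⟩ := i0.1 h
            refine ⟨by omega, ?_⟩
            rw [b, show n + 2 - 2 * (dc f n + 0 + 1) = n - 2 * dc f n by omega]
            ring
          · intro h
            rw [i0.2 h, mul_zero]
      · simp only [h1, Wf, and_false, not_false_eq_true, and_true, if_false, add_zero]
        constructor
        · intro h
          obtain ⟨a, b⟩ := i1.1 h
          refine ⟨by omega, ?_⟩
          rw [b, show n + 2 - 2 * (dc f (n + 1)) = (n + 1 - 2 * dc f (n + 1)) + 1 by omega]
          ring
        · intro h
          rw [i1.2 h, mul_zero]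

lemma invL_eq (l : List ℕ) : invL l = ∑ i ∈ range l.length, ∑ j ∈ range l.length,
    if i < j ∧ gf l j < gf l i then 1 else 0 := by
  induction l with
  | nil => rfl
  | cons x l ih =>
    rw [invL, ih, List.length_cons, sum_range_succ']
    rw [add_comm]
    congr 1
    · refine sum_congr rfl fun i _ => ?_
      rw [sum_range_succ']
      simp [gf]
    · rw [sum_range_succ']
      simp only [gf, lt_irrefl, false_and, if_false, add_zero, Nat.succ_pos, true_and,
        List.getD_cons_succ, List.getD_cons_zero]
      clear ih
      induction l with
      | nil => simp
      | cons y l ih =>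
        rw [List.countP_cons, List.length_cons, sum_range_succ', ih]
        simp

lemma invN_eq {n : ℕ} (π : Equiv.Perm (Fin n)) : invL (List.ofFn fun i => (π i : ℕ)) = invN π := by
  rw [invL_eq, List.length_ofFn, invN, card_filter, sum_product]
  refine sum_congr rfl fun i hi => sum_congr rfl fun j hj => ?_
  rw [gf_ofFn π (mem_range.mp hi), gf_ofFn π (mem_range.mp hj)]

lemma des_eq {n : ℕ} (π : Equiv.Perm (Fin n)) : dc (pf π) n = desN π := by
  rw [desN, card_filter]
  rcases n with _ | n
  · rfl
  · rw [dc, sum_range_succ', Nat.add_sub_cancel]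
    simp [Ds]

lemma pf_lt {n : ℕ} (π : Equiv.Perm (Fin n)) {i : ℕ} (h : i < n) : pf π i < n := by
  unfold pf; rw [dif_pos h]; exact (π _).2

lemma dd_eq {n : ℕ} (π : Equiv.Perm (Fin n)) : ddN π = 0 ↔ ND (pf π) n := by
  rw [ddN, card_eq_zero, filter_eq_empty_iff]
  constructor
  · intro h i hi hd
    obtain ⟨⟨h1, h2⟩, -, h3⟩ := hd
    obtain ⟨j, rfl⟩ := Nat.exists_eq_succ_of_ne_zero h1
    refine h (x := j + 2) (by rw [mem_Icc]; omega) ?_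
    unfold extv
    rw [if_pos (by omega), if_pos (by omega), if_pos (by omega)]
    exact ⟨h3, h2⟩
  · intro h i hi hd
    rw [mem_Icc] at hi
    obtain ⟨j, rfl⟩ : ∃ j, i = j + 2 := ⟨i - 2, by omega⟩
    unfold extv at hd
    rw [if_pos (by omega : 1 ≤ j + 2 ∧ j + 2 ≤ n), if_pos (by omega : 1 ≤ j + 2 - 1 ∧ j + 2 - 1 ≤ n)] at hd
    by_cases hj : j + 3 ≤ n
    · rw [if_pos (by omega)] at hd
      exact h (j + 1) (by omega) ⟨⟨by omega, hd.2⟩, by omega, hd.1⟩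
    · rw [if_neg (by omega)] at hd
      have := pf_lt π (i := j + 2 - 1) (by omega)
      omega

/-- right-hand side -/
def RH (R : Type*) [CommRing R] (n : ℕ) (t q : R) : R :=
  ∑ k ∈ range (n / 2 + 1),
    (∑ σ ∈ Finset.univ.filter
      (fun σ : Equiv.Perm (Fin n) => ddN σ = 0 ∧ desN σ = k), q ^ invN σ) *
      t ^ k * (1 + t) ^ (n - 2 * k)

lemma RH_eq {K : Type*} [Field K] (t q : K) (n : ℕ) : RH K n t q = Gm t q n := by
  rw [Gm, ← perm_sum, RH]
  have : ∀ π : Equiv.Perm (Fin n), q ^ invL (List.ofFn fun i => (π i : ℕ)) *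
      Wf t (gf (List.ofFn fun i => (π i : ℕ))) n =
      ∑ k ∈ range (n / 2 + 1), if ddN π = 0 ∧ desN π = k then
        q ^ invN π * t ^ k * (1 + t) ^ (n - 2 * k) else 0 := by
    intro π
    have hW : Wf t (gf (List.ofFn fun i => (π i : ℕ))) n = Wf t (pf π) n := by
      apply Wf_congr
      intro i hi
      unfold Ds
      rw [gf_ofFn π hi, gf_ofFn π (by omega)]
    rw [hW, invN_eq]
    have hc := Wf_closed t (pf π) n
    rw [← dd_eq, des_eq] at hc
    by_cases h : ddN π = 0
    · obtain ⟨h1, h2⟩ := hc.1 h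
      rw [h2, sum_eq_single (desN π)]
      · simp only [h, true_and, if_true]; ring
      · intro k _ hk
        rw [if_neg (by rintro ⟨-, h⟩; exact hk h.symm)]
      · intro hk
        exfalso; apply hk; rw [mem_range]; omega
    · rw [hc.2 h]
      simp [h]
  rw [sum_congr rfl (fun π _ => this π), sum_comm]
  refine sum_congr rfl fun k _ => ?_
  rw [sum_mul, sum_mul, sum_filter]

section Transfer
variable {R S : Type*} [CommRing R] [CommRing S] (φ : R →+* S)

lemma gauss_map (q : R) (n k : ℕ) : φ (gaussR q n k) = gaussR (φ q) n k := by
  induction n generalizing k with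
  | zero => cases k <;> simp [gaussR]
  | succ n ih => cases k <;> simp [gaussR, ih]

lemma Atilde_map (n : ℕ) (t q : R) : φ (Atilde R n t q) = Atilde S n (φ t) (φ q) := by
  simp [Atilde, Aq, gauss_map]

lemma RH_map (n : ℕ) (t q : R) : φ (RH R n t q) = RH S n (φ t) (φ q) := by
  simp [RH]

end Transfer

theorem final {R : Type*} [CommRing R] (t q : R) (n : ℕ) : Atilde R n t q = RH R n t q := by
  let P := MvPolynomial (Fin 2) ℤ
  let T : P := MvPolynomial.X 0
  let Q : P := MvPolynomial.X 1
  let ι : P →+* FractionRing P := algebraMap P (FractionRing P)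
  have hι : Function.Injective ι := IsFractionRing.injective P (FractionRing P)
  let ε : P →+* ℤ := MvPolynomial.eval (fun _ => 0)
  have eT : ε T = 0 := MvPolynomial.eval_X _
  have eQ : ε Q = 0 := MvPolynomial.eval_X _
  have hT : ι T ≠ 1 := by
    intro h
    rw [← map_one ι] at h
    have := congrArg ε (hι h)
    rw [eT, map_one] at this
    exact zero_ne_one this
  have hQ : ∀ m, 1 ≤ m → 1 - ι Q ^ m ≠ 0 := by
    intro m hm h
    rw [← map_one ι, ← map_pow, ← map_sub, ← map_zero ι] at h
    have := congrArg ε (hι h)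
    rw [map_sub, map_one, map_pow, eQ, map_zero, zero_pow (by omega)] at this
    omega
  have h1 : Atilde P n T Q = RH P n T Q := by
    apply hι
    rw [Atilde_map, RH_map, RH_eq, Atilde_eq hQ hT]
  let ψ : P →+* R := MvPolynomial.eval₂Hom (Int.castRingHom R) ![t, q]
  have h2 := congrArg ψ h1
  rw [Atilde_map, RH_map] at h2
  have fT : ψ T = t := MvPolynomial.eval₂_X _ _ _
  have fQ : ψ Q = q := MvPolynomial.eval₂_X _ _ _
  rwa [fT, fQ] at h2

end QBE


/-- the q-γ-positivity expansion of the q-binomial-Eulerian polynomials,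
with `γ̃_{n,k}(q) = ∑_{σ ∈ Γ̃_{n,k}} q^{inv σ}` over permutations with no non-initial
double descents and exactly k descents. -/
theorem stmt10 {R : Type*} [CommRing R] (t q : R) (n : ℕ) (hn : 1 ≤ n) :
    Atilde R n t q =
      ∑ k ∈ range (n / 2 + 1),
        (∑ σ ∈ Finset.univ.filter
            (fun σ : Equiv.Perm (Fin n) => ddN σ = 0 ∧ desN σ = k), q ^ invN σ) *
          t ^ k * (1 + t) ^ (n - 2 * k) := by
  exact QBE.final t q n
end

section
/- For n ≥ 1, the signed q-binomial-Eulerian polynomial satisfies Ã_n(t,-1) = 1 + t ∑_{k=1}^m C(m,k) (1+t)^k A_k(t) when n = 2m, and Ã_n(t,-1) = 1 + t ∑_{k=0}^m C(m,k) (1+t)^k (A_k(t) + A_{k+1}(t)) when n = 2m+1, with the convention A_0(t) = 0. -/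
open Finset

lemma pf_lt {n : ℕ} (π : Equiv.Perm (Fin n)) {i : ℕ} (h : i < n) : pf π i < n := by
  simp [pf, h]

lemma pf_inj {n : ℕ} (π : Equiv.Perm (Fin n)) {i j : ℕ} (hi : i < n) (hj : j < n)
    (h : pf π i = pf π j) : i = j := by
  simp only [pf, hi, hj, dite_true] at h
  have := π.injective (Fin.ext h)
  simpa using this

lemma gauss_neg_one {R : Type*} [CommRing R] (m : ℕ) :
    (∀ k, gaussR (-1 : R) (2 * m) (2 * k) = (m.choose k : R)) ∧
    (∀ k, gaussR (-1 : R) (2 * m) (2 * k + 1) = 0) ∧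
    (∀ k, gaussR (-1 : R) (2 * m + 1) (2 * k) = (m.choose k : R)) ∧
    (∀ k, gaussR (-1 : R) (2 * m + 1) (2 * k + 1) = (m.choose k : R)) := by
  have step : ∀ m : ℕ, (∀ k, gaussR (-1 : R) (2 * m) (2 * k) = (m.choose k : R)) →
      (∀ k, gaussR (-1 : R) (2 * m) (2 * k + 1) = 0) →
      (∀ k, gaussR (-1 : R) (2 * m + 1) (2 * k) = (m.choose k : R)) ∧
      (∀ k, gaussR (-1 : R) (2 * m + 1) (2 * k + 1) = (m.choose k : R)) := by
    intro m h1 h2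
    constructor
    · intro k
      cases k with
      | zero => simp [gaussR]
      | succ k =>
        rw [show 2 * (k + 1) = (2 * k + 1) + 1 by ring, gaussR, h2,
          show (2 * k + 1) + 1 = 2 * (k + 1) by ring, h1]
        simp
    · intro k
      rw [gaussR, h1, h2]; simp
  induction m with
  | zero =>
    have h1 : ∀ k, gaussR (-1 : R) (2 * 0) (2 * k) = ((0 : ℕ).choose k : R) := by
      intro k; cases k with
      | zero => simp [gaussR]
      | succ k => rw [show 2 * (k + 1) = (2 * k + 1) + 1 by ring]; simp [gaussR]
    have h2 : ∀ k, gaussR (-1 : R) (2 * 0) (2 * k + 1) = 0 := by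
      intro k; simp [gaussR]
    exact ⟨h1, h2, step 0 h1 h2⟩
  | succ m ih =>
    obtain ⟨-, -, h3, h4⟩ := ih
    have h1 : ∀ k, gaussR (-1 : R) (2 * (m + 1)) (2 * k) = ((m + 1).choose k : R) := by
      intro k; cases k with
      | zero => simp [gaussR]
      | succ k =>
        rw [show 2 * (k + 1) = (2 * k + 1) + 1 by ring, show 2 * (m + 1) = (2 * m + 1) + 1 by ring,
          gaussR, h4, show (2 * k + 1) + 1 = 2 * (k + 1) by ring, h3, Nat.choose_succ_succ]
        simp
    have h2 : ∀ k, gaussR (-1 : R) (2 * (m + 1)) (2 * k + 1) = 0 := by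
      intro k
      rw [show 2 * (m + 1) = (2 * m + 1) + 1 by ring, gaussR, h3, h4]
      simp [pow_succ]
    exact ⟨h1, h2, step _ h1 h2⟩

lemma exc_le_maj {n : ℕ} (π : Equiv.Perm (Fin n)) : excN π ≤ majN π := by
  -- positions after the last descent are not excedances
  by_contra hlt
  push Not at hlt
  set M := majN π with hM
  have hd : ∀ i, M ≤ i → i + 1 < n → pf π i < pf π (i + 1) := by
    intro i hi hin
    by_contra hc
    have hne : pf π (i + 1) ≠ pf π i := fun h => by
      have := pf_inj π hin (by omega) h; omega
    have hmem : i ∈ (range (n - 1)).filter (fun i => pf π (i + 1) < pf π i) := by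
      simp; omega
    have := Finset.single_le_sum (f := fun i => i + 1) (fun _ _ => Nat.zero_le _) hmem
    have h2 : i + 1 ≤ M := this
    omega
  have hb : ∀ d i, M ≤ i → i + d + 1 = n → pf π i ≤ i := by
    intro d
    induction d with
    | zero => intro i hi h; have := pf_lt π (i := i) (by omega); omega
    | succ d ih =>
      intro i hi h
      have h1 := ih (i + 1) (by omega) (by omega)
      have h2 := hd i hi (by omega)
      omega
  have : excN π ≤ (range M).card := by
    apply Finset.card_le_card
    intro i hi
    simp only [mem_filter, Finset.mem_range] at hi ⊢
    by_contra hc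
    have := hb (n - 1 - i) i (by omega) (by omega)
    omega
  simp at this
  omega

lemma sum_even (M : Type*) [AddCommMonoid M] (f : ℕ → M) (m : ℕ) :
    ∑ i ∈ Icc 1 (2 * m), f i = ∑ k ∈ Icc 1 m, f (2 * k) + ∑ k ∈ range m, f (2 * k + 1) := by
  induction m with
  | zero => simp
  | succ m ih =>
    rw [show 2 * (m + 1) = (2 * m + 1) + 1 by ring, sum_Icc_succ_top (by omega),
      sum_Icc_succ_top (by omega), ih, sum_Icc_succ_top (by omega), sum_range_succ,
      show 2 * (m + 1) = (2 * m + 1) + 1 by ring]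
    abel

/-! ### Equidistribution of descents and excedances -/

lemma card_split (N : ℕ) (S : ℕ) (P : Fin N → Prop) [DecidablePred P] {M : Type*} [AddCommMonoid M]
    (a b : M) (hS : (univ.filter P).card = S) :
    ∑ y : Fin N, (if P y then a else b) = S • a + (N - S) • b := by
  rw [sum_ite, sum_const, sum_const, hS]
  congr 2
  have := card_filter_add_card_filter_not (s := (univ : Finset (Fin N))) P
  simp at this
  omega

lemma exc_fin {n : ℕ} (π : Equiv.Perm (Fin n)) :
    excN π = ∑ i : Fin n, if i < π i then 1 else 0 := by
  unfold excN
  rw [card_filter, ← Fin.sum_univ_eq_sum_range (fun i => if i < pf π i then 1 else 0)]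
  apply sum_congr rfl
  intro i _
  simp [pf]

lemma exc_decomp_zero {n : ℕ} (e : Equiv.Perm (Fin n)) :
    excN (Equiv.Perm.decomposeFin.symm (0, e)) = excN e := by
  rw [exc_fin, exc_fin, Fin.sum_univ_succ]
  simp

lemma exc_decomp_succ {n : ℕ} (e : Equiv.Perm (Fin n)) (y : Fin n) :
    excN (Equiv.Perm.decomposeFin.symm (y.succ, e)) =
      if e.symm y < y then excN e else excN e + 1 := by
  have key : excN (Equiv.Perm.decomposeFin.symm (y.succ, e)) + (if e.symm y < y then 1 else 0)
      = excN e + 1 := by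
    rw [exc_fin, exc_fin, Fin.sum_univ_succ]
    have h1 : ∀ i : Fin n, ((if i.succ < Equiv.Perm.decomposeFin.symm (y.succ, e) i.succ
        then 1 else 0 : ℕ)) + (if i = e.symm y then (if e.symm y < y then 1 else 0) else 0)
        = if i < e i then 1 else 0 := by
      intro i
      rw [Equiv.Perm.decomposeFin_symm_apply_succ]
      by_cases hi : i = e.symm y
      · subst hi; simp
      · have : e i ≠ y := fun h => hi (by simp [← h])
        rw [Equiv.swap_apply_of_ne_of_ne (Fin.succ_ne_zero _) (by simpa using this)]
        simp [hi]
    rw [← sum_congr rfl (fun i _ => h1 i), sum_add_distrib]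
    simp
    ring
  split_ifs at key ⊢ <;> omega

lemma exc_rec {M : Type*} [AddCommMonoid M] (n : ℕ) (f : ℕ → M) :
    ∑ π : Equiv.Perm (Fin (n + 1)), f (excN π) =
      ∑ e : Equiv.Perm (Fin n), ((1 + excN e) • f (excN e) + (n - excN e) • f (excN e + 1)) := by
  rw [← Equiv.sum_comp Equiv.Perm.decomposeFin.symm, Fintype.sum_prod_type_right]
  apply sum_congr rfl
  intro e _
  rw [Fin.sum_univ_succ]
  simp only [exc_decomp_zero, exc_decomp_succ]
  simp only [apply_ite f]
  rw [card_split n (excN e) (fun y => e.symm y < y)]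
  · rw [add_smul, one_smul, add_assoc]
  · rw [exc_fin, card_filter, ← Equiv.sum_comp e]
    simp

/-- Insert the largest letter at position `p`. -/
def insMax {n : ℕ} (p : Fin (n + 1)) (e : Equiv.Perm (Fin n)) : Equiv.Perm (Fin (n + 1)) :=
  (finSuccEquiv' p).trans ((Equiv.optionCongr e).trans (finSuccEquiv' (Fin.last n)).symm)

lemma insMax_self {n : ℕ} (p : Fin (n + 1)) (e : Equiv.Perm (Fin n)) :
    insMax p e p = Fin.last n := by simp [insMax]

lemma insMax_succAbove {n : ℕ} (p : Fin (n + 1)) (e : Equiv.Perm (Fin n)) (i : Fin n) :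
    insMax p e (p.succAbove i) = (e i).castSucc := by simp [insMax]

lemma insMax_bij (n : ℕ) : Function.Bijective
    (fun x : Fin (n + 1) × Equiv.Perm (Fin n) => insMax x.1 x.2) := by
  rw [Fintype.bijective_iff_injective_and_card]
  constructor
  · rintro ⟨p, e⟩ ⟨p', e'⟩ h
    simp only at h
    have hp : p = p' := by
      have h1 := insMax_self p e
      rw [h, ← insMax_self p' e'] at h1
      exact (insMax p' e').injective h1
    subst hp
    congr 1
    ext i
    have h1 := insMax_succAbove p e i
    rw [h, insMax_succAbove] at h1
    have := Fin.castSucc_injective _ h1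
    rw [this]
  · simp [Fintype.card_perm, Nat.factorial_succ]

lemma pf_insMax_lt {n : ℕ} (p : Fin (n + 1)) (e : Equiv.Perm (Fin n)) (i : ℕ) (h : i < p) :
    pf (insMax p e) i = pf e i := by
  have hi : i < n := by omega
  have := insMax_succAbove p e ⟨i, hi⟩
  rw [Fin.succAbove_of_castSucc_lt _ _ (by simpa [Fin.lt_def] using h)] at this
  have h2 : i < n + 1 := by omega
  simp only [pf, hi, h2, dite_true]
  have h3 := congrArg Fin.val this
  simpa using h3

lemma pf_insMax_eq {n : ℕ} (p : Fin (n + 1)) (e : Equiv.Perm (Fin n)) :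
    pf (insMax p e) p = n := by
  have := p.isLt
  simp only [pf, this, dite_true, Fin.eta, insMax_self, Fin.val_last]

lemma pf_insMax_gt {n : ℕ} (p : Fin (n + 1)) (e : Equiv.Perm (Fin n)) (i : ℕ) (h : (p : ℕ) ≤ i)
    (hi : i < n) : pf (insMax p e) (i + 1) = pf e i := by
  have := insMax_succAbove p e ⟨i, hi⟩
  rw [Fin.succAbove_of_le_castSucc _ _ (by simpa [Fin.le_def] using h)] at this
  have h2 : i + 1 < n + 1 := by omega
  simp only [pf, hi, h2, dite_true]
  have h3 := congrArg Fin.val this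
  simpa using h3

lemma des_insMax {n : ℕ} (p : Fin (n + 1)) (e : Equiv.Perm (Fin n)) :
    desN (insMax p e) = if (p : ℕ) = n ∨ (0 < (p : ℕ) ∧ pf e p < pf e (p - 1))
      then desN e else desN e + 1 := by
  unfold desN
  rw [card_filter, card_filter, Nat.add_sub_cancel]
  obtain ⟨p, hp⟩ := p
  have hl := pf_insMax_lt ⟨p, hp⟩ e
  have he := pf_insMax_eq ⟨p, hp⟩ e
  have hg := pf_insMax_gt ⟨p, hp⟩ e
  set w' := pf (insMax ⟨p, hp⟩ e) with hw'
  simp only at hl he hg ⊢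
  -- the part before p
  have A : ∀ k, p = k + 1 → ∑ i ∈ range p, (if w' (i + 1) < w' i then 1 else 0) =
      ∑ i ∈ range k, (if pf e (i + 1) < pf e i then 1 else 0) := by
    intro k hk
    subst hk
    rw [sum_range_succ, he, hl k (by omega), if_neg, add_zero]
    · apply sum_congr rfl
      intro i hi
      rw [mem_range] at hi
      rw [hl i (by omega), hl (i + 1) (by omega)]
    · have := pf_lt e (i := k) (by omega); omega
  by_cases hpn : p = n
  · subst hpn
    rw [if_pos (Or.inl rfl)]
    cases p with
    | zero => simp
    | succ k => rw [A k rfl]; simp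
  · obtain ⟨r, rfl⟩ : ∃ r, n = p + 1 + r := ⟨n - p - 1, by omega⟩
    have B : ∑ j ∈ range r, (if w' (p + 1 + j + 1) < w' (p + 1 + j) then 1 else 0) =
        ∑ j ∈ range r, (if pf e (p + j + 1) < pf e (p + j) then 1 else 0) := by
      apply sum_congr rfl
      intro j hj
      rw [mem_range] at hj
      rw [hg (p + 1 + j) (by omega) (by omega), show p + 1 + j = (p + j) + 1 by ring,
        hg (p + j) (by omega) (by omega)]
    rw [sum_range_add, B, sum_range_succ, he, hg p le_rfl (by omega),
      if_pos (pf_lt e (by omega)), show p + 1 + r - 1 = p + r by omega, sum_range_add]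
    cases p with
    | zero =>
      rw [if_neg (by simp; omega)]
      simp; ring
    | succ k =>
      rw [A k rfl, sum_range_succ]
      simp only [hpn, false_or, Nat.succ_pos, true_and, Nat.add_sub_cancel]
      split_ifs <;> ring

lemma des_rec {M : Type*} [AddCommMonoid M] (n : ℕ) (f : ℕ → M) :
    ∑ π : Equiv.Perm (Fin (n + 1)), f (desN π) =
      ∑ e : Equiv.Perm (Fin n), ((1 + desN e) • f (desN e) + (n - desN e) • f (desN e + 1)) := by
  rw [← Equiv.sum_comp (Equiv.ofBijective _ (insMax_bij n)), Fintype.sum_prod_type_right]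
  apply sum_congr rfl
  intro e _
  simp only [Equiv.ofBijective_apply, des_insMax, apply_ite f]
  rw [card_split (n + 1) (1 + desN e)
    (fun p : Fin (n + 1) => (p : ℕ) = n ∨ (0 < (p : ℕ) ∧ pf e p < pf e (p - 1)))]
  · rw [show n + 1 - (1 + desN e) = n - desN e by omega]
  · unfold desN
    rw [card_filter, card_filter,
      Fin.sum_univ_eq_sum_range
        (fun p => if p = n ∨ (0 < p ∧ pf e p < pf e (p - 1)) then 1 else 0),
      sum_range_succ, if_pos (Or.inl rfl), add_comm]
    congr 1
    cases n with
    | zero => simp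
    | succ k =>
      rw [sum_range_succ']
      simp
      congr 1
      apply filter_congr
      intro i hi
      rw [mem_range] at hi
      constructor
      · rintro (h | h)
        · omega
        · exact h
      · exact Or.inr

lemma des_exc_equi {M : Type*} [AddCommMonoid M] (n : ℕ) : ∀ f : ℕ → M,
    ∑ π : Equiv.Perm (Fin n), f (desN π) = ∑ π : Equiv.Perm (Fin n), f (excN π) := by
  induction n with
  | zero => intro f; simp [desN, excN]
  | succ n ih =>
    intro f
    rw [des_rec, exc_rec]
    exact ih (fun d => (1 + d) • f d + (n - d) • f (d + 1))

lemma eulerPoly_exc (R : Type*) [CommRing R] (n : ℕ) (t : R) :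
    eulerPoly R n t = ∑ π : Equiv.Perm (Fin n), t ^ excN π := des_exc_equi n _

/-! ### The signed sum -/

/-- Excedance weight. -/
def wt {R : Type*} [CommRing R] (s : R) (i v : ℕ) : R := if i < v then s else 1

/-- Sign of the pair of positions `2j, 2j+1`. -/
def sg (R : Type*) [CommRing R] {n : ℕ} (π : Equiv.Perm (Fin n)) (j : ℕ) : R :=
  if pf π (2 * j + 1) < pf π (2 * j) then -1 else 1

lemma prod_pairs {M : Type*} [CommMonoid M] (g : ℕ → M) (m : ℕ) :
    ∏ i ∈ range (2 * m), g i = ∏ j ∈ range m, (g (2 * j) * g (2 * j + 1)) := by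
  induction m with
  | zero => simp
  | succ m ih =>
    rw [show 2 * (m + 1) = 2 * m + 1 + 1 by ring, prod_range_succ, prod_range_succ, ih,
      prod_range_succ, mul_assoc]

lemma neg_one_maj {R : Type*} [CommRing R] {n m : ℕ} (h1 : 2 * m ≤ n) (h2 : n ≤ 2 * m + 1)
    (π : Equiv.Perm (Fin n)) : (-1 : R) ^ majN π = ∏ j ∈ range m, sg R π j := by
  unfold majN
  rw [← prod_pow_eq_pow_sum, prod_filter]
  have key : ∏ i ∈ range (2 * m), (if pf π (i + 1) < pf π i then (-1 : R) ^ (i + 1) else 1) =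
      ∏ j ∈ range m, sg R π j := by
    rw [prod_pairs]
    apply prod_congr rfl
    intro j _
    have e1 : (-1 : R) ^ (2 * j + 1) = -1 := by simp [pow_succ]
    have e2 : (-1 : R) ^ (2 * j + 1 + 1) = 1 := by simp [pow_succ]
    rw [e1, e2]
    simp [sg]
  rw [← key]
  rcases (by omega : n = 2 * m ∨ n = 2 * m + 1) with h | h
  · cases m with
    | zero => simp [h]
    | succ k =>
      rw [show n - 1 = 2 * k + 1 by omega, show 2 * (k + 1) = 2 * k + 1 + 1 by ring,
        prod_range_succ _ (2 * k + 1)]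
      have e2 : (-1 : R) ^ (2 * k + 1 + 1) = 1 := by simp [pow_succ]
      rw [e2]; simp
  · rw [show range (n - 1) = range (2 * m) by rw [h, Nat.add_sub_cancel]]

lemma pow_exc {R : Type*} [CommRing R] (s : R) {n m : ℕ} (h1 : 2 * m ≤ n) (h2 : n ≤ 2 * m + 1)
    (π : Equiv.Perm (Fin n)) : s ^ excN π =
      ∏ j ∈ range m, (wt s (2 * j) (pf π (2 * j)) * wt s (2 * j + 1) (pf π (2 * j + 1))) := by
  unfold excN
  rw [← prod_pairs (fun i => wt s i (pf π i)), ← prod_const, prod_filter]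
  rcases (by omega : n = 2 * m ∨ n = 2 * m + 1) with h | h
  · rw [show range n = range (2 * m) by rw [h]]; rfl
  · rw [show range n = range (2 * m + 1) by rw [h], prod_range_succ, if_neg, mul_one]
    · rfl
    · have := pf_lt π (i := 2 * m) (by omega); omega

/-- main part -/
def eP {R : Type*} [CommRing R] (s : R) {n : ℕ} (π : Equiv.Perm (Fin n)) (j : ℕ) : R :=
  sg R π j * ((if pf π (2 * j) = 2 * j + 1 then s - 1 else 0) *
    wt s (2 * j + 1) (pf π (2 * j + 1)))

/-- antisymmetric part -/
def rP {R : Type*} [CommRing R] (s : R) {n : ℕ} (π : Equiv.Perm (Fin n)) (j : ℕ) : R :=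
  sg R π j * (wt s (2 * j + 1) (pf π (2 * j)) * wt s (2 * j + 1) (pf π (2 * j + 1)))

lemma term_eq {R : Type*} [CommRing R] (t : R) {n m : ℕ} (h1 : 2 * m ≤ n) (h2 : n ≤ 2 * m + 1)
    (π : Equiv.Perm (Fin n)) : t ^ excN π * (-1) ^ (majN π - excN π) =
      ∏ j ∈ range m, (eP (-t) π j + rP (-t) π j) := by
  have h : (-1 : R) ^ majN π = (-1) ^ (majN π - excN π) * (-1) ^ excN π := by
    rw [← pow_add, Nat.sub_add_cancel (exc_le_maj π)]
  have h' : t ^ excN π * (-1) ^ (majN π - excN π) = (-1) ^ majN π * (-t) ^ excN π := by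
    rw [h, mul_assoc, ← mul_pow]; simp [mul_comm]
  rw [h', neg_one_maj h1 h2, pow_exc (-t) h1 h2, ← prod_mul_distrib]
  apply prod_congr rfl
  intro j _
  unfold eP rP
  rw [← mul_add, ← add_mul]
  congr 2
  unfold wt
  split_ifs <;> first | omega | ring

lemma pf_swap {n : ℕ} (π : Equiv.Perm (Fin n)) (a b : Fin n) (i : ℕ) :
    pf (π * Equiv.swap a b) i = if i = a then pf π b else if i = b then pf π a else pf π i := by
  unfold pf
  by_cases h : i < n
  · simp only [h, dite_true, a.isLt, b.isLt, Equiv.Perm.mul_apply, Equiv.swap_apply_def,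
      Fin.ext_iff, Fin.eta]
    split_ifs <;> rfl
  · have := a.isLt
    have := b.isLt
    simp only [h, dite_false]
    rw [if_neg (by omega), if_neg (by omega)]

lemma vanish {R : Type*} [CommRing R] (s : R) {n m : ℕ} (h1 : 2 * m ≤ n) (T : Finset ℕ)
    (j : ℕ) (hj : j ∈ range m \ T) :
    ∑ π : Equiv.Perm (Fin n), (∏ i ∈ T, eP s π i) * ∏ i ∈ range m \ T, rP s π i = 0 := by
  have hj' := hj
  rw [mem_sdiff, mem_range] at hj'
  let a : Fin n := ⟨2 * j, by omega⟩
  let b : Fin n := ⟨2 * j + 1, by omega⟩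
  have hab : a ≠ b := by simp [a, b]
  have p0 : ∀ π : Equiv.Perm (Fin n), pf (π * Equiv.swap a b) (2 * j) = pf π (2 * j + 1) := by
    intro π; rw [pf_swap]; simp [a, b]
  have p1 : ∀ π : Equiv.Perm (Fin n), pf (π * Equiv.swap a b) (2 * j + 1) = pf π (2 * j) := by
    intro π; rw [pf_swap]; simp [a, b]
  have p2 : ∀ π : Equiv.Perm (Fin n), ∀ i, i ≠ j →
      pf (π * Equiv.swap a b) (2 * i) = pf π (2 * i) := by
    intro π i hi; rw [pf_swap, if_neg (by simp [a]; omega), if_neg (by simp [b]; omega)]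
  have p3 : ∀ π : Equiv.Perm (Fin n), ∀ i, i ≠ j →
      pf (π * Equiv.swap a b) (2 * i + 1) = pf π (2 * i + 1) := by
    intro π i hi; rw [pf_swap, if_neg (by simp [a]; omega), if_neg (by simp [b]; omega)]
  apply sum_ninvolution (fun π => π * Equiv.swap a b)
  · intro π
    rw [← mul_prod_erase _ _ hj, ← mul_prod_erase _ _ hj]
    have hr : rP s (π * Equiv.swap a b) j = - rP s π j := by
      have hne : pf π (2 * j) ≠ pf π (2 * j + 1) := fun h => by
        have := pf_inj π (by omega) (by omega) h; omega
      unfold rP sg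
      rw [p0, p1]
      split_ifs <;> first | omega | ring
    have hE : ∏ i ∈ T, eP s (π * Equiv.swap a b) i = ∏ i ∈ T, eP s π i := by
      apply prod_congr rfl
      intro i hi
      have hij : i ≠ j := by rintro rfl; exact hj'.2 hi
      unfold eP sg
      rw [p2 π i hij, p3 π i hij]
    have hR : ∏ i ∈ (range m \ T).erase j, rP s (π * Equiv.swap a b) i =
        ∏ i ∈ (range m \ T).erase j, rP s π i := by
      apply prod_congr rfl
      intro i hi
      have hij : i ≠ j := (mem_erase.mp hi).1
      unfold rP sg
      rw [p2 π i hij, p3 π i hij]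
    rw [hr, hE, hR]
    ring
  · intro π _ h
    have : Equiv.swap a b = 1 := by simpa using h
    exact hab (Equiv.swap_eq_one_iff.mp this)
  · intro π; simp
  · intro π; simp [mul_assoc]

lemma Aq_eq_main {R : Type*} [CommRing R] (t : R) {n m : ℕ} (h1 : 2 * m ≤ n)
    (h2 : n ≤ 2 * m + 1) :
    Aq R n t (-1) = ∑ π : Equiv.Perm (Fin n), ∏ j ∈ range m, eP (-t) π j := by
  unfold Aq
  simp only [term_eq t h1 h2, prod_add]
  rw [sum_comm, sum_eq_single (range m)]
  · simp
  · intro T hT hne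
    have : (range m \ T).Nonempty := by
      rw [sdiff_nonempty]
      intro h
      exact hne (Subset.antisymm (mem_powerset.mp hT) h)
    obtain ⟨j, hj⟩ := this
    exact vanish (-t) h1 T j hj
  · simp

/-- positions -/
noncomputable def posE (n m : ℕ) (h1 : 2 * m ≤ n) (h2 : n ≤ 2 * m + 1) : Fin m ⊕ Fin (n - m) ≃ Fin n :=
  Equiv.ofBijective (Sum.elim (fun j => ⟨2 * j, by omega⟩)
    (fun j => if h : (j : ℕ) < m then ⟨2 * j + 1, by omega⟩ else ⟨2 * m, by omega⟩)) (by
    rw [Fintype.bijective_iff_injective_and_card]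
    constructor
    · rintro (⟨a, ha⟩ | ⟨a, ha⟩) (⟨b, hb⟩ | ⟨b, hb⟩) h
      · simp at h ⊢; omega
      · simp at h
        split_ifs at h <;> simp at h <;> omega
      · simp at h
        split_ifs at h <;> simp at h <;> omega
      · simp at h ⊢
        split_ifs at h <;> simp at h <;> omega
    · simp; omega)

/-- values -/
noncomputable def valE (n m : ℕ) (h1 : 2 * m ≤ n) (h2 : n ≤ 2 * m + 1) : Fin m ⊕ Fin (n - m) ≃ Fin n :=
  Equiv.ofBijective (Sum.elim (fun j => ⟨2 * j + 1, by omega⟩)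
    (fun j => ⟨2 * j, by omega⟩)) (by
    rw [Fintype.bijective_iff_injective_and_card]
    constructor
    · rintro (⟨a, ha⟩ | ⟨a, ha⟩) (⟨b, hb⟩ | ⟨b, hb⟩) h <;> simp at h ⊢ <;> omega
    · simp; omega)

/-- The permutation with `π(2j) = 2j+1` and the rest given by `σ`. -/
noncomputable def bld (n m : ℕ) (h1 : 2 * m ≤ n) (h2 : n ≤ 2 * m + 1) (σ : Equiv.Perm (Fin (n - m))) :
    Equiv.Perm (Fin n) :=
  (posE n m h1 h2).symm.trans ((Equiv.sumCongr (Equiv.refl _) σ).trans (valE n m h1 h2))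

lemma pf_bld_even {n m : ℕ} (h1 : 2 * m ≤ n) (h2 : n ≤ 2 * m + 1) (σ : Equiv.Perm (Fin (n - m)))
    (j : ℕ) (hj : j < m) : pf (bld n m h1 h2 σ) (2 * j) = 2 * j + 1 := by
  have hp : posE n m h1 h2 (Sum.inl ⟨j, hj⟩) = ⟨2 * j, by omega⟩ := rfl
  have h : 2 * j < n := by omega
  simp only [pf, h, dite_true, bld, Equiv.trans_apply]
  rw [← hp, Equiv.symm_apply_apply]
  rfl

lemma pf_bld_odd {n m : ℕ} (h1 : 2 * m ≤ n) (h2 : n ≤ 2 * m + 1) (σ : Equiv.Perm (Fin (n - m)))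
    (j : ℕ) (hj : j < m) : pf (bld n m h1 h2 σ) (2 * j + 1) = 2 * pf σ j := by
  have hp : posE n m h1 h2 (Sum.inr ⟨j, by omega⟩) = ⟨2 * j + 1, by omega⟩ := by
    simp [posE, hj]
  have h : 2 * j + 1 < n := by omega
  have h' : j < n - m := by omega
  simp only [pf, h, h', dite_true, bld, Equiv.trans_apply]
  rw [← hp, Equiv.symm_apply_apply]
  rfl

lemma bld_inj {n m : ℕ} (h1 : 2 * m ≤ n) (h2 : n ≤ 2 * m + 1) :
    Function.Injective (bld n m h1 h2) := by
  intro σ τ h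
  ext1 x
  have := DFunLike.congr_fun h (posE n m h1 h2 (Sum.inr x))
  simpa [bld] using this

lemma bld_surj {n m : ℕ} (h1 : 2 * m ≤ n) (h2 : n ≤ 2 * m + 1) (π : Equiv.Perm (Fin n))
    (hπ : ∀ j < m, pf π (2 * j) = 2 * j + 1) : ∃ σ, bld n m h1 h2 σ = π := by
  let τ : Equiv.Perm (Fin m ⊕ Fin (n - m)) :=
    (posE n m h1 h2).trans (π.trans (valE n m h1 h2).symm)
  have hτ : ∀ j, τ (Sum.inl j) = Sum.inl j := by
    intro j
    simp only [τ, Equiv.trans_apply]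
    rw [Equiv.symm_apply_eq]
    have h := hπ j j.isLt
    have h' : 2 * (j : ℕ) < n := by omega
    simp only [pf, h', dite_true] at h
    exact Fin.ext h
  have hmem : τ ∈ (Equiv.Perm.sumCongrHom (Fin m) (Fin (n - m))).range := by
    apply Equiv.Perm.mem_sumCongrHom_range_of_perm_mapsTo_inl
    rintro _ ⟨j, rfl⟩
    exact ⟨j, (hτ j).symm⟩
  obtain ⟨⟨α, σ⟩, hασ⟩ := hmem
  refine ⟨σ, ?_⟩
  have hα : ∀ j, α j = j := by
    intro j
    have := hτ j
    rw [← hασ] at this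
    simpa using this
  have hτ2 : ∀ x, τ x = Equiv.sumCongr (Equiv.refl _) σ x := by
    intro x
    rw [← hασ]
    rcases x with x | x <;> simp [hα]
  ext1 x
  simp only [bld, Equiv.trans_apply]
  rw [← hτ2]
  simp [τ]

lemma Aq_neg_one {R : Type*} [CommRing R] (t : R) {n m : ℕ} (h1 : 2 * m ≤ n)
    (h2 : n ≤ 2 * m + 1) :
    Aq R n t (-1) = (1 + t) ^ m * eulerPoly R (n - m) t := by
  rw [Aq_eq_main t h1 h2, eulerPoly_exc, mul_sum]
  symm
  apply sum_of_injOn (bld n m h1 h2) (bld_inj h1 h2).injOn (by simp)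
  · intro π _ hπ
    have : ∃ j, j < m ∧ pf π (2 * j) ≠ 2 * j + 1 := by
      by_contra hc
      push Not at hc
      obtain ⟨σ, hσ⟩ := bld_surj h1 h2 π hc
      exact hπ ⟨σ, by simp, hσ⟩
    obtain ⟨j, hj, hne⟩ := this
    apply prod_eq_zero (mem_range.mpr hj)
    simp [eP, hne]
  · intro σ _
    have hexc : t ^ excN σ = ∏ j ∈ range m, (if j < pf σ j then t else 1) := by
      unfold excN
      rw [← prod_const, prod_filter]
      rcases (by omega : n - m = m ∨ n - m = m + 1) with h | h
      · rw [show range (n - m) = range m by rw [h]]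
      · rw [show range (n - m) = range (m + 1) by rw [h], prod_range_succ, if_neg, mul_one]
        have := pf_lt σ (i := m) (by omega); omega
    have hc : (1 + t) ^ m = ∏ j ∈ range m, (1 + t) := by simp
    rw [hexc, hc, ← prod_mul_distrib]
    apply prod_congr rfl
    intro j hj
    rw [mem_range] at hj
    unfold eP sg wt
    rw [pf_bld_even h1 h2 σ j hj, pf_bld_odd h1 h2 σ j hj]
    split_ifs <;> first | omega | ring

/-- explicit formulas for the signed q-binomial-Eulerian polynomials
`Ã_n(t,-1)`, with the convention `A_0(t) = 0`. -/
theorem stmt11 {R : Type*} [CommRing R] (t : R) (n m : ℕ) (hn : 1 ≤ n) :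
    (n = 2 * m →
      Atilde R n t (-1) =
        1 + t * ∑ k ∈ Icc 1 m, (m.choose k : R) * (1 + t) ^ k * eulerPoly R k t) ∧
    (n = 2 * m + 1 →
      Atilde R n t (-1) =
        1 + t * ∑ k ∈ range (m + 1), (m.choose k : R) * (1 + t) ^ k *
          ((if k = 0 then 0 else eulerPoly R k t) + eulerPoly R (k + 1) t)) := by
  obtain ⟨g1, g2, g3, g4⟩ := gauss_neg_one (R := R) m
  constructor
  · rintro rfl
    unfold Atilde
    rw [sum_even]
    simp only [g1, g2, zero_mul, sum_const_zero, add_zero]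
    congr 2
    apply sum_congr rfl
    intro k _
    rw [Aq_neg_one t (n := 2 * k) (m := k) (by omega) (by omega), show 2 * k - k = k by omega,
      mul_assoc]
  · rintro rfl
    unfold Atilde
    rw [sum_Icc_succ_top (by omega), sum_even, add_assoc,
      ← sum_range_succ (fun k => gaussR (-1 : R) (2 * m + 1) (2 * k + 1) * Aq R (2 * k + 1) t (-1))]
    have hI : ∀ f : ℕ → R, ∑ k ∈ Icc 1 m, f k = ∑ k ∈ range (m + 1), if k = 0 then 0 else f k := by
      intro f
      rw [sum_range_succ', if_pos rfl, add_zero, range_eq_Ico, sum_Ico_add' (fun k => if k = 0 then 0 else f k) 0 m 1]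
      apply sum_congr (by ext; simp)
      intro k hk
      simp at hk
      rw [if_neg (by omega)]
    rw [hI, ← sum_add_distrib]
    congr 2
    apply sum_congr rfl
    intro k _
    rw [g3, g4, Aq_neg_one t (n := 2 * k) (m := k) (by omega) (by omega),
      Aq_neg_one t (n := 2 * k + 1) (m := k) (by omega) (by omega), show 2 * k - k = k by omega,
      show 2 * k + 1 - k = k + 1 by omega]
    split_ifs <;> ring
end

section
/- For every n ≥ 1, the polynomial Ã_n(t,-1) (the q-binomial-Eulerian polynomial evaluated at q = -1) is palindromic of degree n and unimodal. -/
open Finset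

namespace SBE
open Polynomial

/-- Binomial convolution. -/
noncomputable def cv (a b : ℕ → ℤ[X]) (m : ℕ) : ℤ[X] :=
  ∑ ij ∈ antidiagonal m, (m.choose ij.1 : ℤ[X]) * (a ij.1 * b ij.2)

lemma cv_zero (a b : ℕ → ℤ[X]) : cv a b 0 = a 0 * b 0 := by simp [cv]

lemma cv_succ (a b : ℕ → ℤ[X]) (m : ℕ) :
    cv a b (m + 1) = cv a (fun i => b (i + 1)) m + cv (fun i => a (i + 1)) b m := by
  unfold cv
  rw [Finset.sum_antidiagonal_choose_succ_mul (fun i j => a i * b j)]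
  congr 1
  refine Finset.sum_congr rfl fun ij h => ?_
  rw [HasAntidiagonal.mem_antidiagonal] at h
  rw [← h, Nat.choose_symm_add]

lemma cv_comm (a b : ℕ → ℤ[X]) (m : ℕ) : cv a b m = cv b a m := by
  induction m generalizing a b with
  | zero => simp [cv_zero, mul_comm]
  | succ m ih => rw [cv_succ, cv_succ, ih, ih (fun i => a (i+1)), add_comm]

lemma cv_add_left (a b c : ℕ → ℤ[X]) (m : ℕ) :
    cv (fun i => a i + b i) c m = cv a c m + cv b c m := by
  simp only [cv, ← Finset.sum_add_distrib]
  exact Finset.sum_congr rfl fun _ _ => by ring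

lemma cv_add_right (a b c : ℕ → ℤ[X]) (m : ℕ) :
    cv c (fun i => a i + b i) m = cv c a m + cv c b m := by
  simp only [cv, ← Finset.sum_add_distrib]
  exact Finset.sum_congr rfl fun _ _ => by ring

lemma cv_smul_right (r : ℤ[X]) (a c : ℕ → ℤ[X]) (m : ℕ) :
    cv c (fun i => r * a i) m = r * cv c a m := by
  simp only [cv, Finset.mul_sum]
  exact Finset.sum_congr rfl fun _ _ => by ring

lemma cv_assoc (a b c : ℕ → ℤ[X]) (m : ℕ) :
    cv (fun i => cv a b i) c m = cv a (fun i => cv b c i) m := by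
  induction m generalizing a b c with
  | zero => simp [cv_zero, mul_assoc]
  | succ m ih =>
    rw [cv_succ, cv_succ]
    simp only [cv_succ a b, cv_succ b c]
    rw [cv_add_left, cv_add_right, ih, ih, ih]
    ring

lemma cv_pow (r : ℤ[X]) (a b : ℕ → ℤ[X]) (m : ℕ) :
    cv (fun i => r ^ i * a i) (fun i => r ^ i * b i) m = r ^ m * cv a b m := by
  simp only [cv, Finset.mul_sum]
  refine Finset.sum_congr rfl fun ij h => ?_
  rw [HasAntidiagonal.mem_antidiagonal] at h
  rw [← h]; ring

lemma quad (P : ℕ → ℤ[X]) (h0 : P 0 = 1)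
    (hs : ∀ k, P (k + 1) = ((k : ℤ[X]) + 1) * X * P k + X * (1 - X) * derivative (P k)) (k : ℕ) :
    P (k + 1) = cv P P k - (1 - X) * P k := by
  induction k with
  | zero => rw [hs, cv_zero, h0]; simp
  | succ k ih =>
    have hd : ∀ k, X * (1 - X) * derivative (P k) = P (k + 1) - ((k : ℤ[X]) + 1) * X * P k := by
      intro k; rw [hs]; ring
    have hcv : X * (1 - X) * derivative (cv P P k) =
        cv P P (k + 1) - ((k : ℤ[X]) + 2) * X * cv P P k := by
      rw [cv_succ]
      simp only [cv, derivative_sum, Finset.mul_sum, ← Finset.sum_add_distrib,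
        ← Finset.sum_sub_distrib]
      refine Finset.sum_congr rfl fun ij h => ?_
      rw [HasAntidiagonal.mem_antidiagonal] at h
      have h1 := hd ij.1
      have h2 := hd ij.2
      have hk : (k : ℤ[X]) = (ij.1 : ℤ[X]) + ij.2 := by rw [← h]; push_cast; rfl
      rw [derivative_mul, derivative_natCast, derivative_mul, hk]
      linear_combination (k.choose ij.1 : ℤ[X]) * P ij.2 * h1 + (k.choose ij.1 : ℤ[X]) * P ij.1 * h2
    have e : derivative (P (k+1)) = derivative (cv P P k) - (1 - X) * derivative (P k) + P k := by
      rw [ih]; simp [derivative_mul]; ring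
    have h3 := hs (k+1)
    rw [e] at h3
    push_cast at h3 ⊢
    linear_combination h3 + hcv - (1 - X) * hd k + ((k : ℤ[X]) + 2) * X * ih

/-- Sums of blocks `X^a (1 + ... + X^b)` with `2a+b=c`. -/
noncomputable def Cone (c : ℕ) : AddSubmonoid ℤ[X] :=
  AddSubmonoid.closure {p | ∃ a b : ℕ, 2 * a + b = c ∧ p = X ^ a * ∑ i ∈ range (b + 1), X ^ i}

lemma block_mem {c : ℕ} (a b : ℕ) (h : 2 * a + b = c) :
    X ^ a * ∑ i ∈ range (b + 1), (X : ℤ[X]) ^ i ∈ Cone c :=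
  AddSubmonoid.subset_closure ⟨a, b, h, rfl⟩

lemma geom_id (b b' : ℕ) :
    (∑ i ∈ range (b + 1 + 1), (X : ℤ[X]) ^ i) * ∑ i ∈ range (b' + 1 + 1), (X : ℤ[X]) ^ i =
      (∑ i ∈ range (b + b' + 3), (X : ℤ[X]) ^ i) +
      X * ((∑ i ∈ range (b + 1), (X : ℤ[X]) ^ i) * ∑ i ∈ range (b' + 1), (X : ℤ[X]) ^ i) := by
  have e : b + b' + 3 = (b' + 1 + 1) + (b + 1) := by omega
  rw [e, sum_range_add _ (b' + 1 + 1), Finset.sum_range_succ' _ (b+1), Finset.sum_range_succ _ (b'+1)]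
  simp only [pow_add, pow_one, pow_zero, ← Finset.mul_sum, ← Finset.sum_mul]
  ring

lemma block_mul (b b' a c : ℕ) (h : 2 * a + b + b' = c) :
    X ^ a * ((∑ i ∈ range (b + 1), (X : ℤ[X]) ^ i) * ∑ i ∈ range (b' + 1), (X : ℤ[X]) ^ i)
      ∈ Cone c := by
  induction b generalizing b' a with
  | zero => simpa using block_mem a b' (by omega)
  | succ b ih =>
    cases b' with
    | zero => simpa using block_mem a (b+1) (by omega)
    | succ b' =>
      rw [geom_id, mul_add]
      refine add_mem (block_mem a (b + b' + 2) (by omega)) ?_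
      rw [← mul_assoc, ← pow_succ]
      exact ih b' (a+1) (by omega)

lemma cone_mul {c d : ℕ} {p q : ℤ[X]} (hp : p ∈ Cone c) (hq : q ∈ Cone d) :
    p * q ∈ Cone (c + d) := by
  induction hp using AddSubmonoid.closure_induction with
  | zero => simp
  | add x y _ _ hx hy => rw [add_mul]; exact add_mem hx hy
  | mem x hx =>
    obtain ⟨a, b, h, rfl⟩ := hx
    induction hq using AddSubmonoid.closure_induction with
    | zero => simp
    | add x y _ _ hx hy => rw [mul_add]; exact add_mem hx hy
    | mem y hy =>
      obtain ⟨a', b', h', rfl⟩ := hy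
      have := block_mul b b' (a + a') (c + d) (by omega)
      rw [pow_add] at this
      convert this using 1; ring

lemma cone_nat {c : ℕ} {p : ℤ[X]} (n : ℕ) (hp : p ∈ Cone c) : (n : ℤ[X]) * p ∈ Cone c := by
  rw [← nsmul_eq_mul]; exact nsmul_mem hp n

lemma cone_one : (1 : ℤ[X]) ∈ Cone 0 := by simpa using block_mem (c := 0) 0 0 rfl
lemma cone_X : (X : ℤ[X]) ∈ Cone 2 := by simpa using block_mem (c := 2) 1 0 rfl
lemma cone_1X : (1 + X : ℤ[X]) ∈ Cone 1 := by
  simpa [Finset.sum_range_succ] using block_mem (c := 1) 0 1 rfl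
lemma cone_1XX : (1 + X + X ^ 2 : ℤ[X]) ∈ Cone 2 := by
  simpa [Finset.sum_range_succ] using block_mem (c := 2) 0 2 rfl

lemma cone_pow {c : ℕ} {p : ℤ[X]} (hp : p ∈ Cone c) (n : ℕ) : p ^ n ∈ Cone (n * c) := by
  induction n with
  | zero => simpa using cone_one
  | succ n ih => rw [pow_succ, Nat.succ_mul]; exact cone_mul ih hp

lemma block_coeff (a b i : ℕ) :
    (X ^ a * ∑ i ∈ range (b + 1), (X : ℤ[X]) ^ i).coeff i = if a ≤ i ∧ i ≤ a + b then 1 else 0 := by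
  rw [coeff_X_pow_mul', finsetSum_coeff]
  simp only [coeff_X_pow, Finset.sum_ite_eq, mem_range]
  split_ifs <;> first | rfl | omega

lemma cone_props {c : ℕ} {p : ℤ[X]} (hp : p ∈ Cone c) :
    (∀ i ≤ c, p.coeff i = p.coeff (c - i)) ∧ (∀ i, c < i → p.coeff i = 0) ∧
    (∀ i < c / 2, p.coeff i ≤ p.coeff (i + 1)) ∧
    (∀ i, c / 2 ≤ i → p.coeff (i + 1) ≤ p.coeff i) := by
  induction hp using AddSubmonoid.closure_induction with
  | zero => simp
  | add x y _ _ hx hy =>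
    obtain ⟨h1, h2, h3, h4⟩ := hx
    obtain ⟨k1, k2, k3, k4⟩ := hy
    simp only [coeff_add]
    refine ⟨fun i hi => ?_, fun i hi => ?_, fun i hi => ?_, fun i hi => ?_⟩
    · rw [h1 i hi, k1 i hi]
    · rw [h2 i hi, k2 i hi, add_zero]
    · exact add_le_add (h3 i hi) (k3 i hi)
    · exact add_le_add (h4 i hi) (k4 i hi)
  | mem x hx =>
    obtain ⟨a, b, h, rfl⟩ := hx
    simp only [block_coeff]
    refine ⟨fun i hi => ?_, fun i hi => ?_, fun i hi => ?_, fun i hi => ?_⟩ <;>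
      split_ifs <;> omega

/-- if `a, b` start with 1 resp. anything: split off the `k=0` term. -/
lemma cv_split (a b : ℕ → ℤ[X]) (m : ℕ) : ∃ s, cv a b m = a 0 * b m + s ∧
    s = ∑ k ∈ range m, (m.choose (k + 1) : ℤ[X]) * (a (k + 1) * b (m - (k + 1))) := by
  refine ⟨_, ?_, rfl⟩
  unfold cv
  rw [Finset.Nat.sum_antidiagonal_eq_sum_range_succ
    (fun i j => (m.choose i : ℤ[X]) * (a i * b j)), Nat.succ_eq_add_one, Finset.sum_range_succ']
  simp [add_comm]


lemma P_cone (P : ℕ → ℤ[X]) (h0 : P 0 = 1)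
    (hq : ∀ k, P (k + 1) = cv P P k - (1 - X) * P k) (k : ℕ) : P (k + 1) ∈ Cone (k + 2) := by
  induction k using Nat.strong_induction_on with
  | _ k ih =>
    cases k with
    | zero => rw [hq, cv_zero, h0]; simpa using cone_X
    | succ k =>
      obtain ⟨s, h, hs⟩ := cv_split P P (k + 1)
      rw [Finset.sum_range_succ] at hs
      simp only [Nat.choose_self, Nat.cast_one, one_mul, Nat.sub_self, h0, mul_one] at hs
      have e : P (k + 1 + 1) = (1 + X) * P (k + 1) +
          ∑ k_1 ∈ range k, ((k + 1).choose (k_1 + 1) : ℤ[X]) *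
            (P (k_1 + 1) * P (k + 1 - (k_1 + 1))) := by
        rw [hq (k + 1), h, hs, h0]; ring
      rw [e]
      refine add_mem ?_ (sum_mem fun i hi => cone_nat _ ?_)
      · have := cone_mul cone_1X (ih k (by omega))
        rwa [show 1 + (k + 2) = k + 1 + 2 by omega] at this
      · rw [mem_range] at hi
        have := cone_mul (ih i (by omega)) (ih (k - i - 1) (by omega))
        rwa [show i + 2 + (k - i - 1 + 2) = k + 1 + 2 by omega,
          show k - i - 1 + 1 = k + 1 - (i + 1) by omega] at this

/-- auxiliary scaled sequence -/
lemma H_cone (P : ℕ → ℤ[X]) (h0 : P 0 = 1)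
    (hq : ∀ k, P (k + 1) = cv P P k - (1 - X) * P k) (k : ℕ) : (1 + X) ^ (k + 1) * P (k + 1) ∈ Cone (2 * k + 3) := by
  have := cone_mul (cone_pow cone_1X (k + 1)) (P_cone P h0 hq k)
  rwa [show (k + 1) * 1 + (k + 2) = 2 * k + 3 by omega] at this

lemma even_rec (P : ℕ → ℤ[X]) 
    (hq : ∀ k, P (k + 1) = cv P P k - (1 - X) * P k) (m : ℕ) :
    cv (fun _ => 1) (fun k => (1 + X) ^ k * P k) (m + 1) =
      X ^ 2 * cv (fun _ => 1) (fun k => (1 + X) ^ k * P k) m +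
      (1 + X) * cv (fun k => (1 + X) ^ k * P k)
        (fun i => cv (fun _ => 1) (fun k => (1 + X) ^ k * P k) i) m := by
  rw [cv_succ]
  have e : (fun i => (1 + X) ^ (i + 1) * P (i + 1)) = fun i =>
      (1 + X) * cv (fun k => (1 + X) ^ k * P k) (fun k => (1 + X) ^ k * P k) i +
      (X ^ 2 - 1) * ((1 + X) ^ i * P i) := by
    funext i; rw [cv_pow, hq]; ring
  rw [e, cv_add_right, cv_smul_right, cv_smul_right, ← cv_assoc, ← cv_assoc]
  have : (fun i => cv (fun _ => 1) (fun k => (1 + X) ^ k * P k) i) =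
    (fun i => cv (fun k => (1 + X) ^ k * P k) (fun _ => 1) i) := by
    funext i; rw [cv_comm]
  rw [this]
  ring

lemma even_cone (P : ℕ → ℤ[X]) (h0 : P 0 = 1)
    (hq : ∀ k, P (k + 1) = cv P P k - (1 - X) * P k) (m : ℕ) : cv (fun _ => 1) (fun k => (1 + X) ^ k * P k) m ∈ Cone (2 * m) := by
  induction m using Nat.strong_induction_on with
  | _ m ih =>
    cases m with
    | zero => rw [cv_zero]; simpa [h0] using cone_one
    | succ m =>
      rw [even_rec P hq]
      obtain ⟨s, h, hs⟩ := cv_split (fun k => (1 + X) ^ k * P k)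
        (fun i => cv (fun _ => 1) (fun k => (1 + X) ^ k * P k) i) m
      rw [h]
      have e : ∀ y : ℤ[X], X ^ 2 * y + (1 + X) * ((1 + X) ^ 0 * P 0 * y + s) =
        (1 + X + X ^ 2) * y + (1 + X) * s := by intro y; rw [h0]; ring
      rw [e]
      refine add_mem ?_ ?_
      · have := cone_mul cone_1XX (ih m (by omega))
        rwa [show 2 + 2 * m = 2 * (m + 1) by omega] at this
      · rw [hs, Finset.mul_sum]
        refine sum_mem fun i hi => ?_
        rw [mem_range] at hi
        have := cone_mul cone_1X (cone_nat (m.choose (i + 1))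
          (cone_mul (H_cone P h0 hq i) (ih (m - (i + 1)) (by omega))))
        rwa [show 1 + (2 * i + 3 + 2 * (m - (i + 1))) = 2 * (m + 1) by omega] at this

lemma odd_cone (P : ℕ → ℤ[X]) (h0 : P 0 = 1)
    (hq : ∀ k, P (k + 1) = cv P P k - (1 - X) * P k) (m : ℕ) : cv (fun _ => 1) (fun k => (1 + X) ^ k * P k) m +
    cv (fun _ => 1) (fun k => (1 + X) ^ k * P (k + 1)) m ∈ Cone (2 * m + 1) := by
  have e : (fun i => (1 + X) ^ i * P (i + 1)) = fun i =>
      cv (fun k => (1 + X) ^ k * P k) (fun k => (1 + X) ^ k * P k) i +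
      (X - 1) * ((1 + X) ^ i * P i) := by
    funext i; rw [cv_pow, hq]; ring
  rw [e, cv_add_right, cv_smul_right, ← cv_assoc]
  have e1 : cv (fun i => cv (fun _ => 1) (fun k => (1 + X) ^ k * P k) i)
      (fun k => (1 + X) ^ k * P k) m = cv (fun k => (1 + X) ^ k * P k)
      (fun i => cv (fun _ => 1) (fun k => (1 + X) ^ k * P k) i) m := cv_comm _ _ _
  rw [e1]
  obtain ⟨s, h, hs⟩ := cv_split (fun k => (1 + X) ^ k * P k)
    (fun i => cv (fun _ => 1) (fun k => (1 + X) ^ k * P k) i) m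
  rw [h]
  have e2 : ∀ y : ℤ[X], y + ((1 + X) ^ 0 * P 0 * y + s + (X - 1) * y) =
        (1 + X) * y + s := by intro y; rw [h0]; ring
  rw [e2]
  refine add_mem ?_ ?_
  · have := cone_mul cone_1X (even_cone P h0 hq m)
    rwa [show 1 + 2 * m = 2 * m + 1 by omega] at this
  · rw [hs]
    refine sum_mem fun i hi => cone_nat _ ?_
    rw [mem_range] at hi
    have := cone_mul (H_cone P h0 hq i) (even_cone P h0 hq (m - (i + 1)))
    rwa [show 2 * i + 3 + 2 * (m - (i + 1)) = 2 * m + 1 by omega] at this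

end SBE

namespace SBE
open Polynomial

lemma cancel {m : ℕ} (W : Fin m → Fin m × Fin 2 → Fin m × Fin 2 → ℤ[X]) (j : Fin m)
    (N : Fin m × Fin 2 → Fin m × Fin 2 → ℤ[X]) (hN : ∀ a b, a ≠ b → N a b = - N b a) :
    ∑ π : Equiv.Perm (Fin m × Fin 2), N (π (j, 0)) (π (j, 1)) *
      ∏ i ∈ univ.erase j, W i (π (i, 0)) (π (i, 1)) = 0 := by
  set F : Equiv.Perm (Fin m × Fin 2) → ℤ[X] := fun π => N (π (j, 0)) (π (j, 1)) *
      ∏ i ∈ univ.erase j, W i (π (i, 0)) (π (i, 1)) with hF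
  have h1 : ∑ π, F (π * Equiv.swap (j, 0) (j, 1)) = ∑ π, F π :=
    Equiv.sum_comp (Equiv.mulRight (Equiv.swap (j, (0 : Fin 2)) (j, 1))) F
  have h2 : ∀ π, F (π * Equiv.swap (j, 0) (j, 1)) = - F π := by
    intro π
    simp only [hF, Equiv.Perm.mul_apply, Equiv.swap_apply_left, Equiv.swap_apply_right]
    rw [hN (π (j, 1)) (π (j, 0)) (by simp), neg_mul]
    congr 2
    refine Finset.prod_congr rfl fun i hi => ?_
    rw [mem_erase] at hi
    rw [Equiv.swap_apply_of_ne_of_ne, Equiv.swap_apply_of_ne_of_ne] <;> simp [hi.1]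
  simp only [h2, Finset.sum_neg_distrib] at h1
  exact self_eq_neg.mp h1.symm

/-- restriction to good blocks -/
noncomputable def good {m : ℕ} (W : Fin m → Fin m × Fin 2 → Fin m × Fin 2 → ℤ[X]) (i : Fin m)
    (a b : Fin m × Fin 2) : ℤ[X] :=
  if a = (i, 1) ∨ b = (i, 1) then W i a b else 0

lemma restrict {m : ℕ} (W : Fin m → Fin m × Fin 2 → Fin m × Fin 2 → ℤ[X])
    (hW : ∀ i a b, a ≠ b → a ≠ (i, 1) → b ≠ (i, 1) → W i a b = - W i b a) (S : Finset (Fin m)) :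
    ∑ π : Equiv.Perm (Fin m × Fin 2), ∏ i, W i (π (i, 0)) (π (i, 1)) =
    ∑ π : Equiv.Perm (Fin m × Fin 2), ∏ i, (if i ∈ S then good W i else W i)
      (π (i, 0)) (π (i, 1)) := by
  induction S using Finset.induction_on with
  | empty => simp
  | insert j S hj ih =>
    rw [ih, ← sub_eq_zero, ← Finset.sum_sub_distrib]
    rw [← cancel (fun i => if i ∈ S then good W i else W i) j
      (fun a b => W j a b - good W j a b)]
    · refine Finset.sum_congr rfl fun π _ => ?_
      rw [← Finset.mul_prod_erase univ _ (mem_univ j), ← Finset.mul_prod_erase univ _ (mem_univ j)]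
      have : ∏ i ∈ univ.erase j, (if i ∈ insert j S then good W i else W i) (π (i, 0)) (π (i, 1)) =
        ∏ i ∈ univ.erase j, (if i ∈ S then good W i else W i) (π (i, 0)) (π (i, 1)) := by
        refine Finset.prod_congr rfl fun i hi => ?_
        rw [mem_erase] at hi
        simp [mem_insert, hi.1]
      rw [this]
      simp only [hj, if_false, mem_insert_self, if_true]
      ring
    · intro a b hab
      unfold good
      by_cases h : a = (j, 1) ∨ b = (j, 1)
      · rw [if_pos h, if_pos h.symm]; simp
      · rw [if_neg h, if_neg (fun h' => h h'.symm)]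
        push Not at h
        simpa using hW j a b hab h.1 h.2

/-- flip chosen blocks -/
def flipB {m : ℕ} (ε : Fin m → Bool) : Equiv.Perm (Fin m × Fin 2) :=
  Equiv.prodShear (Equiv.refl _) (fun i => if ε i then Equiv.swap 0 1 else 1)

/-- permute the even letters -/
def evenB {m : ℕ} (ρ : Equiv.Perm (Fin m)) : Equiv.Perm (Fin m × Fin 2) where
  toFun x := if x.2 = 0 then (ρ x.1, 0) else x
  invFun x := if x.2 = 0 then (ρ.symm x.1, 0) else x
  left_inv x := by
    obtain ⟨a, b⟩ := x
    by_cases h : b = 0 <;> simp [h]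
  right_inv x := by
    obtain ⟨a, b⟩ := x
    by_cases h : b = 0 <;> simp [h]

lemma evenB_zero {m : ℕ} (ρ : Equiv.Perm (Fin m)) (i : Fin m) : evenB ρ (i, 0) = (ρ i, 0) := by
  simp [evenB]
lemma evenB_one {m : ℕ} (ρ : Equiv.Perm (Fin m)) (i : Fin m) : evenB ρ (i, 1) = (i, 1) := by
  simp [evenB]
lemma flipB_zero {m : ℕ} (ε : Fin m → Bool) (i : Fin m) :
    flipB ε (i, 0) = (i, if ε i then 1 else 0) := by
  by_cases h : ε i <;> simp [flipB, h]
lemma flipB_one {m : ℕ} (ε : Fin m → Bool) (i : Fin m) :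
    flipB ε (i, 1) = (i, if ε i then 0 else 1) := by
  by_cases h : ε i <;> simp [flipB, h]

lemma phi_zero {m : ℕ} (ε : Fin m → Bool) (ρ : Equiv.Perm (Fin m)) (i : Fin m) :
    (evenB ρ * flipB ε) (i, 0) = if ε i then (i, 1) else (ρ i, 0) := by
  rw [Equiv.Perm.mul_apply, flipB_zero]
  split_ifs
  · exact evenB_one ρ i
  · exact evenB_zero ρ i

lemma phi_one {m : ℕ} (ε : Fin m → Bool) (ρ : Equiv.Perm (Fin m)) (i : Fin m) :
    (evenB ρ * flipB ε) (i, 1) = if ε i then (ρ i, 0) else (i, 1) := by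
  rw [Equiv.Perm.mul_apply, flipB_one]
  split_ifs
  · exact evenB_zero ρ i
  · exact evenB_one ρ i

lemma phi_inj {m : ℕ} (ε ε' : Fin m → Bool) (ρ ρ' : Equiv.Perm (Fin m))
    (h : evenB ρ * flipB ε = evenB ρ' * flipB ε') : ε = ε' ∧ ρ = ρ' := by
  have he : ε = ε' := by
    funext i
    have := congrArg (fun p => (p (i, 0)).2) h
    simp only [phi_zero] at this
    cases h1 : ε i <;> cases h2 : ε' i <;> simp [h1, h2] at this ⊢
  refine ⟨he, ?_⟩
  subst he
  have h' := mul_right_cancel h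
  ext i
  have := congrArg (fun p => (p (i, 0)).1) h'
  simp only [evenB_zero] at this
  rw [this]

lemma phi_surj {m : ℕ} (π : Equiv.Perm (Fin m × Fin 2))
    (h : ∀ i, π (i, 0) = (i, 1) ∨ π (i, 1) = (i, 1)) :
    ∃ ε ρ, evenB ρ * flipB ε = π := by
  classical
  set ε : Fin m → Bool := fun i => decide (π (i, 0) = (i, 1)) with hε
  -- the other letter
  set o : Fin m → Fin m × Fin 2 := fun i => if ε i then π (i, 1) else π (i, 0) with ho
  have ho2 : ∀ i, (o i).2 = 0 := by
    intro i
    by_contra hne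
    have h1 : (o i).2 = 1 := by
      rcases Fin.exists_fin_two.mp ⟨(o i).2, rfl⟩ with h | h
      · exact absurd h hne
      · exact h
    have h2 : o i = ((o i).1, 1) := Prod.ext rfl h1
    set k := (o i).1
    have hoi : o i = π (i, 0) ∨ o i = π (i, 1) := by
      simp only [ho]; split_ifs <;> simp
    have hik : k = i := by
      rcases h k with hk | hk <;> rcases hoi with hh | hh <;> rw [hh, ← hk] at h2 <;>
        have := congrArg Prod.fst (π.injective h2) <;> exact this.symm
    rw [hik] at h2
    by_cases hc : π (i, 0) = (i, 1)
    · have : o i = π (i, 1) := by simp [ho, hε, hc]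
      have h3 := π.injective ((this.symm.trans h2).trans hc.symm)
      simp at h3
    · have : o i = π (i, 0) := by simp [ho, hε, hc]
      rw [this] at h2
      exact hc h2
  have hinj : Function.Injective (fun i => (o i).1) := by
    intro i k hik
    have h1 : o i = o k := Prod.ext hik ((ho2 i).trans (ho2 k).symm)
    simp only [ho] at h1
    split_ifs at h1 <;> exact congrArg Prod.fst (π.injective h1)
  refine ⟨ε, Equiv.ofBijective _ (Finite.injective_iff_bijective.mp hinj), ?_⟩
  have hoo : ∀ i, ((o i).1, (0 : Fin 2)) = o i := fun i => Prod.ext rfl (ho2 i).symm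
  ext1 ⟨i, b⟩
  have hb : b = 0 ∨ b = 1 := by
    rcases Fin.exists_fin_two.mp ⟨b, rfl⟩ with h | h
    · exact Or.inl h
    · exact Or.inr h
  rcases hb with rfl | rfl
  · rw [phi_zero, Equiv.ofBijective_apply, hoo]
    by_cases hc : π (i, 0) = (i, 1)
    · simp [hε, hc]
    · simp [ho, hε, hc]
  · rw [phi_one, Equiv.ofBijective_apply, hoo]
    by_cases hc : π (i, 0) = (i, 1)
    · simp [ho, hε, hc]
    · simpa [hε, hc] using ((h i).resolve_left hc).symm

lemma core {m : ℕ} (W : Fin m → Fin m × Fin 2 → Fin m × Fin 2 → ℤ[X])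
    (hW : ∀ i a b, a ≠ b → a ≠ (i, 1) → b ≠ (i, 1) → W i a b = - W i b a) :
    ∑ π : Equiv.Perm (Fin m × Fin 2), ∏ i, W i (π (i, 0)) (π (i, 1)) =
    ∑ ρ : Equiv.Perm (Fin m), ∏ i, (W i (i, 1) (ρ i, 0) + W i (ρ i, 0) (i, 1)) := by
  classical
  rw [restrict W hW univ]
  simp only [mem_univ, if_true]
  have h1 : ∀ ρ : Equiv.Perm (Fin m), ∏ i, (W i (i, 1) (ρ i, 0) + W i (ρ i, 0) (i, 1)) =
      ∑ ε : Fin m → Bool, ∏ i, (if ε i then W i (i, 1) (ρ i, 0) else W i (ρ i, 0) (i, 1)) := by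
    intro ρ
    have := Finset.prod_univ_sum (fun _ : Fin m => (univ : Finset Bool))
      (fun i b => if b then W i (i, 1) (ρ i, 0) else W i (ρ i, 0) (i, 1))
    rw [Fintype.piFinset_univ] at this
    rw [← this]
    simp
  simp only [h1]
  rw [← Finset.sum_product']
  symm
  refine Finset.sum_of_injOn (fun x => evenB x.1 * flipB x.2) ?_ ?_ ?_ ?_
  · intro x _ y _ hxy
    obtain ⟨h, h'⟩ := phi_inj _ _ _ _ hxy
    exact Prod.ext h' h
  · intro x _; simp
  · intro π _ hπ
    by_contra hne
    apply hπ
    have : ∀ i, π (i, 0) = (i, 1) ∨ π (i, 1) = (i, 1) := by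
      intro i
      by_contra hc
      exact hne (Finset.prod_eq_zero (mem_univ i) (by unfold good; rw [if_neg hc]))
    obtain ⟨ε, ρ, h⟩ := phi_surj π this
    exact ⟨(ρ, ε), by simp, h⟩
  · intro x _
    refine Finset.prod_congr rfl fun i _ => ?_
    simp only [phi_zero, phi_one, good]
    by_cases h : x.2 i <;> simp [h]

end SBE

namespace SBE
open Polynomial

lemma pf_lt {n : ℕ} (π : Equiv.Perm (Fin n)) {i : ℕ} (h : i < n) : pf π i < n := by
  unfold pf; rw [dif_pos h]; exact (π _).2

lemma pf_inj {n : ℕ} (π : Equiv.Perm (Fin n)) {i j : ℕ} (hi : i < n) (hj : j < n)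
    (h : pf π i = pf π j) : i = j := by
  unfold pf at h; rw [dif_pos hi, dif_pos hj] at h
  simpa using π.injective (Fin.ext h)

lemma exc_le_maj {n : ℕ} (π : Equiv.Perm (Fin n)) : excN π ≤ majN π := by
  have hsub : (range n).filter (fun i => i < pf π i) ⊆ range (majN π) := by
    intro i hi
    rw [mem_filter, mem_range] at hi
    obtain ⟨hin, hex⟩ := hi
    have : ∃ d, i ≤ d ∧ d < n - 1 ∧ pf π (d + 1) < pf π d := by
      by_contra hc
      push Not at hc
      have hinc : ∀ k, i + k < n → pf π i + k ≤ pf π (i + k) := by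
        intro k
        induction k with
        | zero => simp
        | succ k ih =>
          intro hk
          have h1 := ih (by omega)
          have h2 := hc (i + k) (by omega) (by omega)
          have h3 : pf π (i + k) ≠ pf π (i + k + 1) := fun h => by
            have := pf_inj π (by omega) (by omega) h
            omega
          rw [← add_assoc i k 1]
          omega
      have h1 := hinc (n - 1 - i) (by omega)
      have h2 : pf π (i + (n - 1 - i)) < n := pf_lt π (by omega)
      omega
    obtain ⟨d, h1, h2, h3⟩ := this
    rw [mem_range]
    have : d + 1 ≤ majN π := by
      unfold majN
      exact Finset.single_le_sum (f := fun i => i + 1) (fun _ _ => Nat.zero_le _)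
        (mem_filter.mpr ⟨mem_range.mpr h2, h3⟩)
    omega
  simpa [excN] using card_le_card hsub

/-- block weight -/
noncomputable def bw (j a b : ℕ) : ℤ[X] :=
  (if b < a then -1 else 1) * (if 2 * j < a then -X else 1) * (if 2 * j + 1 < b then -X else 1)

lemma prod_pairs (f : ℕ → ℤ[X]) (M : ℕ) :
    ∏ i ∈ range (2 * M), f i = ∏ j ∈ range M, (f (2 * j) * f (2 * j + 1)) := by
  induction M with
  | zero => simp
  | succ M ih =>
    rw [Finset.prod_range_succ, ← ih, show 2 * (M + 1) = 2 * M + 1 + 1 by ring,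
      Finset.prod_range_succ, Finset.prod_range_succ, mul_assoc]

lemma sum_pairs (f : ℕ → ℤ[X]) (M : ℕ) :
    ∑ i ∈ range (2 * M), f i = ∑ j ∈ range M, (f (2 * j) + f (2 * j + 1)) := by
  induction M with
  | zero => simp
  | succ M ih =>
    rw [Finset.sum_range_succ, ← ih, show 2 * (M + 1) = 2 * M + 1 + 1 by ring,
      Finset.sum_range_succ, Finset.sum_range_succ, add_assoc]

lemma weight {n : ℕ} (M : ℕ) (hM : n = 2 * M ∨ n = 2 * M + 1) (π : Equiv.Perm (Fin n)) :
    (X : ℤ[X]) ^ excN π * (-1) ^ (majN π - excN π) =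
      ∏ j ∈ range M, bw j (pf π (2 * j)) (pf π (2 * j + 1)) := by
  have h1 : (X : ℤ[X]) ^ excN π * (-1) ^ (majN π - excN π) = (-X) ^ excN π * (-1) ^ majN π := by
    obtain ⟨d, hd⟩ := Nat.exists_eq_add_of_le (exc_le_maj π)
    rw [hd, Nat.add_sub_cancel_left, pow_add, neg_pow (X : ℤ[X])]
    have : ((-1 : ℤ[X]) ^ excN π) * (-1) ^ excN π = 1 := by rw [← mul_pow]; simp
    linear_combination (- X ^ excN π * (-1) ^ d) * this
  have h2 : (-X : ℤ[X]) ^ excN π = ∏ i ∈ range n, (if i < pf π i then -X else 1) := by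
    rw [← Finset.prod_filter, Finset.prod_const]; rfl
  have h3 : (-1 : ℤ[X]) ^ majN π =
      ∏ i ∈ range (n - 1), (if pf π (i + 1) < pf π i then (-1) ^ (i + 1) else 1) := by
    rw [← Finset.prod_filter, Finset.prod_pow_eq_pow_sum]; rfl
  have h4 : ∏ i ∈ range n, (if i < pf π i then (-X : ℤ[X]) else 1) =
      ∏ i ∈ range (2 * M), (if i < pf π i then -X else 1) := by
    rcases hM with hM | hM
    · rw [← hM]
    · subst hM
      rw [Finset.prod_range_succ, if_neg, mul_one]
      have := pf_lt π (i := 2 * M) (by omega)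
      omega
  have h5 : ∏ i ∈ range (n - 1), (if pf π (i + 1) < pf π i then (-1 : ℤ[X]) ^ (i + 1) else 1) =
      ∏ i ∈ range (2 * M), (if pf π (i + 1) < pf π i then (-1 : ℤ[X]) ^ (i + 1) else 1) := by
    rcases hM with hM | hM
    · cases M with
      | zero => subst hM; rfl
      | succ M =>
        rw [show 2 * (M + 1) = 2 * M + 1 + 1 by ring, show n - 1 = 2 * M + 1 by omega,
          Finset.prod_range_succ _ (2 * M + 1)]
        have : (-1 : ℤ[X]) ^ (2 * M + 1 + 1) = 1 := Even.neg_one_pow ⟨M + 1, by ring⟩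
        rw [this, ite_self, mul_one]
    · rw [show n - 1 = 2 * M by omega]
  rw [h1, h2, h3, h4, h5, prod_pairs, prod_pairs, ← Finset.prod_mul_distrib]
  refine Finset.prod_congr rfl fun j _ => ?_
  have e1 : (-1 : ℤ[X]) ^ (2 * j + 1) = -1 := Odd.neg_one_pow ⟨j, rfl⟩
  have e2 : (-1 : ℤ[X]) ^ (2 * j + 1 + 1) = 1 := Even.neg_one_pow ⟨j + 1, by ring⟩
  rw [e1, e2, ite_self, bw]
  ring

/-- numerical value of a letter -/
def vl {m : ℕ} (x : Fin m × Fin 2) : ℕ := x.2 + 2 * x.1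

lemma vl_inj {m : ℕ} {x y : Fin m × Fin 2} (h : vl x = vl y) : x = y := by
  unfold vl at h
  have := x.2.2
  have := y.2.2
  refine Prod.ext (Fin.ext ?_) (Fin.ext ?_) <;> omega

lemma pf_congr {m : ℕ} (π : Equiv.Perm (Fin m × Fin 2)) (i : Fin m) (b : Fin 2) :
    pf (finProdFinEquiv.permCongr π) (2 * (i : ℕ) + b) = vl (π (i, b)) := by
  have h : 2 * (i : ℕ) + b = (finProdFinEquiv (i, b) : Fin (m * 2)) := by
    simp [finProdFinEquiv_apply_val, add_comm]
  rw [h]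
  unfold pf
  rw [dif_pos (finProdFinEquiv (i, b)).2]
  show ((finProdFinEquiv.permCongr π (finProdFinEquiv (i, b)) : Fin (m * 2)) : ℕ) = _
  rw [Equiv.permCongr_apply, Equiv.symm_apply_apply, finProdFinEquiv_apply_val, vl]

lemma toBlocks {N : ℕ} (m : ℕ) (hN : N = m * 2) (w : ℕ → ℕ → ℕ → ℤ[X])
    (hw : ∀ i < m, ∀ a b, a ≠ b → a ≠ 2 * i + 1 → b ≠ 2 * i + 1 → w i a b = - w i b a) :
    ∑ π : Equiv.Perm (Fin N), ∏ j ∈ range m, w j (pf π (2 * j)) (pf π (2 * j + 1)) =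
    ∑ ρ : Equiv.Perm (Fin m), ∏ i : Fin m, (w i (2 * i + 1) (2 * (ρ i : ℕ)) +
      w i (2 * (ρ i : ℕ)) (2 * i + 1)) := by
  subst hN
  have hc := core (m := m) (fun i a b => w i (vl a) (vl b)) (by
    intro i a b hab ha hb
    refine hw i i.2 _ _ (fun h => hab (vl_inj h)) (fun h => ha (vl_inj ?_))
      (fun h => hb (vl_inj ?_)) <;> rw [h] <;> simp [vl, add_comm])
  have e1 : ∀ i : Fin m, vl (i, (1 : Fin 2)) = 2 * i + 1 := fun i => by simp [vl, add_comm]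
  have e0 : ∀ i : Fin m, vl (i, (0 : Fin 2)) = 2 * i := fun i => by simp [vl]
  simp only [e0, e1] at hc
  rw [← hc, ← Equiv.sum_comp (finProdFinEquiv (m := m) (n := 2)).permCongr]
  refine Finset.sum_congr rfl fun π _ => ?_
  rw [← Fin.prod_univ_eq_prod_range (fun j => w j (pf _ (2 * j)) (pf _ (2 * j + 1))) m]
  refine Finset.prod_congr rfl fun i _ => ?_
  have h0 := pf_congr π i 0
  have h1 := pf_congr π i 1
  simp only [Fin.val_zero, Fin.val_one, add_zero] at h0 h1
  rw [h0, h1]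

/-- Eulerian polynomial by excedances -/
noncomputable def E (m : ℕ) : ℤ[X] :=
  ∑ ρ : Equiv.Perm (Fin m), ∏ i : Fin m, (if i < ρ i then X else 1)

lemma bw_anti (i a b : ℕ) (hab : a ≠ b) (ha : a ≠ 2 * i + 1) (hb : b ≠ 2 * i + 1) :
    bw i a b = - bw i b a := by
  unfold bw
  split_ifs <;> first | omega | ring

lemma bw_pair (i r : ℕ) : bw i (2 * i + 1) (2 * r) + bw i (2 * r) (2 * i + 1) =
    (1 + X) * (if i < r then X else 1) := by
  unfold bw
  split_ifs <;> first | omega | ring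

lemma Aq_even (m : ℕ) : Aq ℤ[X] (2 * m) X (-1) = (1 + X) ^ m * E m := by
  unfold Aq
  simp only [weight (n := 2 * m) m (Or.inl rfl)]
  rw [toBlocks m (mul_comm _ _) bw (fun i _ => bw_anti i), E, Finset.mul_sum]
  refine Finset.sum_congr rfl fun ρ _ => ?_
  simp only [bw_pair, Finset.prod_mul_distrib, Finset.prod_const, card_univ, Fintype.card_fin,
    Fin.lt_def]

/-- insertion of a new largest letter -/
def ins {k : ℕ} (x : Option (Fin k)) (σ : Equiv.Perm (Fin k)) : Equiv.Perm (Fin (k + 1)) :=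
  finSuccEquivLast.symm.permCongr (Equiv.Perm.decomposeOption.symm (x, σ))

lemma ins_last {k : ℕ} (x : Option (Fin k)) (σ : Equiv.Perm (Fin k)) :
    ins x σ (Fin.last k) = finSuccEquivLast.symm x := by
  simp [ins, Equiv.permCongr_apply, Equiv.Perm.decomposeOption_symm_apply]

lemma ins_castSucc {k : ℕ} (x : Option (Fin k)) (σ : Equiv.Perm (Fin k)) (j : Fin k) :
    ins x σ j.castSucc = finSuccEquivLast.symm (Equiv.swap none x (some (σ j))) := by
  simp [ins, Equiv.permCongr_apply, Equiv.Perm.decomposeOption_symm_apply]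

lemma ins_none {k : ℕ} (σ : Equiv.Perm (Fin k)) (j : Fin k) :
    ins none σ j.castSucc = (σ j).castSucc := by
  rw [ins_castSucc]; simp

lemma ins_some {k : ℕ} (b : Fin k) (σ : Equiv.Perm (Fin k)) (j : Fin k) :
    ins (some b) σ j.castSucc = if σ j = b then Fin.last k else (σ j).castSucc := by
  rw [ins_castSucc]
  split_ifs with h
  · rw [h]; simp
  · rw [Equiv.swap_apply_of_ne_of_ne (by simp) (by simpa using h)]; simp

lemma sum_ins {k : ℕ} (F : Equiv.Perm (Fin (k + 1)) → ℤ[X]) :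
    ∑ π, F π = ∑ σ : Equiv.Perm (Fin k), (F (ins none σ) + ∑ b, F (ins (some b) σ)) := by
  rw [← Equiv.sum_comp (finSuccEquivLast (n := k)).symm.permCongr,
    ← Equiv.sum_comp Equiv.Perm.decomposeOption.symm, Fintype.sum_prod_type_right]
  refine Finset.sum_congr rfl fun σ _ => ?_
  rw [Fintype.sum_option]
  rfl

lemma pf_ins_none {k : ℕ} (σ : Equiv.Perm (Fin k)) (i : ℕ) (hi : i < k) :
    pf (ins none σ) i = pf σ i := by
  unfold pf
  rw [dif_pos hi, dif_pos (by omega)]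
  have := ins_none σ ⟨i, hi⟩
  simp only [Fin.castSucc_mk] at this
  rw [this]; simp

lemma pf_ins_last {k : ℕ} (x : Option (Fin k)) (σ : Equiv.Perm (Fin k)) :
    pf (ins x σ) k = (finSuccEquivLast.symm x : Fin (k + 1)) := by
  unfold pf
  rw [dif_pos (by omega)]
  exact congrArg _ (ins_last x σ)

lemma Aq_odd (m : ℕ) : Aq ℤ[X] (2 * m + 1) X (-1) = (1 + X) ^ m * E (m + 1) := by
  unfold Aq
  simp only [weight (n := 2 * m + 1) m (Or.inr rfl)]
  set w : ℕ → ℕ → ℕ → ℤ[X] := fun j a b =>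
    if j < m then bw j a b else (if b = 2 * m + 1 then 1 else 0) with hw
  have hb := toBlocks (N := 2 * m + 1 + 1) (m + 1) (by ring) w (by
    intro i hi a b hab ha hb
    simp only [hw]
    by_cases h : i < m
    · simp only [h, if_true]; exact bw_anti i a b hab ha hb
    · have : i = m := by omega
      subst this
      simp [ha, hb])
  rw [sum_ins] at hb
  have hl : ∀ π : Equiv.Perm (Fin (2 * m + 1 + 1)),
      ∏ j ∈ range (m + 1), w j (pf π (2 * j)) (pf π (2 * j + 1)) =
      (∏ j ∈ range m, bw j (pf π (2 * j)) (pf π (2 * j + 1))) *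
        (if pf π (2 * m + 1) = 2 * m + 1 then 1 else 0) := by
    intro π
    rw [Finset.prod_range_succ]
    congr 1
    · refine Finset.prod_congr rfl fun j hj => ?_
      simp [hw, mem_range.mp hj]
    · simp [hw]
  simp only [hl, pf_ins_last, finSuccEquivLast_symm_none, finSuccEquivLast_symm_some] at hb
  have e : ∀ σ : Equiv.Perm (Fin (2 * m + 1)),
      ∏ j ∈ range m, bw j (pf (ins none σ) (2 * j)) (pf (ins none σ) (2 * j + 1)) =
      ∏ j ∈ range m, bw j (pf σ (2 * j)) (pf σ (2 * j + 1)) := by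
    intro σ
    refine Finset.prod_congr rfl fun j hj => ?_
    rw [mem_range] at hj
    rw [pf_ins_none _ _ (by omega), pf_ins_none _ _ (by omega)]
  have e' : ∀ b : Fin (2 * m + 1), ((b : ℕ) = 2 * m + 1) ↔ False := fun b => by
    have := b.2
    simp only [iff_false]; omega
  simp only [e, Fin.val_last, if_true, mul_one, Fin.val_castSucc, e', if_false, mul_zero,
    Finset.sum_const_zero, add_zero] at hb
  rw [hb, E, Finset.mul_sum]
  refine Finset.sum_congr rfl fun ρ _ => ?_
  rw [Fin.prod_univ_castSucc, Fin.prod_univ_castSucc]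
  have h1 : ∀ i : Fin m, w (i : ℕ) = bw i := by
    intro i; funext a b; simp [hw]
  have h2 : w m = fun _ b => if b = 2 * m + 1 then 1 else 0 := by
    funext a b; simp [hw]
  simp only [h1, h2, Fin.val_castSucc, bw_pair, Finset.prod_mul_distrib, Finset.prod_const,
    card_univ, Fintype.card_fin, Fin.lt_def, Fin.val_last]
  have h3 : ¬ (2 * (ρ (Fin.last m) : ℕ) = 2 * m + 1) := by omega
  have h4 : ¬ (m < (ρ (Fin.last m) : ℕ)) := by have := (ρ (Fin.last m)).2; omega
  simp [h3, h4]

lemma E_zero : E 0 = 1 := by simp [E]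

lemma E_succ (k : ℕ) : E (k + 1) = (1 + (k : ℤ[X]) * X) * E k + X * (1 - X) * derivative (E k) := by
  have hE : E (k + 1) = ∑ π : Equiv.Perm (Fin (k + 1)), ∏ i, (if i < π i then X else 1) := rfl
  rw [hE, sum_ins, E, derivative_sum, Finset.mul_sum, Finset.mul_sum, ← Finset.sum_add_distrib]
  refine Finset.sum_congr rfl fun σ _ => ?_
  simp only [Fin.prod_univ_castSucc, ins_none, ins_some, ins_last, finSuccEquivLast_symm_none,
    finSuccEquivLast_symm_some, lt_irrefl, if_false, mul_one, Fin.castSucc_lt_castSucc_iff]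
  have hlast : ∀ b : Fin k, ¬ (Fin.last k < b.castSucc) := fun b => not_lt.mpr (Fin.le_last _)
  simp only [hlast, if_false, mul_one]
  set s := univ.filter (fun i : Fin k => i < σ i) with hs
  have hprod : ∏ i : Fin k, (if i < σ i then (X : ℤ[X]) else 1) = X ^ s.card := by
    rw [← Finset.prod_filter, Finset.prod_const]
  have hterm : ∀ p : Fin k, ∏ j : Fin k,
      (if j.castSucc < (if σ j = σ p then Fin.last k else (σ j).castSucc) then (X : ℤ[X]) else 1) =
      if p < σ p then X ^ s.card else X * X ^ s.card := by
    intro p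
    rw [← hprod, ← Finset.mul_prod_erase univ _ (mem_univ p)]
    rw [← Finset.mul_prod_erase univ (fun i => if i < σ i then (X : ℤ[X]) else 1) (mem_univ p)]
    have : ∏ j ∈ univ.erase p,
      (if j.castSucc < (if σ j = σ p then Fin.last k else (σ j).castSucc) then (X : ℤ[X]) else 1) =
      ∏ j ∈ univ.erase p, (if j < σ j then (X : ℤ[X]) else 1) := by
      refine Finset.prod_congr rfl fun j hj => ?_
      rw [mem_erase] at hj
      rw [if_neg (fun h => hj.1 (σ.injective h))]
      simp
    rw [this]
    simp only [if_true, Fin.castSucc_lt_last]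
    split_ifs <;> ring
  rw [← Equiv.sum_comp σ]
  simp only [hterm, hprod]
  rw [Finset.sum_ite, Finset.sum_const, Finset.sum_const, nsmul_eq_mul, nsmul_eq_mul]
  have hc : ((univ.filter (fun i : Fin k => ¬ i < σ i)).card : ℤ[X]) = k - s.card := by
    have := Finset.card_filter_add_card_filter_not (s := (univ : Finset (Fin k)))
      (fun i => i < σ i)
    rw [card_univ, Fintype.card_fin] at this
    rw [eq_sub_iff_add_eq, add_comm]
    exact_mod_cast this
  rw [hc, ← hs]
  have hd : X * derivative ((X : ℤ[X]) ^ s.card) = (s.card : ℤ[X]) * X ^ s.card := by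
    rw [derivative_X_pow]
    cases s.card with
    | zero => simp
    | succ e => simp [pow_succ]; ring
  linear_combination (-(1 - X)) * hd

/-- `P 0 = 1`, `P k = X * E k` -/
noncomputable def P (k : ℕ) : ℤ[X] := if k = 0 then 1 else X * E k

lemma P_zero : P 0 = 1 := rfl
lemma P_of_succ (k : ℕ) : P (k + 1) = X * E (k + 1) := rfl

lemma P_succ (k : ℕ) :
    P (k + 1) = ((k : ℤ[X]) + 1) * X * P k + X * (1 - X) * derivative (P k) := by
  rw [P_of_succ, E_succ]
  cases k with
  | zero => simp [P_zero, E_zero]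
  | succ k =>
    rw [P_of_succ, derivative_mul, derivative_X]
    ring

lemma gauss (m : ℕ) : ∀ k, gaussR (-1 : ℤ[X]) (2 * m) (2 * k) = m.choose k ∧
    gaussR (-1 : ℤ[X]) (2 * m) (2 * k + 1) = 0 ∧
    gaussR (-1 : ℤ[X]) (2 * m + 1) (2 * k) = m.choose k ∧
    gaussR (-1 : ℤ[X]) (2 * m + 1) (2 * k + 1) = m.choose k := by
  have hz : ∀ n, gaussR (-1 : ℤ[X]) n 0 = 1 := fun n => by cases n <;> simp [gaussR]
  have o : ∀ k, (-1 : ℤ[X]) ^ (2 * k + 1) = -1 := fun k => Odd.neg_one_pow ⟨k, rfl⟩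
  have e : ∀ k, (-1 : ℤ[X]) ^ (2 * k + 1 + 1) = 1 := fun k =>
    Even.neg_one_pow ⟨k + 1, by ring⟩
  have hstep : ∀ n k, gaussR (-1 : ℤ[X]) (n + 1) (k + 1) = gaussR (-1) n k +
    (-1) ^ (k + 1) * gaussR (-1) n (k + 1) := fun n k => by rw [gaussR]
  have half : ∀ m : ℕ, (∀ k, gaussR (-1 : ℤ[X]) (2 * m) (2 * k) = m.choose k ∧
      gaussR (-1 : ℤ[X]) (2 * m) (2 * k + 1) = 0) → ∀ k,
      gaussR (-1 : ℤ[X]) (2 * m + 1) (2 * k) = m.choose k ∧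
      gaussR (-1 : ℤ[X]) (2 * m + 1) (2 * k + 1) = m.choose k := by
    intro m h k
    constructor
    · cases k with
      | zero => simp [hz]
      | succ k =>
        have h1 := (h (k + 1)).1
        rw [show 2 * (k + 1) = 2 * k + 1 + 1 by ring] at h1 ⊢
        rw [hstep, (h k).2, h1, e]; simp
    · rw [hstep, (h k).1, (h k).2]; simp
  have main : ∀ k, gaussR (-1 : ℤ[X]) (2 * m) (2 * k) = m.choose k ∧
      gaussR (-1 : ℤ[X]) (2 * m) (2 * k + 1) = 0 := by
    induction m with
    | zero =>
      intro k
      cases k with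
      | zero => simp [gaussR]
      | succ k => simp [gaussR, Nat.mul_succ]
    | succ m ih =>
      have h := half m ih
      intro k
      rw [show 2 * (m + 1) = 2 * m + 1 + 1 by ring]
      constructor
      · cases k with
        | zero => simp [hz]
        | succ k =>
          have h1 := (h (k + 1)).1
          rw [show 2 * (k + 1) = 2 * k + 1 + 1 by ring] at h1 ⊢
          rw [hstep, (h k).2, h1, e, Nat.choose_succ_succ]; push_cast; ring
      · rw [hstep, (h k).1, (h k).2, o]; ring
  intro k
  exact ⟨(main k).1, (main k).2, (half m main k).1, (half m main k).2⟩

/-- the sequence `1, X A_1, X A_2, ...` -/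
noncomputable def B (k : ℕ) : ℤ[X] := if k = 0 then 1 else X * Aq ℤ[X] k X (-1)

lemma B_even (i : ℕ) : B (2 * i) = (1 + X) ^ i * P i := by
  cases i with
  | zero => simp [B, P]
  | succ i =>
    have : B (2 * (i + 1)) = X * Aq ℤ[X] (2 * (i + 1)) X (-1) := by
      unfold B; rw [if_neg (by omega)]
    rw [this, Aq_even, P_of_succ]; ring

lemma B_odd (i : ℕ) : B (2 * i + 1) = (1 + X) ^ i * P (i + 1) := by
  have : B (2 * i + 1) = X * Aq ℤ[X] (2 * i + 1) X (-1) := by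
    unfold B; rw [if_neg (by omega)]
  rw [this, Aq_odd, P_of_succ]; ring

lemma Atilde_B (n : ℕ) : Atilde ℤ[X] n X (-1) = ∑ k ∈ range (n + 1), gaussR (-1) n k * B k := by
  rw [Finset.sum_range_succ']
  have hz : gaussR (-1 : ℤ[X]) n 0 = 1 := by cases n <;> simp [gaussR]
  have hI : ∀ (f : ℕ → ℤ[X]) (n : ℕ), ∑ i ∈ Icc 1 n, f i = ∑ i ∈ range n, f (i + 1) := by
    intro f n
    induction n with
    | zero => simp
    | succ n ih => rw [Finset.sum_Icc_succ_top (by omega), ih, Finset.sum_range_succ]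
  have hB : B 0 = 1 := by unfold B; rw [if_pos rfl]
  rw [Atilde, hI, hz, hB, mul_one, add_comm, Finset.mul_sum]
  have hS : ∀ i, X * (gaussR (-1) n (i + 1) * Aq ℤ[X] (i + 1) X (-1)) =
      gaussR (-1) n (i + 1) * B (i + 1) := by
    intro i
    have hBi : B (i + 1) = X * Aq ℤ[X] (i + 1) X (-1) := by
      unfold B; rw [if_neg (Nat.succ_ne_zero i)]
    rw [hBi]; ring
  simp only [hS]

lemma cv_one (b : ℕ → ℤ[X]) (m : ℕ) :
    cv (fun _ => 1) b m = ∑ i ∈ range (m + 1), (m.choose i : ℤ[X]) * b i := by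
  rw [cv_comm, cv, Finset.Nat.sum_antidiagonal_eq_sum_range_succ
    (fun i j => (m.choose i : ℤ[X]) * (b i * 1))]
  simp

lemma Atilde_even (m : ℕ) : Atilde ℤ[X] (2 * m) X (-1) =
    cv (fun _ => 1) (fun k => (1 + X) ^ k * P k) m := by
  have h : Atilde ℤ[X] (2 * m) X (-1) =
      ∑ k ∈ range (2 * (m + 1)), gaussR (-1) (2 * m) k * B k := by
    rw [Atilde_B, show 2 * (m + 1) = 2 * m + 1 + 1 by ring, Finset.sum_range_succ _ (2 * m + 1),
      (gauss m m).2.1]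
    simp
  rw [h, sum_pairs, cv_one]
  refine Finset.sum_congr rfl fun i _ => ?_
  rw [(gauss m i).1, (gauss m i).2.1, B_even]; ring

lemma Atilde_odd (m : ℕ) : Atilde ℤ[X] (2 * m + 1) X (-1) =
    cv (fun _ => 1) (fun k => (1 + X) ^ k * P k) m +
    cv (fun _ => 1) (fun k => (1 + X) ^ k * P (k + 1)) m := by
  rw [Atilde_B, show 2 * m + 1 + 1 = 2 * (m + 1) by ring, sum_pairs, cv_one, cv_one,
    ← Finset.sum_add_distrib]
  refine Finset.sum_congr rfl fun i _ => ?_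
  rw [(gauss m i).2.2.1, (gauss m i).2.2.2, B_even, B_odd]

lemma Atilde_cone (n : ℕ) : Atilde ℤ[X] n X (-1) ∈ Cone n := by
  have hq := quad P P_zero P_succ
  rcases Nat.even_or_odd' n with ⟨m, rfl | rfl⟩
  · rw [Atilde_even]; exact even_cone P P_zero hq m
  · rw [Atilde_odd]; exact odd_cone P P_zero hq m

end SBE

/-- for every n ≥ 1 the signed binomial-Eulerian polynomial
`Ã_n(t,-1)` is palindromic of degree n and unimodal. -/
theorem stmt12 (n : ℕ) (hn : 1 ≤ n) :
    (Atilde (Polynomial ℤ) n Polynomial.X (-1)).natDegree = n ∧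
    (∀ i ≤ n,
      (Atilde (Polynomial ℤ) n Polynomial.X (-1)).coeff i =
        (Atilde (Polynomial ℤ) n Polynomial.X (-1)).coeff (n - i)) ∧
    (∃ c : ℕ,
      (∀ i < c,
        (Atilde (Polynomial ℤ) n Polynomial.X (-1)).coeff i ≤
          (Atilde (Polynomial ℤ) n Polynomial.X (-1)).coeff (i + 1)) ∧
      (∀ i, c ≤ i →
        (Atilde (Polynomial ℤ) n Polynomial.X (-1)).coeff (i + 1) ≤
          (Atilde (Polynomial ℤ) n Polynomial.X (-1)).coeff i)) := by
  have hc := SBE.Atilde_cone n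
  obtain ⟨h1, h2, h3, h4⟩ := SBE.cone_props hc
  refine ⟨?_, h1, n / 2, h3, h4⟩
  have hz : (Atilde (Polynomial ℤ) n Polynomial.X (-1)).coeff 0 = 1 := by
    rw [Atilde, Polynomial.coeff_add, Polynomial.coeff_X_mul_zero]
    simp
  have hn' : (Atilde (Polynomial ℤ) n Polynomial.X (-1)).coeff n = 1 := by
    rw [h1 n le_rfl, Nat.sub_self, hz]
  apply le_antisymm
  · rw [Polynomial.natDegree_le_iff_coeff_eq_zero]
    exact fun i hi => h2 i hi
  · apply Polynomial.le_natDegree_of_ne_zero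
    rw [hn']; exact one_ne_zero
end
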